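/- For every κ > 0 and s ∈ (0,1], there exist ε = ε(κ,s) ∈ (0,1/2] and λ₀ = λ₀(ε,κ,s) > 0 such that the following holds for all λ ∈ (0,λ₀]: let λ ≤ t ≤ 1, let Σ be the smallest dyadic rational ≥ √(λ/t), and let Ω = {(p,v) : p ∈ P and v ∈ E(p)} be a (λ,Σ,s,λ^{−ε})-configuration. Then there exist constants C_κ ≥ 1 and c_κ > 0 depending only on κ, and a (λ,Σ,s,C_κ λ^{−ε})-configuration G ⊂ Ω with |G| ≥ c_κ |Ω|, such that for every (p,v) ∈ G: #{(p',v') ∈ G : Δ(p,p') ≤ λ^{1−ε}, λ^ε t ≤ |p − p'| ≤ λ^{−ε} t, and λ^{−ε}·R^λ_Σ(p,v) ∩ λ^{−ε}·R^λ_Σ(p',v') ≠ ∅} ≤ λ^{s−κ} |P|. -/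

import Mathlib

open Metric Set

noncomputable section

/-- The plane `ℝ²`. -/
abbrev Plane := EuclideanSpace ℝ (Fin 2)

/-- The parameter space `ℝ² × ℝ` of circles: a pair `(x, r)` of a centre and a radius. -/
abbrev Param := (EuclideanSpace ℝ (Fin 2)) × ℝ

/-- The point of `ℝ²` with coordinates `a`, `b`. -/
def mk2 (a b : ℝ) : Plane := (WithLp.equiv 2 (Fin 2 → ℝ)).symm ![a, b]

/-- The Euclidean distance on `ℝ² × ℝ`, viewed as `ℝ³`. -/
def pdist (p q : Param) : ℝ := Real.sqrt (dist p.1 q.1 ^ 2 + (p.2 - q.2) ^ 2)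

/-- The tangency parameter `Δ(p,q) = ||x - x'| - |r - r'||`. -/
def tang (p q : Param) : ℝ := abs (dist p.1 q.1 - |p.2 - q.2|)

/-- The domain `𝐃 = {(x,r) : |x| ≤ 1/4, r ∈ [1/2, 1]}`. -/
def domD : Set Param := {p | ‖p.1‖ ≤ 1 / 4 ∧ p.2 ∈ Set.Icc (1 / 2 : ℝ) 1}

/-- The circle `S(p)` with centre `p.1` and radius `p.2`. -/
def circ (p : Param) : Set Plane := Metric.sphere p.1 p.2

/-- The closed `δ`-annulus `S^δ(p)` around the circle `S(p)`. -/
def annulus (δ : ℝ) (p : Param) : Set Plane := {w | Metric.infDist w (circ p) ≤ δ}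

/-- The `(δ,σ)`-rectangle `R^δ_σ(p,v) = S^δ(p) ∩ B(v,σ)`. -/
def rect (δ σ : ℝ) (p : Param) (v : Plane) : Set Plane :=
  annulus δ p ∩ Metric.closedBall v σ

/-- Admissible data `(p, v)` for a rectangle: `p ∈ 𝐃` and `v ∈ S(p)`. -/
def IsRectData (r : Param × Plane) : Prop := r.1 ∈ domD ∧ r.2 ∈ circ r.1

/-- `C`-comparability of two rectangles (given by their data): there is a third
`(δ,σ)`-rectangle `R` with `R₁ ∪ R₂ ⊆ C·R`. -/
def Comp (δ σ C : ℝ) (r₁ r₂ : Param × Plane) : Prop :=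
  ∃ r : Param × Plane, IsRectData r ∧
    rect δ σ r₁.1 r₁.2 ∪ rect δ σ r₂.1 r₂.2 ⊆ rect (C * δ) (C * σ) r.1 r.2

/-- The index of the dyadic `δ`-cube of `ℝ²` containing a point. -/
def idx2 (δ : ℝ) (v : Plane) : ℤ × ℤ := (⌊v 0 / δ⌋, ⌊v 1 / δ⌋)

/-- The index of the dyadic `δ`-cube of `ℝ³ = ℝ² × ℝ` containing a point. -/
def idx3 (δ : ℝ) (p : Param) : (ℤ × ℤ) × ℤ := (idx2 δ p.1, ⌊p.2 / δ⌋)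

/-- `|E|_δ`: the number of dyadic `δ`-cubes intersecting `E ⊆ ℝ²`. -/
def count2 (δ : ℝ) (E : Set Plane) : ℕ := Nat.card (idx2 δ '' E)

/-- `|P|_δ`: the number of dyadic `δ`-cubes intersecting `P ⊆ ℝ³`. -/
def count3 (δ : ℝ) (P : Set Param) : ℕ := Nat.card (idx3 δ '' P)

/-- `|Ω|_δ`: the number of dyadic `δ`-cubes of `ℝ⁵ = ℝ³ × ℝ²` intersecting `Ω`. -/
def count5 (δ : ℝ) (Ω : Set (Param × Plane)) : ℕ :=
  Nat.card ((fun ω => (idx3 δ ω.1, idx2 δ ω.2)) '' Ω)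

/-- A `(δ,s,C)`-set in the plane. -/
def IsDSet2 (δ s C : ℝ) (E : Set Plane) : Prop :=
  Bornology.IsBounded E ∧ ∀ (x : Plane) (r : ℝ), δ ≤ r →
    (count2 δ (E ∩ Metric.closedBall x r) : ℝ) ≤ C * r ^ s * (count2 δ E : ℝ)

/-- A `(δ,s,C)`-set in `ℝ³ = ℝ² × ℝ`. -/
def IsDSet3 (δ s C : ℝ) (P : Set Param) : Prop :=
  Bornology.IsBounded P ∧ ∀ (x : Param) (r : ℝ), δ ≤ r →
    (count3 δ (P ∩ {q | pdist q x ≤ r}) : ℝ) ≤ C * r ^ s * (count3 δ P : ℝ)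

/-- `x ∈ 2^{-ℕ}`. -/
def IsDyadic (x : ℝ) : Prop := ∃ n : ℕ, x = (2 : ℝ) ^ (-(n : ℤ))

/-- The smallest dyadic rational `2^{-n} ≥ σ` (for `σ ∈ (0,1]`). -/
def dyadicCeil (σ : ℝ) : ℝ := (2 : ℝ) ^ (-⌊Real.logb 2 σ⁻¹⌋)

/-- Indices of dyadic cubes in `ℝ³ = ℝ² × ℝ`. -/
abbrev CubeIdx := (ℤ × ℤ) × ℤ

/-- The dyadic cube of side length `δ` with index `k`. -/
def cubeSet (δ : ℝ) (k : CubeIdx) : Set Param :=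
  {p | (k.1.1 : ℝ) * δ ≤ p.1 0 ∧ p.1 0 < ((k.1.1 : ℝ) + 1) * δ ∧
       (k.1.2 : ℝ) * δ ≤ p.1 1 ∧ p.1 1 < ((k.1.2 : ℝ) + 1) * δ ∧
       (k.2 : ℝ) * δ ≤ p.2 ∧ p.2 < ((k.2 : ℝ) + 1) * δ}

/-- The centre of the dyadic cube of side length `δ` with index `k`. -/
def cubeCtr (δ : ℝ) (k : CubeIdx) : Param :=
  (mk2 (((k.1.1 : ℝ) + 1 / 2) * δ) (((k.1.2 : ℝ) + 1 / 2) * δ), ((k.2 : ℝ) + 1 / 2) * δ)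

/-- The unit vector with angle `θ`. -/
def dir (θ : ℝ) : Plane := mk2 (Real.cos θ) (Real.sin θ)

/-- The `j`-th (half-open) arc of the partition `𝒮_σ(p)` of the circle `S(p)`
into arcs of length `2πrσ`. -/
def arcSet (p : Param) (σ : ℝ) (j : ℤ) : Set Plane :=
  {w | ∃ θ : ℝ, (j : ℝ) * (2 * Real.pi * σ) ≤ θ ∧ θ < ((j : ℝ) + 1) * (2 * Real.pi * σ) ∧
    w = p.1 + p.2 • dir θ}

/-- The centre of the `j`-th arc of `𝒮_σ(p)`. -/
def arcCenterAt (p : Param) (σ : ℝ) (j : ℤ) : Plane :=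
  p.1 + p.2 • dir (((j : ℝ) + 1 / 2) * (2 * Real.pi * σ))

/-- Valid indices for the arcs of `𝒮_σ(p)`. -/
def validArc (σ : ℝ) (j : ℤ) : Prop := 0 ≤ j ∧ (j : ℝ) < σ⁻¹

/-- The (one-sided) cone `V(p, I)` centred at the centre of `p` and spanned by `I`. -/
def cone (p : Param) (I : Set Plane) : Set Plane :=
  {x | ∃ e ∈ I, ∃ t : ℝ, 0 ≤ t ∧ x = p.1 + t • (e - p.1)}

/-- A pair: (index of a dyadic cube in `ℝ³`, index of an arc). -/
abbrev DPair := CubeIdx × ℤ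

/-- The relation `(p,v) ≺ (𝐩,𝐯)` between pairs at scales `(δ,σ)` and `(Δ,Σ)`. -/
def prec (δ σ Δ Sg : ℝ) (ω W : DPair) : Prop :=
  cubeSet δ ω.1 ⊆ cubeSet Δ W.1 ∧
  arcCenterAt (cubeCtr δ ω.1) σ ω.2 ∈ cone (cubeCtr Δ W.1) (arcSet (cubeCtr Δ W.1) Sg W.2)

/-- The `(Δ,Σ)`-skeleton `Ω^Δ_Σ` of a set of pairs at scales `(δ,σ)`. -/
def skeleton (δ σ Δ Sg : ℝ) (Ω : Set DPair) : Set DPair :=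
  {W | cubeSet Δ W.1 ⊆ domD ∧ validArc Sg W.2 ∧ ∃ ω ∈ Ω, prec δ σ Δ Sg ω W}

/-- The cube family `P` of a configuration. -/
def configP (Ω : Set DPair) : Set CubeIdx := Prod.fst '' Ω

/-- The arc family `E_σ(p)` of a configuration. -/
def configE (Ω : Set DPair) (k : CubeIdx) : Set ℤ := {j | (k, j) ∈ Ω}

/-- A (dyadic) `(δ,σ,s,C,M)`-configuration. -/
def IsConfigD (δ σ s C : ℝ) (M : ℕ) (Ω : Set DPair) : Prop :=
  (configP Ω).Nonempty ∧
  (∀ k ∈ configP Ω, cubeSet δ k ⊆ domD) ∧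
  IsDSet3 δ s C (⋃ k ∈ configP Ω, cubeSet δ k) ∧
  ∀ k ∈ configP Ω,
    (∀ j ∈ configE Ω k, validArc σ j) ∧
    IsDSet2 σ s C (⋃ j ∈ configE Ω k, arcSet (cubeCtr δ k) σ j) ∧
    Nat.card (configE Ω k) = M

/-- The partial multiplicity function `m^{ρ_λ,ρ_t,C}_{Δ,λ,t}(ω ∣ G)`, counting pairs in the
`(Δ, σa)`-skeleton of `G`; the geometric data of `ω` is given by the circle parameter `pω`
(the centre of the cube of `ω`) and the arc centre `vω`. -/
def pMult (baseδ baseσ Δ σa lam t ρl ρt C : ℝ) (G : Set DPair) (pω : Param) (vω : Plane) : ℕ :=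
  Nat.card {ω' : DPair | ω' ∈ skeleton baseδ baseσ Δ σa G ∧
    (lam ≤ ρl * Δ ∨ lam / ρl ≤ tang pω (cubeCtr Δ ω'.1)) ∧
    tang pω (cubeCtr Δ ω'.1) ≤ ρl * lam ∧
    t / ρt ≤ pdist pω (cubeCtr Δ ω'.1) ∧
    pdist pω (cubeCtr Δ ω'.1) ≤ ρt * t ∧
    (rect (C * Δ) (C * σa) pω vω ∩
      rect (C * Δ) (C * σa) (cubeCtr Δ ω'.1) (arcCenterAt (cubeCtr Δ ω'.1) σa ω'.2)).Nonempty}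

/-- A `δ`-separated set in `ℝ³ = ℝ² × ℝ`. -/
def sep3 (δ : ℝ) (A : Set Param) : Prop := ∀ p ∈ A, ∀ q ∈ A, p ≠ q → δ ≤ pdist p q

/-- A `(δ,ε)`-almost `t`-bipartite pair. -/
def AlmostBipartite (δ ε t : ℝ) (W B : Set Param) : Prop :=
  sep3 δ W ∧ sep3 δ B ∧ (∀ p ∈ W, ∀ q ∈ B, δ ^ ε * t ≤ pdist p q) ∧
    ∀ p ∈ W ∪ B, ∀ q ∈ W ∪ B, pdist p q ≤ δ ^ (-ε) * t

/-- A `t`-bipartite pair (relative to the scale `δ`). -/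
def Bipartite (δ t : ℝ) (W B : Set Param) : Prop :=
  sep3 δ W ∧ sep3 δ B ∧
  (∀ p ∈ W, ∀ q ∈ W, pdist p q ≤ t) ∧ (∀ p ∈ B, ∀ q ∈ B, pdist p q ≤ t) ∧
  (∀ p ∈ B, ∀ q ∈ W, t ≤ pdist p q) ∧
  ∀ p ∈ W ∪ B, ∀ q ∈ W ∪ B, pdist p q ≤ 100 * t



open Classical in
lemma mantel {α : Type*} (S : Finset α) (R : α → α → Prop)
    (hs : ∀ x y, R x y → R y x)
    (ht : ∀ x ∈ S, ∀ y ∈ S, ∀ z ∈ S, R x y → R y z → R x z → False) :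
    ((S ×ˢ S).filter (fun z => R z.1 z.2)).card ≤
      ((S ×ˢ S).filter (fun z => ¬ R z.1 z.2)).card := by
  set d : α → ℕ := fun x => (S.filter (fun y => R x y)).card with hd
  set e := ((S ×ˢ S).filter (fun z => R z.1 z.2)).card with he
  have hsum : e = ∑ x ∈ S, d x := by
    simp only [he, hd, Finset.card_filter, Finset.sum_product]
  have htot : e + ((S ×ˢ S).filter (fun z => ¬ R z.1 z.2)).card = S.card * S.card := by
    rw [he, Finset.card_filter_add_card_filter_not, Finset.card_product]
  have hdeg : ∀ x ∈ S, ∀ y ∈ S, R x y → d x + d y ≤ S.card := by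
    intro x hx y hy hxy
    have hdis : Disjoint (S.filter (fun z => R x z)) (S.filter (fun z => R y z)) := by
      rw [Finset.disjoint_left]
      intro z hz hz'
      simp only [Finset.mem_filter] at hz hz'
      exact ht x hx y hy z hz.1 hxy hz'.2 hz.2
    simp only [hd]
    rw [← Finset.card_union_of_disjoint hdis]
    apply Finset.card_le_card
    intro z hz
    simp only [Finset.mem_union, Finset.mem_filter] at hz
    tauto
  have h1 : ∑ x ∈ S, ∑ y ∈ S, (if R x y then (d x + d y) else 0) ≤ S.card * e := by
    rw [he, Finset.card_filter, Finset.sum_product, Finset.mul_sum]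
    apply Finset.sum_le_sum
    intro x hx
    rw [Finset.mul_sum]
    apply Finset.sum_le_sum
    intro y hy
    split_ifs with h
    · simpa using hdeg x hx y hy h
    · simp
  have h2 : ∑ x ∈ S, ∑ y ∈ S, (if R x y then (d x + d y) else 0) = 2 * ∑ x ∈ S, d x ^ 2 := by
    have ha : ∑ x ∈ S, ∑ y ∈ S, (if R x y then d x else 0) = ∑ x ∈ S, d x ^ 2 := by
      apply Finset.sum_congr rfl
      intro x hx
      rw [← Finset.sum_filter, Finset.sum_const, smul_eq_mul, sq]
    have hb : ∑ x ∈ S, ∑ y ∈ S, (if R x y then d y else 0) = ∑ x ∈ S, d x ^ 2 := by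
      rw [Finset.sum_comm, ← ha]
      apply Finset.sum_congr rfl
      intro x hx
      apply Finset.sum_congr rfl
      intro y hy
      have : R y x ↔ R x y := ⟨hs _ _, hs _ _⟩
      simp [this]
    rw [two_mul]
    nth_rewrite 1 [← ha]
    rw [← hb, ← Finset.sum_add_distrib]
    apply Finset.sum_congr rfl
    intro x hx
    rw [← Finset.sum_add_distrib]
    apply Finset.sum_congr rfl
    intro y hy
    split_ifs <;> simp
  have h3 : e ^ 2 ≤ S.card * ∑ x ∈ S, d x ^ 2 := by
    rw [hsum]; exact sq_sum_le_card_mul_sum_sq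
  have h4 : 2 * e ^ 2 ≤ S.card * S.card * e := by
    nlinarith [h1, h2, h3, Nat.zero_le S.card]
  rcases Nat.eq_zero_or_pos e with h0 | h0
  · omega
  · have : 2 * e ≤ S.card * S.card := by
      have : (2 * e) * e ≤ (S.card * S.card) * e := by nlinarith
      exact Nat.le_of_mul_le_mul_right this h0
    omega

open Classical in
/-- quadruples forming a 4-cycle -/
def KK {α β : Type*} (W : Finset α) (B : Finset β) (E : α → β → Prop) :
    Finset ((α × α) × (β × β)) :=
  ((W ×ˢ W) ×ˢ (B ×ˢ B)).filter
    (fun z => E z.1.1 z.2.1 ∧ E z.1.1 z.2.2 ∧ E z.1.2 z.2.1 ∧ E z.1.2 z.2.2)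

lemma mem_KK {α β : Type*} {W : Finset α} {B : Finset β} {E : α → β → Prop}
    {z : (α × α) × (β × β)} : z ∈ KK W B E ↔
    (z.1.1 ∈ W ∧ z.1.2 ∈ W ∧ z.2.1 ∈ B ∧ z.2.2 ∈ B) ∧
    E z.1.1 z.2.1 ∧ E z.1.1 z.2.2 ∧ E z.1.2 z.2.1 ∧ E z.1.2 z.2.2 := by
  simp only [KK, Finset.mem_filter, Finset.mem_product]
  tauto

open Classical in
lemma KK_half {α β : Type*} (W : Finset α) (B : Finset β) (E : α → β → Prop)
    (Q : α → α → ℝ) (Q' : β → β → ℝ) (q ρ : ℝ)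
    (hQs : ∀ x y, Q x y = Q y x)
    (H1 : ∀ z ∈ KK W B E, q < Q z.1.1 z.1.2 → q < Q' z.2.1 z.2.2 →
      Q' z.2.1 z.2.2 < Q z.1.1 z.1.2 → 4 * Q' z.2.1 z.2.2 ≤ Q z.1.1 z.1.2)
    (H2 : ∀ b b' w₀ w₁ w₂, E w₀ b → E w₁ b → E w₂ b → E w₀ b' → E w₁ b' → E w₂ b' →
      q < Q' b b' → q < Q w₀ w₁ → q < Q w₁ w₂ → q < Q w₀ w₂ →
      Q' b b' < Q w₀ w₁ → Q' b b' < Q w₁ w₂ → Q' b b' < Q w₀ w₂ → False) :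
    ((KK W B E).filter (fun z => q < Q z.1.1 z.1.2 ∧ q < Q' z.2.1 z.2.2 ∧
      Q' z.2.1 z.2.2 < Q z.1.1 z.1.2 ∧ Q z.1.1 z.1.2 ≤ ρ)).card ≤
    ((KK W B E).filter (fun z => q < Q z.1.1 z.1.2 ∧ q < Q' z.2.1 z.2.2 ∧
      Q z.1.1 z.1.2 ≤ Q' z.2.1 z.2.2 ∧ Q' z.2.1 z.2.2 ≤ ρ / 4)).card +
    ((KK W B E).filter (fun z => Q z.1.1 z.1.2 ≤ q)).card := by
  have hdis : ∀ (p : (α × α) × (β × β) → Prop) [DecidablePred p], ((KK W B E).filter p).card =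
      ∑ y ∈ B ×ˢ B, ((((W.filter (fun w => E w y.1 ∧ E w y.2)) ×ˢ
        (W.filter (fun w => E w y.1 ∧ E w y.2)))).filter (fun x => p (x, y))).card := by
    intro p _
    rw [Finset.card_eq_sum_card_fiberwise (f := Prod.snd) (t := B ×ˢ B)]
    · apply Finset.sum_congr rfl
      intro y hy
      refine Finset.card_bij' (fun z _ => z.1) (fun x _ => (x, y)) ?_ ?_ ?_ ?_
      · rintro ⟨⟨a, b⟩, c⟩ hz
        simp only [Finset.mem_filter, mem_KK] at hz
        obtain ⟨⟨hz, hp⟩, rfl⟩ := hz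
        simp only [Finset.mem_filter, Finset.mem_product]
        tauto
      · rintro ⟨a, b⟩ hz
        simp only [Finset.mem_filter, Finset.mem_product] at hz hy
        simp only [Finset.mem_filter, mem_KK]
        tauto
      · rintro ⟨⟨a, b⟩, c⟩ hz
        simp only [Finset.mem_filter] at hz
        rw [← hz.2]
      · rintro ⟨a, b⟩ hz
        rfl
    · intro z hz
      have hz := (mem_KK.1 (Finset.mem_filter.1 hz).1)
      simp only [Finset.coe_product, Set.mem_prod, Finset.mem_coe]
      tauto
  rw [hdis, hdis, hdis, ← Finset.sum_add_distrib]
  apply Finset.sum_le_sum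
  rintro ⟨b, b'⟩ hb
  simp only [Finset.mem_product] at hb
  set S := W.filter (fun w => E w b ∧ E w b') with hS
  by_cases hc : q < Q' b b' ∧ Q' b b' ≤ ρ / 4
  · have hm := mantel S (fun w w' => q < Q w w' ∧ Q' b b' < Q w w')
      (fun x y h => by rw [hQs y x]; exact h)
      (by
        intro x hx y hy z hz h1 h2 h3
        simp only [hS, Finset.mem_filter] at hx hy hz
        exact H2 b b' x y z hx.2.1 hy.2.1 hz.2.1 hx.2.2 hy.2.2 hz.2.2 hc.1 h1.1 h2.1 h3.1
          h1.2 h2.2 h3.2)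
    refine le_trans (le_trans (Finset.card_le_card ?_) hm) ?_
    · intro z hz
      simp only [Finset.mem_filter] at hz ⊢
      tauto
    · refine le_trans (Finset.card_le_card ?_) (Finset.card_union_le _ _)
      intro z hz
      simp only [Finset.mem_filter, Finset.mem_union, not_and, not_lt] at hz ⊢
      by_cases h : q < Q z.1 z.2
      · left; exact ⟨hz.1, h, hc.1, hz.2 h, hc.2⟩
      · right; exact ⟨hz.1, not_lt.1 h⟩
  · have : ((S ×ˢ S).filter (fun x => q < Q x.1 x.2 ∧ q < Q' b b' ∧
        Q' b b' < Q x.1 x.2 ∧ Q x.1 x.2 ≤ ρ)) = ∅ := by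
      apply Finset.filter_eq_empty_iff.2
      rintro ⟨x, y⟩ hx ⟨h1, h2, h3, h4⟩
      simp only [hS, Finset.mem_filter, Finset.mem_product] at hx
      have := H1 ((x, y), (b, b')) (mem_KK.2 (by simp only; tauto)) h1 h2 h3
      simp only at this h4
      exact hc ⟨h2, by linarith⟩
    simp only [this, Finset.card_empty]
    exact Nat.zero_le _

open Classical in
lemma KK_swap {α β : Type*} (W : Finset α) (B : Finset β) (E : α → β → Prop)
    (p : (α × α) × (β × β) → Prop) [DecidablePred p] :
    ((KK W B E).filter p).card = ((KK B W (fun b w => E w b)).filter (fun z => p z.swap)).card := by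
  refine Finset.card_bij' (fun z _ => z.swap) (fun z _ => z.swap) ?_ ?_ ?_ ?_
  · rintro ⟨⟨a, b⟩, ⟨c, d⟩⟩ hz
    simp only [Finset.mem_filter, mem_KK, Prod.swap] at hz ⊢
    tauto
  · rintro ⟨⟨a, b⟩, ⟨c, d⟩⟩ hz
    simp only [Finset.mem_filter, mem_KK, Prod.swap] at hz ⊢
    tauto
  · intros; simp
  · intros; simp

open Classical in
lemma KK_rec {α β : Type*} (W : Finset α) (B : Finset β) (E : α → β → Prop)
    (Q : α → α → ℝ) (Q' : β → β → ℝ) (q ρ : ℝ) (hq : 0 < q)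
    (hQs : ∀ x y, Q x y = Q y x) (hQs' : ∀ x y, Q' x y = Q' y x)
    (H1 : ∀ z ∈ KK W B E, q < Q z.1.1 z.1.2 → q < Q' z.2.1 z.2.2 →
      4 * Q' z.2.1 z.2.2 ≤ Q z.1.1 z.1.2 ∨ 4 * Q z.1.1 z.1.2 ≤ Q' z.2.1 z.2.2)
    (H2 : ∀ b b' w₀ w₁ w₂, E w₀ b → E w₁ b → E w₂ b → E w₀ b' → E w₁ b' → E w₂ b' →
      q < Q' b b' → q < Q w₀ w₁ → q < Q w₁ w₂ → q < Q w₀ w₂ →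
      Q' b b' < Q w₀ w₁ → Q' b b' < Q w₁ w₂ → Q' b b' < Q w₀ w₂ → False)
    (H2' : ∀ w w' b₀ b₁ b₂, E w b₀ → E w b₁ → E w b₂ → E w' b₀ → E w' b₁ → E w' b₂ →
      q < Q w w' → q < Q' b₀ b₁ → q < Q' b₁ b₂ → q < Q' b₀ b₂ →
      Q w w' < Q' b₀ b₁ → Q w w' < Q' b₁ b₂ → Q w w' < Q' b₀ b₂ → False) :
    ((KK W B E).filter (fun z => q < Q z.1.1 z.1.2 ∧ q < Q' z.2.1 z.2.2 ∧
      Q' z.2.1 z.2.2 ≤ ρ ∧ Q z.1.1 z.1.2 ≤ ρ)).card ≤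
    ((KK W B E).filter (fun z => q < Q z.1.1 z.1.2 ∧ q < Q' z.2.1 z.2.2 ∧
      Q' z.2.1 z.2.2 ≤ ρ / 4 ∧ Q z.1.1 z.1.2 ≤ ρ / 4)).card +
    (((KK W B E).filter (fun z => Q z.1.1 z.1.2 ≤ q)).card +
    ((KK W B E).filter (fun z => Q' z.2.1 z.2.2 ≤ q)).card) := by
  have ha := KK_half W B E Q Q' q ρ hQs (fun z hz h1 h2 h3 => by
    rcases H1 z hz h1 h2 with h | h <;> linarith) H2
  have hb := KK_half B W (fun b w => E w b) Q' Q q ρ hQs' (fun z hz h1 h2 h3 => by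
    have hz' : z.swap ∈ KK W B E := by
      rw [mem_KK] at hz ⊢
      simp only [Prod.swap]
      tauto
    rcases H1 z.swap hz' h2 h1 with h | h <;> simp only [Prod.swap] at h <;> linarith)
    (fun w w' b₀ b₁ b₂ h1 h2 h3 h4 h5 h6 => H2' w w' b₀ b₁ b₂ h1 h2 h3 h4 h5 h6)
  have s1 := KK_swap W B E (fun z => q < Q' z.2.1 z.2.2 ∧ q < Q z.1.1 z.1.2 ∧
      Q z.1.1 z.1.2 < Q' z.2.1 z.2.2 ∧ Q' z.2.1 z.2.2 ≤ ρ)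
  have s2 := KK_swap W B E (fun z => q < Q' z.2.1 z.2.2 ∧ q < Q z.1.1 z.1.2 ∧
      Q' z.2.1 z.2.2 ≤ Q z.1.1 z.1.2 ∧ Q z.1.1 z.1.2 ≤ ρ / 4)
  have s3 := KK_swap W B E (fun z => Q' z.2.1 z.2.2 ≤ q)
  simp only [Prod.fst_swap, Prod.snd_swap] at s1 s2 s3
  rw [← s1, ← s2, ← s3] at hb
  have hL : ((KK W B E).filter (fun z => q < Q z.1.1 z.1.2 ∧ q < Q' z.2.1 z.2.2 ∧
      Q' z.2.1 z.2.2 ≤ ρ ∧ Q z.1.1 z.1.2 ≤ ρ)).card ≤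
      ((KK W B E).filter (fun z => q < Q z.1.1 z.1.2 ∧ q < Q' z.2.1 z.2.2 ∧
      Q' z.2.1 z.2.2 < Q z.1.1 z.1.2 ∧ Q z.1.1 z.1.2 ≤ ρ)).card +
      ((KK W B E).filter (fun z => q < Q' z.2.1 z.2.2 ∧ q < Q z.1.1 z.1.2 ∧
      Q z.1.1 z.1.2 < Q' z.2.1 z.2.2 ∧ Q' z.2.1 z.2.2 ≤ ρ)).card := by
    refine le_trans (Finset.card_le_card ?_) (Finset.card_union_le _ _)
    intro z hz
    simp only [Finset.mem_filter, Finset.mem_union] at hz ⊢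
    obtain ⟨h0, h1, h2, h3, h4⟩ := hz
    rcases H1 z h0 h1 h2 with h | h
    · left; exact ⟨h0, h1, h2, by linarith, h4⟩
    · right; exact ⟨h0, h2, h1, by linarith, h3⟩
  have hR : ((KK W B E).filter (fun z => q < Q z.1.1 z.1.2 ∧ q < Q' z.2.1 z.2.2 ∧
      Q z.1.1 z.1.2 ≤ Q' z.2.1 z.2.2 ∧ Q' z.2.1 z.2.2 ≤ ρ / 4)).card +
      ((KK W B E).filter (fun z => q < Q' z.2.1 z.2.2 ∧ q < Q z.1.1 z.1.2 ∧
      Q' z.2.1 z.2.2 ≤ Q z.1.1 z.1.2 ∧ Q z.1.1 z.1.2 ≤ ρ / 4)).card ≤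
      ((KK W B E).filter (fun z => q < Q z.1.1 z.1.2 ∧ q < Q' z.2.1 z.2.2 ∧
      Q' z.2.1 z.2.2 ≤ ρ / 4 ∧ Q z.1.1 z.1.2 ≤ ρ / 4)).card := by
    rw [← Finset.card_union_of_disjoint]
    · apply Finset.card_le_card
      intro z hz
      simp only [Finset.mem_filter, Finset.mem_union] at hz ⊢
      rcases hz with ⟨h0, h1, h2, h3, h4⟩ | ⟨h0, h1, h2, h3, h4⟩
      · exact ⟨h0, h1, h2, h4, h3.trans h4⟩
      · exact ⟨h0, h2, h1, h3.trans h4, h4⟩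
    · rw [Finset.disjoint_left]
      intro z hz hz'
      simp only [Finset.mem_filter] at hz hz'
      obtain ⟨h0, h1, h2, h3, h4⟩ := hz
      obtain ⟨_, _, _, h5, _⟩ := hz'
      rcases H1 z h0 h1 h2 with h | h <;> linarith
  omega

open Classical in
lemma KK_total {α β : Type*} (W : Finset α) (B : Finset β) (E : α → β → Prop)
    (Q : α → α → ℝ) (Q' : β → β → ℝ) (q ρ : ℝ) (hq : 0 < q)
    (hQs : ∀ x y, Q x y = Q y x) (hQs' : ∀ x y, Q' x y = Q' y x)
    (H1 : ∀ z ∈ KK W B E, q < Q z.1.1 z.1.2 → q < Q' z.2.1 z.2.2 →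
      4 * Q' z.2.1 z.2.2 ≤ Q z.1.1 z.1.2 ∨ 4 * Q z.1.1 z.1.2 ≤ Q' z.2.1 z.2.2)
    (H2 : ∀ b b' w₀ w₁ w₂, E w₀ b → E w₁ b → E w₂ b → E w₀ b' → E w₁ b' → E w₂ b' →
      q < Q' b b' → q < Q w₀ w₁ → q < Q w₁ w₂ → q < Q w₀ w₂ →
      Q' b b' < Q w₀ w₁ → Q' b b' < Q w₁ w₂ → Q' b b' < Q w₀ w₂ → False)
    (H2' : ∀ w w' b₀ b₁ b₂, E w b₀ → E w b₁ → E w b₂ → E w' b₀ → E w' b₁ → E w' b₂ →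
      q < Q w w' → q < Q' b₀ b₁ → q < Q' b₁ b₂ → q < Q' b₀ b₂ →
      Q w w' < Q' b₀ b₁ → Q w w' < Q' b₁ b₂ → Q w w' < Q' b₀ b₂ → False)
    (hρ : ∀ z ∈ KK W B E, Q z.1.1 z.1.2 ≤ ρ ∧ Q' z.2.1 z.2.2 ≤ ρ)
    (N : ℕ) (hN : ρ ≤ 4 ^ N * q) :
    (KK W B E).card ≤ (N + 1) * (((KK W B E).filter (fun z => Q z.1.1 z.1.2 ≤ q)).card +
    ((KK W B E).filter (fun z => Q' z.2.1 z.2.2 ≤ q)).card) := by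
  set D := (((KK W B E).filter (fun z => Q z.1.1 z.1.2 ≤ q)).card +
    ((KK W B E).filter (fun z => Q' z.2.1 z.2.2 ≤ q)).card) with hD
  have key : ∀ n : ℕ, ∀ σ : ℝ, σ ≤ 4 ^ n * q →
      ((KK W B E).filter (fun z => q < Q z.1.1 z.1.2 ∧ q < Q' z.2.1 z.2.2 ∧
      Q' z.2.1 z.2.2 ≤ σ ∧ Q z.1.1 z.1.2 ≤ σ)).card ≤ n * D := by
    intro n
    induction n with
    | zero =>
      intro σ hσ
      simp only [Nat.zero_mul, Nat.le_zero, Finset.card_eq_zero]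
      apply Finset.filter_eq_empty_iff.2
      rintro z hz ⟨h1, h2, h3, h4⟩
      simp at hσ
      linarith
    | succ n ih =>
      intro σ hσ
      have h1 := KK_rec W B E Q Q' q σ hq hQs hQs' H1 H2 H2'
      have h2 := ih (σ / 4) (by rw [pow_succ] at hσ; linarith)
      have : (n + 1) * D = n * D + D := by ring
      omega
  have h1 := key N ρ hN
  have h2 : (KK W B E).card ≤ ((KK W B E).filter (fun z => q < Q z.1.1 z.1.2 ∧
      q < Q' z.2.1 z.2.2 ∧ Q' z.2.1 z.2.2 ≤ ρ ∧ Q z.1.1 z.1.2 ≤ ρ)).card + D := by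
    rw [hD]
    refine le_trans (le_trans (Finset.card_le_card ?_) (Finset.card_union_le _ _))
      (Nat.add_le_add_left (Finset.card_union_le _ _) _)
    intro z hz
    simp only [Finset.mem_filter, Finset.mem_union]
    by_cases ha : Q z.1.1 z.1.2 ≤ q
    · right; left; exact ⟨hz, ha⟩
    by_cases hb : Q' z.2.1 z.2.2 ≤ q
    · right; right; exact ⟨hz, hb⟩
    left
    exact ⟨hz, not_le.1 ha, not_le.1 hb, (hρ z hz).2, (hρ z hz).1⟩
  have : (N + 1) * D = N * D + D := by ring
  omega

open Classical in
lemma KK_CS {α β : Type*} (W : Finset α) (B : Finset β) (E : α → β → Prop)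
    (Pr : Finset (β × β)) (hPr : ∀ w ∈ W, ∀ b ∈ B, ∀ b' ∈ B, E w b → E w b' → (b, b') ∈ Pr) :
    ((W ×ˢ B).filter (fun z => E z.1 z.2)).card ^ 4 ≤ W.card ^ 2 * (Pr.card * (KK W B E).card) := by
  set A := ((W ×ˢ B).filter (fun z => E z.1 z.2)).card with hA
  set d : α → ℕ := fun w => (B.filter (fun b => E w b)).card with hd
  have h1 : A = ∑ w ∈ W, d w := by
    simp only [hA, hd, Finset.card_filter, Finset.sum_product]
  have h2 : A ^ 2 ≤ W.card * ∑ w ∈ W, d w ^ 2 := by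
    rw [h1]; exact sq_sum_le_card_mul_sum_sq
  set Pr' := Pr ∩ (B ×ˢ B) with hPr'
  set c : β × β → ℕ := fun y => (W.filter (fun w => E w y.1 ∧ E w y.2)).card with hc
  have h3 : ∑ w ∈ W, d w ^ 2 = ∑ y ∈ Pr', c y := by
    have : ∀ w ∈ W, d w ^ 2 = ∑ y ∈ Pr', if (E w y.1 ∧ E w y.2) then 1 else 0 := by
      intro w hw
      rw [← Finset.card_filter, sq]
      simp only [hd]
      rw [← Finset.card_product]
      congr 1
      ext ⟨b, b'⟩
      simp only [Finset.mem_product, Finset.mem_filter, hPr', Finset.mem_inter]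
      constructor
      · rintro ⟨⟨h1, h2⟩, h3, h4⟩
        exact ⟨⟨hPr w hw b h1 b' h3 h2 h4, h1, h3⟩, h2, h4⟩
      · tauto
    rw [Finset.sum_congr rfl this, Finset.sum_comm]
    apply Finset.sum_congr rfl
    intro y hy
    simp only [hc, Finset.card_filter]
  have h4 : (∑ y ∈ Pr', c y) ^ 2 ≤ Pr'.card * ∑ y ∈ Pr', c y ^ 2 := sq_sum_le_card_mul_sum_sq
  have h5 : ∑ y ∈ Pr', c y ^ 2 ≤ (KK W B E).card := by
    have : ∀ y ∈ Pr', c y ^ 2 = ∑ x ∈ W ×ˢ W, if ((E x.1 y.1 ∧ E x.1 y.2) ∧ (E x.2 y.1 ∧ E x.2 y.2)) then 1 else 0 := by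
      intro y hy
      rw [← Finset.card_filter, sq]
      simp only [hc]
      rw [← Finset.card_product]
      congr 1
      ext ⟨a, b⟩
      simp only [Finset.mem_product, Finset.mem_filter]
      tauto
    rw [Finset.sum_congr rfl this, Finset.sum_comm, ← Finset.sum_product', ← Finset.card_filter]
    apply Finset.card_le_card
    rintro ⟨⟨a, b⟩, ⟨c, d⟩⟩ hz
    simp only [Finset.mem_filter, Finset.mem_product, hPr', Finset.mem_inter] at hz
    rw [mem_KK]
    tauto
  have h6 : Pr'.card ≤ Pr.card := Finset.card_le_card Finset.inter_subset_left
  calc A ^ 4 = (A ^ 2) ^ 2 := by ring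
    _ ≤ (W.card * ∑ w ∈ W, d w ^ 2) ^ 2 := Nat.pow_le_pow_left h2 2
    _ = W.card ^ 2 * (∑ w ∈ W, d w ^ 2) ^ 2 := by ring
    _ ≤ W.card ^ 2 * (Pr.card * (KK W B E).card) := by
        apply Nat.mul_le_mul_left
        rw [h3]
        exact h4.trans (Nat.mul_le_mul h6 h5)

open Classical in
lemma deg_aux {α γ : Type*} (G : Finset (α × γ)) (T : α × γ → α × γ → Prop) (m : ℝ)
    (hm : ∀ ω ∈ G, ((G.filter (fun ω' => T ω ω')).card : ℝ) ≤ m)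
    (w : α) (S : Finset γ) (hS : ∀ v ∈ S, (w, v) ∈ G) (B : Finset α)
    (hB : ∀ b ∈ B, ∃ v ∈ S, ∃ v', (b, v') ∈ G ∧ T (w, v) (b, v')) :
    (B.card : ℝ) ≤ S.card * m := by
  have h1 : B ⊆ S.biUnion (fun v => (G.filter (fun ω' => T (w, v) ω')).image Prod.fst) := by
    intro b hb
    obtain ⟨v, hv, v', h1, h2⟩ := hB b hb
    simp only [Finset.mem_biUnion, Finset.mem_image, Finset.mem_filter]
    exact ⟨v, hv, (b, v'), ⟨h1, h2⟩, rfl⟩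
  have h2 : (B.card : ℝ) ≤ ∑ v ∈ S, ((G.filter (fun ω' => T (w, v) ω')).card : ℝ) := by
    have := (Finset.card_le_card h1).trans (Finset.card_biUnion_le.trans
      (Finset.sum_le_sum (fun v _ => Finset.card_image_le)))
    exact_mod_cast this
  refine h2.trans ((Finset.sum_le_sum (fun v hv => hm _ (hS v hv))).trans ?_)
  simp

open Classical in
/-- count of pairs via fibres -/
lemma card_filter_prod_le {α β : Type*} (X : Finset α) (Y : α → Finset β) (Z : Finset (α × β))
    (c : ℝ) (hZ : ∀ z ∈ Z, z.1 ∈ X ∧ z.2 ∈ Y z.1) (hc : ∀ x ∈ X, ((Y x).card : ℝ) ≤ c) :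
    (Z.card : ℝ) ≤ X.card * c := by
  have h1 : Z ⊆ (X.sigma Y).image (fun z => (z.1, z.2)) := by
    intro z hz
    simp only [Finset.mem_image, Finset.mem_sigma]
    exact ⟨⟨z.1, z.2⟩, hZ z hz, rfl⟩
  have h2 := (Finset.card_le_card h1).trans Finset.card_image_le
  rw [Finset.card_sigma] at h2
  have h3 : (Z.card : ℝ) ≤ ∑ x ∈ X, ((Y x).card : ℝ) := by exact_mod_cast h2
  refine h3.trans ((Finset.sum_le_sum hc).trans ?_)
  simp

open Classical in
lemma chainB {α : Type*} (P : Finset α) (E : α → α → Prop) (Q : α → α → ℝ) (q c₁ c₂ : ℝ)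
    (hc₁ : 0 ≤ c₁) (hc₂ : 0 ≤ c₂)
    (dW : ∀ w ∈ P, (((P.filter (fun b => E w b)).card : ℝ)) ≤ c₁)
    (dB : ∀ b ∈ P, (((P.filter (fun w => E w b)).card : ℝ)) ≤ c₁)
    (dW' : ∀ w b, E w b → (((P.filter (fun b' => E w b' ∧ Q b b' ≤ q)).card : ℝ)) ≤ c₂) :
    (((KK P P E).filter (fun z => Q z.2.1 z.2.2 ≤ q)).card : ℝ) ≤ P.card * c₁ * c₂ * c₁ := by
    set Z := (KK P P E).filter (fun z => Q z.2.1 z.2.2 ≤ q) with hZ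
    have hinj : Function.Injective (fun z : (α × α) × (α × α) =>
        (((z.1.1, z.2.1), z.2.2), z.1.2)) := by
      rintro ⟨⟨a, b⟩, ⟨c, d⟩⟩ ⟨⟨a', b'⟩, ⟨c', d'⟩⟩ h
      simp only [Prod.mk.injEq] at h ⊢
      tauto
    rw [← Finset.card_image_of_injective Z hinj]
    set X1 := (P ×ˢ P).filter (fun z => E z.1 z.2) with hX1
    set X2 := (X1 ×ˢ P).filter (fun z => E z.1.1 z.2 ∧ Q z.1.2 z.2 ≤ q) with hX2
    have h1 : (X1.card : ℝ) ≤ P.card * c₁ := by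
      refine card_filter_prod_le P (fun w => P.filter (fun b => E w b)) X1 _ ?_ (dW)
      intro z hz
      simp only [hX1, Finset.mem_filter, Finset.mem_product] at hz ⊢
      tauto
    have h2 : (X2.card : ℝ) ≤ X1.card * c₂ := by
      refine card_filter_prod_le X1 (fun z => P.filter (fun b' => E z.1 b' ∧ Q z.2 b' ≤ q)) X2 _ ?_
        ?_
      · intro z hz
        simp only [hX2, Finset.mem_filter, Finset.mem_product] at hz ⊢
        tauto
      · intro z hz
        exact dW' z.1 z.2 (Finset.mem_filter.1 hz).2
    have h3 : ((Z.image (fun z : (α × α) × (α × α) =>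
        (((z.1.1, z.2.1), z.2.2), z.1.2))).card : ℝ) ≤ X2.card * c₁ := by
      refine card_filter_prod_le X2 (fun z => P.filter (fun w => E w z.1.2)) _ _ ?_ ?_
      · intro z hz
        rw [Finset.mem_image] at hz
        obtain ⟨y, hy, rfl⟩ := hz
        simp only [hZ, Finset.mem_filter, mem_KK] at hy
        simp only [hX2, hX1, Finset.mem_filter, Finset.mem_product]
        tauto
      · intro z hz
        apply dB
        simp only [hX2, hX1, Finset.mem_filter, Finset.mem_product] at hz
        tauto
    refine h3.trans (mul_le_mul_of_nonneg_right (h2.trans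
      (mul_le_mul_of_nonneg_right h1 hc₂)) hc₁)

open Classical in
lemma chainW {α : Type*} (P : Finset α) (E : α → α → Prop) (Q : α → α → ℝ) (q c₁ c₂ : ℝ)
    (hc₁ : 0 ≤ c₁) (hc₂ : 0 ≤ c₂)
    (dW : ∀ w ∈ P, (((P.filter (fun b => E w b)).card : ℝ)) ≤ c₁)
    (dB : ∀ b ∈ P, (((P.filter (fun w => E w b)).card : ℝ)) ≤ c₁)
    (dB' : ∀ b w, E w b → (((P.filter (fun w' => E w' b ∧ Q w w' ≤ q)).card : ℝ)) ≤ c₂) :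
    (((KK P P E).filter (fun z => Q z.1.1 z.1.2 ≤ q)).card : ℝ) ≤ P.card * c₁ * c₂ * c₁ := by
    set Z := (KK P P E).filter (fun z => Q z.1.1 z.1.2 ≤ q) with hZ
    have hinj : Function.Injective (fun z : (α × α) × (α × α) =>
        (((z.2.1, z.1.1), z.1.2), z.2.2)) := by
      rintro ⟨⟨a, b⟩, ⟨c, d⟩⟩ ⟨⟨a', b'⟩, ⟨c', d'⟩⟩ h
      simp only [Prod.mk.injEq] at h ⊢
      tauto
    rw [← Finset.card_image_of_injective Z hinj]
    set X1 := (P ×ˢ P).filter (fun z => E z.2 z.1) with hX1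
    set X2 := (X1 ×ˢ P).filter (fun z => E z.2 z.1.1 ∧ Q z.1.2 z.2 ≤ q) with hX2
    have h1 : (X1.card : ℝ) ≤ P.card * c₁ := by
      refine card_filter_prod_le P (fun w => P.filter (fun b => E b w)) X1 _ ?_ (dB)
      intro z hz
      simp only [hX1, Finset.mem_filter, Finset.mem_product] at hz ⊢
      tauto
    have h2 : (X2.card : ℝ) ≤ X1.card * c₂ := by
      refine card_filter_prod_le X1 (fun z => P.filter (fun b' => E b' z.1 ∧ Q z.2 b' ≤ q)) X2 _ ?_
        ?_
      · intro z hz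
        simp only [hX2, Finset.mem_filter, Finset.mem_product] at hz ⊢
        tauto
      · intro z hz
        exact dB' z.1 z.2 (Finset.mem_filter.1 hz).2
    have h3 : ((Z.image (fun z : (α × α) × (α × α) =>
        (((z.2.1, z.1.1), z.1.2), z.2.2))).card : ℝ) ≤ X2.card * c₁ := by
      refine card_filter_prod_le X2 (fun z => P.filter (fun w => E z.1.2 w)) _ _ ?_ ?_
      · intro z hz
        rw [Finset.mem_image] at hz
        obtain ⟨y, hy, rfl⟩ := hz
        simp only [hZ, Finset.mem_filter, mem_KK] at hy
        simp only [hX2, hX1, Finset.mem_filter, Finset.mem_product]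
        tauto
      · intro z hz
        apply dW
        simp only [hX2, hX1, Finset.mem_filter, Finset.mem_product] at hz
        tauto
    refine h3.trans (mul_le_mul_of_nonneg_right (h2.trans
      (mul_le_mul_of_nonneg_right h1 hc₂)) hc₁)

set_option maxHeartbeats 1000000 in
open Classical in
lemma step_core {α γ ι : Type*} (G : Finset (α × γ)) (P : Finset α)
    (hP : ∀ ω ∈ G, ω.1 ∈ P)
    (T : α × γ → α × γ → Prop) (hT : ∀ x y, T x y → T y x)
    (cl : α → α → ι) (Cls : Finset ι) (hcl : ∀ x ∈ G, ∀ y ∈ G, T x y → cl x.1 y.1 ∈ Cls)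
    (Q : α → α → ℝ) (q ρ : ℝ) (hq : 0 < q) (hQs : ∀ x y, Q x y = Q y x) (hQ0 : ∀ x, Q x x ≤ q)
    (hQρ : ∀ x ∈ P, ∀ y ∈ P, Q x y ≤ ρ)
    (N : ℕ) (hN : ρ ≤ 4 ^ N * q)
    (M' : ℝ) (hM : ∀ w ∈ P, ∀ S : Finset γ, (∀ v ∈ S, (w, v) ∈ G) → (S.card : ℝ) ≤ M')
    (m : ℝ) (hm0 : 0 ≤ m) (hm : ∀ ω ∈ G, ((G.filter (fun ω' => T ω ω')).card : ℝ) ≤ m)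
    (L : ℝ) 
    (hD : ∀ w b, ∀ S : Finset γ, (∀ v ∈ S, (w, v) ∈ G ∧ ∃ b₁ v₁, (b₁, v₁) ∈ G ∧
      T (w, v) (b₁, v₁) ∧ cl w b₁ = cl w b ∧ Q b b₁ ≤ q) →
      (∃ v v₁, (w, v) ∈ G ∧ (b, v₁) ∈ G ∧ T (w, v) (b, v₁)) → (S.card : ℝ) ≤ L)
    (hD' : ∀ w b, ∀ S : Finset γ, (∀ v ∈ S, (w, v) ∈ G ∧ ∃ b₁ v₁, (b₁, v₁) ∈ G ∧
      T (w, v) (b₁, v₁) ∧ cl b₁ w = cl b w ∧ Q b b₁ ≤ q) →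
      (∃ v v₁, (w, v) ∈ G ∧ (b, v₁) ∈ G ∧ T (w, v) (b, v₁)) → (S.card : ℝ) ≤ L)
    (EE : ι → α → α → Prop) (hEE : ∀ x ∈ G, ∀ y ∈ G, T x y → EE (cl x.1 y.1) x.1 y.1)
    (H1 : ∀ χ w w' b b', EE χ w b → EE χ w b' → EE χ w' b → EE χ w' b' →
      q < Q w w' → q < Q b b' → 4 * Q b b' ≤ Q w w' ∨ 4 * Q w w' ≤ Q b b')
    (H2 : ∀ χ b b' w₀ w₁ w₂, EE χ w₀ b → EE χ w₁ b → EE χ w₂ b →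
      EE χ w₀ b' → EE χ w₁ b' → EE χ w₂ b' →
      q < Q b b' → q < Q w₀ w₁ → q < Q w₁ w₂ → q < Q w₀ w₂ →
      Q b b' < Q w₀ w₁ → Q b b' < Q w₁ w₂ → Q b b' < Q w₀ w₂ → False)
    (H2' : ∀ χ w w' b₀ b₁ b₂, EE χ w b₀ → EE χ w b₁ → EE χ w b₂ →
      EE χ w' b₀ → EE χ w' b₁ → EE χ w' b₂ →
      q < Q w w' → q < Q b₀ b₁ → q < Q b₁ b₂ → q < Q b₀ b₂ →
      Q w w' < Q b₀ b₁ → Q w w' < Q b₁ b₂ → Q w w' < Q b₀ b₂ → False)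
    (hL0 : 0 ≤ L) (hM0 : 0 ≤ M')
    (nt : ℝ) (hnt0 : 0 ≤ nt)
    (hnt : ∀ b ∈ P, ∀ B : Finset α, (∀ b' ∈ B, b' ∈ P ∧ ∃ w χ, EE χ w b ∧ EE χ w b') →
      (B.card : ℝ) ≤ nt) :
    (((G ×ˢ G).filter (fun z => T z.1 z.2)).card : ℝ) ^ 4 ≤
      Cls.card ^ 4 * L ^ 8 * (P.card ^ 4 * nt * (2 * (N + 1) * L * M' ^ 2 * m ^ 3)) := by
  obtain ⟨E, hE⟩ : ∃ E : ι → α → α → Prop, ∀ χ w b, E χ w b ↔ (cl w b = χ ∧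
    ∃ v v', (w, v) ∈ G ∧ (b, v') ∈ G ∧ T (w, v) (b, v')) := ⟨_, fun _ _ _ => Iff.rfl⟩
  have hEEE : ∀ χ w b, E χ w b → EE χ w b := by
    intro χ w b hh
    obtain ⟨rfl, v, v', h1, h2, h3⟩ := (hE _ _ _).1 hh
    exact hEE _ h1 _ h2 h3
  have hEP : ∀ χ w b, E χ w b → w ∈ P ∧ b ∈ P := by
    intro χ w b hh
    obtain ⟨rfl, v, v', h1, h2, h3⟩ := (hE _ _ _).1 hh
    exact ⟨hP _ h1, hP _ h2⟩
  set Vs : α → Finset γ := fun w => (G.filter (fun x => x.1 = w)).image Prod.snd with hVs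
  have memVs : ∀ w v, v ∈ Vs w ↔ (w, v) ∈ G := by
    intro w v
    simp only [hVs, Finset.mem_image, Finset.mem_filter]
    constructor
    · rintro ⟨⟨a, b⟩, ⟨h1, rfl⟩, rfl⟩; exact h1
    · intro h; exact ⟨(w, v), ⟨h, rfl⟩, rfl⟩
  -- full degrees
  have degW : ∀ χ, ∀ w ∈ P, (((P.filter (fun b => E χ w b)).card : ℝ)) ≤ M' * m := by
    intro χ w hw
    refine (deg_aux G T m hm w (Vs w) (fun v hv => (memVs w v).1 hv) _ ?_).trans
      (mul_le_mul_of_nonneg_right (hM w hw _ (fun v hv => (memVs w v).1 hv)) hm0)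
    intro b hb
    obtain ⟨-, v, v', h1, h2, h3⟩ := (hE _ _ _).1 (Finset.mem_filter.1 hb).2
    exact ⟨v, (memVs w v).2 h1, v', h2, h3⟩
  have degB : ∀ χ, ∀ b ∈ P, (((P.filter (fun w => E χ w b)).card : ℝ)) ≤ M' * m := by
    intro χ w hw
    refine (deg_aux G T m hm w (Vs w) (fun v hv => (memVs w v).1 hv) _ ?_).trans
      (mul_le_mul_of_nonneg_right (hM w hw _ (fun v hv => (memVs w v).1 hv)) hm0)
    intro b hb
    obtain ⟨-, v, v', h1, h2, h3⟩ := (hE _ _ _).1 (Finset.mem_filter.1 hb).2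
    exact ⟨v', (memVs w v').2 h2, v, h1, hT _ _ h3⟩
  have degW' : ∀ χ w b, E χ w b →
      (((P.filter (fun b' => E χ w b' ∧ Q b b' ≤ q)).card : ℝ)) ≤ L * m := by
    intro χ w b hh
    obtain ⟨rfl, hx⟩ := (hE _ _ _).1 hh
    set S := (Vs w).filter (fun v => ∃ b₁ v₁, (b₁, v₁) ∈ G ∧
      T (w, v) (b₁, v₁) ∧ cl w b₁ = cl w b ∧ Q b b₁ ≤ q) with hS
    have hSL : (S.card : ℝ) ≤ L := by
      apply hD w b S _ hx
      intro v hv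
      rw [hS, Finset.mem_filter] at hv
      exact ⟨(memVs w v).1 hv.1, hv.2⟩
    refine (deg_aux G T m hm w S (fun v hv => (memVs w v).1 (Finset.mem_filter.1 hv).1) _ ?_).trans
      (mul_le_mul_of_nonneg_right hSL hm0)
    intro b' hb
    obtain ⟨hh', hQ⟩ := (Finset.mem_filter.1 hb).2
    obtain ⟨hc, v, v', h1, h2, h3⟩ := (hE _ _ _).1 hh'
    exact ⟨v, Finset.mem_filter.2 ⟨(memVs w v).2 h1, b', v', h2, h3, hc, hQ⟩, v', h2, h3⟩
  have degB' : ∀ χ b w, E χ w b →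
      (((P.filter (fun w' => E χ w' b ∧ Q w w' ≤ q)).card : ℝ)) ≤ L * m := by
    intro χ w b hh
    obtain ⟨rfl, v, v', hx1, hx2, hx3⟩ := (hE _ _ _).1 hh
    set S := (Vs w).filter (fun v => ∃ b₁ v₁, (b₁, v₁) ∈ G ∧
      T (w, v) (b₁, v₁) ∧ cl b₁ w = cl b w ∧ Q b b₁ ≤ q) with hS
    have hSL : (S.card : ℝ) ≤ L := by
      apply hD' w b S _ ⟨v', v, hx2, hx1, hT _ _ hx3⟩
      intro v hv
      rw [hS, Finset.mem_filter] at hv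
      exact ⟨(memVs w v).1 hv.1, hv.2⟩
    refine (deg_aux G T m hm w S (fun v hv => (memVs w v).1 (Finset.mem_filter.1 hv).1) _ ?_).trans
      (mul_le_mul_of_nonneg_right hSL hm0)
    intro b' hb
    obtain ⟨hh', hQ⟩ := (Finset.mem_filter.1 hb).2
    obtain ⟨hc, v, v', h1, h2, h3⟩ := (hE _ _ _).1 hh'
    exact ⟨v', Finset.mem_filter.2 ⟨(memVs w v').2 h2, b', v, h1, hT _ _ h3, hc, hQ⟩, v, h1,
      hT _ _ h3⟩
  have hMm : 0 ≤ M' * m := by positivity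
  have hLm : 0 ≤ L * m := by positivity
  have hDegB : ∀ χ, (((KK P P (E χ)).filter (fun z => Q z.2.1 z.2.2 ≤ q)).card : ℝ) ≤
      P.card * (M' * m) * (L * m) * (M' * m) := fun χ =>
    chainB P (E χ) Q q _ _ hMm hLm (degW χ) (degB χ) (degW' χ)
  have hDegW : ∀ χ, (((KK P P (E χ)).filter (fun z => Q z.1.1 z.1.2 ≤ q)).card : ℝ) ≤
      P.card * (M' * m) * (L * m) * (M' * m) := fun χ =>
    chainW P (E χ) Q q _ _ hMm hLm (degW χ) (degB χ) (degB' χ)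
  set X : ℝ := P.card ^ 4 * nt * (2 * (N + 1) * L * M' ^ 2 * m ^ 3) with hX
  have hA : ∀ χ, (((P ×ˢ P).filter (fun z => E χ z.1 z.2)).card : ℝ) ^ 4 ≤ X := by
    intro χ
    set Pr := (P ×ˢ P).filter (fun y => ∃ w χ, EE χ w y.1 ∧ EE χ w y.2) with hPr
    have hPrc : (Pr.card : ℝ) ≤ P.card * nt := by
      refine card_filter_prod_le P (fun b => P.filter (fun b' => ∃ w χ, EE χ w b ∧ EE χ w b'))
        Pr _ ?_ ?_
      · intro z hz
        simp only [hPr, Finset.mem_filter, Finset.mem_product] at hz ⊢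
        tauto
      · intro b hb
        apply hnt b hb
        intro b' hb'
        exact Finset.mem_filter.1 hb'
    have hcs := KK_CS P P (E χ) Pr (fun w hw b hb b' hb' h1 h2 => by
      rw [hPr, Finset.mem_filter, Finset.mem_product]
      exact ⟨⟨hb, hb'⟩, w, χ, hEEE _ _ _ h1, hEEE _ _ _ h2⟩)
    have htot := KK_total P P (E χ) Q Q q ρ hq hQs hQs
      (by
        intro z hz h1 h2
        obtain ⟨_, e1, e2, e3, e4⟩ := mem_KK.1 hz
        exact H1 χ _ _ _ _ (hEEE _ _ _ e1) (hEEE _ _ _ e2) (hEEE _ _ _ e3) (hEEE _ _ _ e4) h1 h2)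
      (by
        intro b b' w₀ w₁ w₂ h1 h2 h3 h4 h5 h6
        exact H2 χ b b' w₀ w₁ w₂ (hEEE _ _ _ h1) (hEEE _ _ _ h2) (hEEE _ _ _ h3)
          (hEEE _ _ _ h4) (hEEE _ _ _ h5) (hEEE _ _ _ h6))
      (by
        intro b b' w₀ w₁ w₂ h1 h2 h3 h4 h5 h6
        exact H2' χ b b' w₀ w₁ w₂ (hEEE _ _ _ h1) (hEEE _ _ _ h2) (hEEE _ _ _ h3)
          (hEEE _ _ _ h4) (hEEE _ _ _ h5) (hEEE _ _ _ h6))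
      (by
        intro z hz
        obtain ⟨⟨e1, e2, e3, e4⟩, _⟩ := mem_KK.1 hz
        exact ⟨hQρ _ e1 _ e2, hQρ _ e3 _ e4⟩) N hN
    have htot' : ((KK P P (E χ)).card : ℝ) ≤ (N + 1) *
        (2 * (P.card * (M' * m) * (L * m) * (M' * m))) := by
      have : ((KK P P (E χ)).card : ℝ) ≤ (N + 1) *
          ((((KK P P (E χ)).filter (fun z => Q z.1.1 z.1.2 ≤ q)).card : ℝ) +
          (((KK P P (E χ)).filter (fun z => Q z.2.1 z.2.2 ≤ q)).card : ℝ)) := by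
        exact_mod_cast htot
      refine this.trans (mul_le_mul_of_nonneg_left ?_ (by positivity))
      linarith [hDegB χ, hDegW χ]
    have hcs' : (((P ×ˢ P).filter (fun z => E χ z.1 z.2)).card : ℝ) ^ 4 ≤
        (P.card : ℝ) ^ 2 * ((Pr.card : ℝ) * ((KK P P (E χ)).card : ℝ)) := by exact_mod_cast hcs
    calc _ ≤ _ := hcs'
      _ ≤ (P.card : ℝ) ^ 2 * ((P.card * nt) * ((N + 1) *
        (2 * (P.card * (M' * m) * (L * m) * (M' * m))))) := by gcongr
      _ = X := by rw [hX]; ring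
  -- bound number of T pairs
  set TG := (G ×ˢ G).filter (fun z => T z.1 z.2) with hTG
  have hTG1 : (TG.card : ℝ) ≤ ∑ χ ∈ Cls,
      (((P ×ˢ P).filter (fun z => E χ z.1 z.2)).card : ℝ) * (L * L) := by
    have hinj : Function.Injective (fun z : (α × γ) × (α × γ) =>
        ((z.1.1, z.2.1), (z.1.2, z.2.2))) := by
      rintro ⟨⟨a, b⟩, ⟨c, d⟩⟩ ⟨⟨a', b'⟩, ⟨c', d'⟩⟩ h
      simp only [Prod.mk.injEq] at h ⊢
      tauto
    set Z := TG.image (fun z : (α × γ) × (α × γ) => ((z.1.1, z.2.1), (z.1.2, z.2.2))) with hZ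
    have h0 : TG.card = Z.card := (Finset.card_image_of_injective TG hinj).symm
    have h1 : (Z.card : ℝ) ≤ ∑ χ ∈ Cls, ((Z.filter (fun z => cl z.1.1 z.1.2 = χ)).card : ℝ) := by
      have : Z.card = ∑ χ ∈ Cls, (Z.filter (fun z => cl z.1.1 z.1.2 = χ)).card := by
        apply Finset.card_eq_sum_card_fiberwise
        intro z hz
        simp only [hZ, hTG, Finset.coe_image, Set.mem_image, Finset.mem_coe, Finset.mem_filter,
          Finset.mem_product] at hz ⊢
        obtain ⟨y, ⟨⟨h1, h2⟩, h3⟩, rfl⟩ := hz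
        exact hcl _ h1 _ h2 h3
      rw [this]; push_cast; exact le_rfl
    rw [h0]
    refine h1.trans (Finset.sum_le_sum ?_)
    intro χ hχ
    refine card_filter_prod_le _ (fun y => (Vs y.1).filter (fun v => ∃ v', (y.2, v') ∈ G ∧
      T (y.1, v) (y.2, v')) ×ˢ (Vs y.2).filter (fun v => ∃ v', (y.1, v') ∈ G ∧
      T (y.2, v) (y.1, v'))) _ _ ?_ ?_
    · intro z hz
      simp only [hZ, hTG, Finset.mem_filter, Finset.mem_image, Finset.mem_product] at hz ⊢
      obtain ⟨⟨y, ⟨⟨h1, h2⟩, h3⟩, rfl⟩, h4⟩ := hz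
      simp only at h4 ⊢
      exact ⟨⟨⟨hP _ h1, hP _ h2⟩, (hE _ _ _).2 ⟨h4, y.1.2, y.2.2, h1, h2, h3⟩⟩,
        ⟨(memVs _ _).2 h1, y.2.2, h2, h3⟩, (memVs _ _).2 h2, y.1.2, h1, hT _ _ h3⟩
    · intro y hy
      obtain ⟨-, v, v', h1, h2, h3⟩ := (hE _ _ _).1 (Finset.mem_filter.1 hy).2
      rw [Finset.card_product]
      push_cast
      apply mul_le_mul _ _ (by positivity) hL0
      · apply hD y.1 y.2 _ _ ⟨v, v', h1, h2, h3⟩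
        intro u hu
        obtain ⟨k1, u', k2, k3⟩ := Finset.mem_filter.1 hu
        exact ⟨(memVs _ _).1 k1, y.2, u', k2, k3, rfl, hQ0 _⟩
      · apply hD y.2 y.1 _ _ ⟨v', v, h2, h1, hT _ _ h3⟩
        intro u hu
        obtain ⟨k1, u', k2, k3⟩ := Finset.mem_filter.1 hu
        exact ⟨(memVs _ _).1 k1, y.1, u', k2, k3, rfl, hQ0 _⟩
  have hX0 : 0 ≤ X := by rw [hX]; positivity
  have hA' : ∀ χ, (((P ×ˢ P).filter (fun z => E χ z.1 z.2)).card : ℝ) ≤ X ^ (1 / 4 : ℝ) := by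
    intro χ
    have := Real.rpow_le_rpow (by positivity) (hA χ) (by norm_num : (0:ℝ) ≤ 1 / 4)
    rwa [← Real.rpow_natCast, ← Real.rpow_mul (by positivity), show ((4 : ℕ) : ℝ) * (1 / 4) = 1 by norm_num,
      Real.rpow_one] at this
  have hfin : (TG.card : ℝ) ≤ Cls.card * (X ^ (1 / 4 : ℝ) * (L * L)) := by
    refine hTG1.trans ?_
    refine (Finset.sum_le_sum (fun χ _ => mul_le_mul_of_nonneg_right (hA' χ) (by positivity))).trans ?_
    simp
  have hX4 : (X ^ (1 / 4 : ℝ)) ^ 4 = X := by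
    rw [← Real.rpow_natCast, ← Real.rpow_mul hX0]; norm_num
  calc (TG.card : ℝ) ^ 4 ≤ (Cls.card * (X ^ (1 / 4 : ℝ) * (L * L))) ^ 4 := by gcongr
    _ = Cls.card ^ 4 * L ^ 8 * (X ^ (1 / 4 : ℝ)) ^ 4 := by ring
    _ = _ := by rw [hX4]

lemma g_frame (U p f k E q : ℝ) (hU : 0 < U) (hU2 : |U ^ 2 - 1| ≤ E) (hp : |p| ≤ 1 / 1000)
    (hk : |k| ≤ 1 / 1000) (hN : |(U - p) ^ 2 + f ^ 2 - (1 - k) ^ 2| ≤ E)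
    (hqd : q = p ^ 2 + f ^ 2 - k ^ 2) (hq : 10000 * E < q) :
    |p - k - q / 2| ≤ 2 * E ∧ |q - f ^ 2| ≤ q / 400 ∧ |p - k| ≤ 51 / 100 * q := by
  have hE : 0 ≤ E := (abs_nonneg _).trans hU2
  have hU1 : |U - 1| ≤ E := by
    have : |U ^ 2 - 1| = |U - 1| * (U + 1) := by
      rw [show U ^ 2 - 1 = (U - 1) * (U + 1) by ring, abs_mul, abs_of_pos (by linarith : 0 < U + 1)]
    nlinarith [abs_nonneg (U - 1)]
  have h1 : |(U - 1) * p| ≤ E * (1 / 1000) := by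
    rw [abs_mul]; exact mul_le_mul hU1 hp (abs_nonneg _) hE
  have h2 : |p - k - q / 2| ≤ 2 * E := by
    rw [abs_le] at *
    constructor <;> nlinarith
  have h3 : |p - k| ≤ 51 / 100 * q := by
    rw [abs_le] at *
    constructor <;> linarith
  have h4 : |p + k| ≤ 2 / 1000 := (abs_add_le p k).trans (by linarith)
  refine ⟨h2, ?_, h3⟩
  have : q - f ^ 2 = (p - k) * (p + k) := by rw [hqd]; ring
  rw [this, abs_mul]
  have := mul_le_mul h3 h4 (abs_nonneg _) (by linarith)
  linarith

lemma g1_core (p f k p' f' k' E q q' : ℝ) (hE : 0 ≤ E)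
    (hk' : |k'| ≤ 1 / 1000)
    (hp : |p| ≤ 1 / 1000)
    (hq : 10000 * E < q)
    (h2 : |q - f ^ 2| ≤ q / 400) (h3 : |p - k| ≤ 51 / 100 * q)
    (h2' : |q' - f' ^ 2| ≤ q' / 400) (h3' : |p' - k'| ≤ 51 / 100 * q')
    (hc : |p * p' + f * f' - k * k'| ≤ 2 * E) : ¬ (q < 4 * q' ∧ q' < 4 * q) := by
  rintro ⟨ha, hb⟩
  have e1 : |p * (p' - k')| ≤ 1 / 1000 * (51 / 100 * (4 * q)) := by
    rw [abs_mul]; exact mul_le_mul hp (h3'.trans (by linarith)) (abs_nonneg _) (by norm_num)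
  have e2 : |k' * (p - k)| ≤ 1 / 1000 * (51 / 100 * q) := by
    rw [abs_mul]; exact mul_le_mul hk' h3 (abs_nonneg _) (by norm_num)
  have e3 : |f * f'| ≤ 1 / 100 * q := by
    have : f * f' = (p * p' + f * f' - k * k') - p * (p' - k') - k' * (p - k) := by ring
    rw [abs_le] at *
    constructor <;> linarith
  have e4 : f ^ 2 * f' ^ 2 ≤ (1 / 100 * q) ^ 2 := by
    have := pow_le_pow_left₀ (abs_nonneg _) e3 2
    rwa [sq_abs, mul_pow] at this
  have e5 : 399 / 400 * q ≤ f ^ 2 := by linarith [abs_le.1 h2]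
  have e6 : 399 / 400 * (q / 4) ≤ f' ^ 2 := by linarith [abs_le.1 h2']
  have hq0 : 0 < q := by linarith
  have := mul_le_mul e5 e6 (by positivity) (by positivity)
  nlinarith

/-- direction of `f` -/
lemma g2_aux (p f k p' f' k' E q q' : ℝ)
    (hk : |k| ≤ 1 / 1000) (hp : |p| ≤ 1 / 1000) (hp' : |p'| ≤ 1 / 1000) (hE : 0 ≤ E)
    (hq : 10000 * E < q) (hqq : 4 * q ≤ q')
    (h2 : |q - f ^ 2| ≤ q / 400) (h3 : |p - k| ≤ 51 / 100 * q)
    (h1' : |-(p' - k') - q' / 2| ≤ 2 * E)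
    (h2' : |q' - f' ^ 2| ≤ q' / 400)
    (hc : |p * p' + f * f' - k * k'| ≤ 2 * E) :
    |f - k * f' / 2| ≤ 4 / 1000 * |f| := by
  have hq0 : 0 < q := by linarith
  set X := |f * f'| with hX
  have hX0 : 0 ≤ X := abs_nonneg _
  have hqX : q ≤ X := by
    have e5 : 399 / 400 * q ≤ f ^ 2 := by linarith [abs_le.1 h2]
    have e6 : 399 / 400 * q' ≤ f' ^ 2 := by linarith [abs_le.1 h2']
    have e7 := mul_le_mul e5 e6 (by linarith) (by positivity)
    have : q ^ 2 ≤ X ^ 2 := by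
      rw [hX, sq_abs, mul_pow]; nlinarith
    exact (abs_le_of_sq_le_sq' this hX0).2
  have e1 : |(p - k) * p'| ≤ 51 / 100 * q * (1 / 1000) := by
    rw [abs_mul]; exact mul_le_mul h3 hp' (abs_nonneg _) (by linarith)
  have e2 : |k * (-(p' - k') - q' / 2)| ≤ 1 / 1000 * (2 * E) := by
    rw [abs_mul]; exact mul_le_mul hk h1' (abs_nonneg _) (by norm_num)
  have e3 : |f * f' - k * q' / 2| ≤ 8 / 10000 * X := by
    have : f * f' - k * q' / 2 = (p * p' + f * f' - k * k') - (p - k) * p' +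
      k * (-(p' - k') - q' / 2) := by ring
    rw [abs_le] at *
    constructor <;> linarith
  have e4 : |k * (q' - f' ^ 2)| ≤ |k| * q' / 400 := by
    rw [abs_mul]; nlinarith [abs_nonneg k]
  have e5 : |k| * q' ≤ 201 / 100 * X := by
    have h : |k| * q' / 2 = |k * q' / 2| := by
      rw [abs_div, abs_mul, abs_of_pos (by linarith : 0 < q')]; norm_num
    have := abs_sub_abs_le_abs_sub (k * q' / 2) (f * f')
    rw [abs_sub_comm] at this
    linarith
  have e6 : |f * f' - k * f' ^ 2 / 2| ≤ 4 / 1000 * X := by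
    have : f * f' - k * f' ^ 2 / 2 = (f * f' - k * q' / 2) + k * (q' - f' ^ 2) / 2 := by ring
    rw [abs_le] at *
    constructor <;> linarith
  have hf' : 0 < |f'| := by
    rw [abs_pos]; rintro rfl
    have := abs_le.1 h2'
    norm_num at this
    linarith
  have e7 : |f * f' - k * f' ^ 2 / 2| = |f - k * f' / 2| * |f'| := by
    rw [← abs_mul]; congr 1; ring
  rw [e7, hX, abs_mul, ← mul_assoc] at e6
  exact le_of_mul_le_mul_right e6 hf'

lemma g2_core (p f k p₁ f₁ k₁ p₂ f₂ k₂ E q q₁ q₂ : ℝ) (hE : 0 ≤ E)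
    (hk : |k| ≤ 1 / 1000) (hk₁ : |k₁| ≤ 1 / 1000) (hk₂ : |k₂| ≤ 1 / 1000)
    (hp : |p| ≤ 1 / 1000) (hp₁ : |p₁| ≤ 1 / 1000) (hp₂ : |p₂| ≤ 1 / 1000)
    (hq : 10000 * E < q) (hqq₁ : 4 * q ≤ q₁) (hqq₂ : 4 * q ≤ q₂)
    (h2 : |q - f ^ 2| ≤ q / 400) (h3 : |p - k| ≤ 51 / 100 * q)
    (h1₁ : |-(p₁ - k₁) - q₁ / 2| ≤ 2 * E)
    (h2₁ : |q₁ - f₁ ^ 2| ≤ q₁ / 400) (h3₁ : |p₁ - k₁| ≤ 51 / 100 * q₁)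
    (h1₂ : |-(p₂ - k₂) - q₂ / 2| ≤ 2 * E)
    (h2₂ : |q₂ - f₂ ^ 2| ≤ q₂ / 400) (h3₂ : |p₂ - k₂| ≤ 51 / 100 * q₂)
    (hc₁ : |p * p₁ + f * f₁ - k * k₁| ≤ 2 * E)
    (hc₂ : |p * p₂ + f * f₂ - k * k₂| ≤ 2 * E)
    (hm₁ : q₁ ≤ (p₂ - p₁) ^ 2 + (f₂ - f₁) ^ 2 - (k₂ - k₁) ^ 2)
    (hm₂ : q₂ ≤ (p₂ - p₁) ^ 2 + (f₂ - f₁) ^ 2 - (k₂ - k₁) ^ 2) : False := by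
  have a₁ := g2_aux p f k p₁ f₁ k₁ E q q₁ hk hp hp₁ hE hq hqq₁ h2 h3 h1₁ h2₁ hc₁
  have a₂ := g2_aux p f k p₂ f₂ k₂ E q q₂ hk hp hp₂ hE hq hqq₂ h2 h3 h1₂ h2₂ hc₂
  have hq0 : 0 < q := by linarith
  have hf : 0 < |f| := by
    rw [abs_pos]; rintro rfl
    have := abs_le.1 h2
    norm_num at this
    linarith
  have b1 : |k| * |f₂ - f₁| ≤ 16 / 1000 * |f| := by
    have : |k| * |f₂ - f₁| = 2 * |(f - k * f₁ / 2) - (f - k * f₂ / 2)| := by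
      rw [← abs_mul, show (2 : ℝ) = |2| by norm_num, ← abs_mul]; congr 1; norm_num; ring
    rw [this]
    linarith [abs_sub (f - k * f₁ / 2) (f - k * f₂ / 2)]
  have b2 : 996 / 1000 * |f| ≤ |k| * |f₁| / 2 := by
    have h : |k * f₁ / 2| = |k| * |f₁| / 2 := by rw [abs_div, abs_mul]; norm_num
    have := abs_sub_abs_le_abs_sub f (k * f₁ / 2)
    linarith
  have hkpos : 0 < |k| := by
    by_contra h
    have : |k| = 0 := le_antisymm (not_lt.1 h) (abs_nonneg _)
    rw [this] at b2; linarith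
  have b3 : |f₂ - f₁| ≤ 1 / 100 * |f₁| := by
    have : |k| * |f₂ - f₁| ≤ |k| * (1 / 100 * |f₁|) := by linarith
    exact le_of_mul_le_mul_left this hkpos
  have b4 : (f₂ - f₁) ^ 2 ≤ 1 / 10000 * f₁ ^ 2 := by
    have := pow_le_pow_left₀ (abs_nonneg _) b3 2
    rw [sq_abs, mul_pow, sq_abs] at this
    linarith
  set q12 := (p₂ - p₁) ^ 2 + (f₂ - f₁) ^ 2 - (k₂ - k₁) ^ 2 with hq12
  have c1 : |(p₂ - k₂) - (p₁ - k₁)| ≤ 102 / 100 * q12 :=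
    (abs_sub _ _).trans (by linarith)
  have c2 : |(p₂ + k₂) - (p₁ + k₁)| ≤ 4 / 1000 := by
    rw [abs_le] at *
    constructor <;> linarith
  have c3 : q12 = (f₂ - f₁) ^ 2 + ((p₂ - k₂) - (p₁ - k₁)) * ((p₂ + k₂) - (p₁ + k₁)) := by
    rw [hq12]; ring
  have c4 := mul_le_mul c1 c2 (abs_nonneg _) (by linarith)
  rw [← abs_mul] at c4
  have c5 := (abs_le.1 c4).2
  have c6 := (abs_le.1 h2₁)
  linarith

lemma g_setup (n₁ n₂ h E g : ℝ) (hN : |n₁ ^ 2 + n₂ ^ 2 - h ^ 2| ≤ E) (hE : E < h ^ 2)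
    (hg : 2000 * g ≤ |h|) : ∃ a b : ℝ, a ^ 2 + b ^ 2 = 1 / h ^ 2 ∧
    ∀ x y z, |x| ≤ g → |y| ≤ g → |z| ≤ g → |(n₁ - x) ^ 2 + (n₂ - y) ^ 2 - (h - z) ^ 2| ≤ E →
      10000 * E < x ^ 2 + y ^ 2 - z ^ 2 →
      |a * x + b * y| ≤ 1 / 1000 ∧ |z / h| ≤ 1 / 1000 ∧
      10000 * (E / h ^ 2) < (x ^ 2 + y ^ 2 - z ^ 2) / h ^ 2 ∧
      |a * x + b * y - z / h - (x ^ 2 + y ^ 2 - z ^ 2) / h ^ 2 / 2| ≤ 2 * (E / h ^ 2) ∧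
      |(x ^ 2 + y ^ 2 - z ^ 2) / h ^ 2 - (a * y - b * x) ^ 2| ≤
        (x ^ 2 + y ^ 2 - z ^ 2) / h ^ 2 / 400 ∧
      |a * x + b * y - z / h| ≤ 51 / 100 * ((x ^ 2 + y ^ 2 - z ^ 2) / h ^ 2) := by
  have hE0 : 0 ≤ E := (abs_nonneg _).trans hN
  have hh2 : 0 < h ^ 2 := by linarith
  have hh : h ≠ 0 := by rintro rfl; norm_num at hh2
  have hha : 0 < |h| := abs_pos.2 hh
  have hD2 : 0 < n₁ ^ 2 + n₂ ^ 2 := by linarith [(abs_le.1 hN).1]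
  set D := Real.sqrt (n₁ ^ 2 + n₂ ^ 2) with hD
  have hDpos : 0 < D := Real.sqrt_pos.2 hD2
  have hDD : D ^ 2 = n₁ ^ 2 + n₂ ^ 2 := Real.sq_sqrt hD2.le
  set a := n₁ / (D * |h|) with ha
  set b := n₂ / (D * |h|) with hb
  have hab : a ^ 2 + b ^ 2 = 1 / h ^ 2 := by
    rw [ha, hb, div_pow, div_pow, ← add_div, ← hDD, mul_pow, sq_abs]
    field_simp
  set U := D / |h| with hU
  have hU0 : 0 < U := by positivity
  have hUe : a * n₁ + b * n₂ = U := by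
    rw [ha, hb, hU, div_mul_eq_mul_div, div_mul_eq_mul_div, ← add_div, ← sq, ← sq, ← hDD]
    field_simp
  have hUz : a * n₂ - b * n₁ = 0 := by
    rw [ha, hb]; ring
  refine ⟨a, b, hab, ?_⟩
  intro x y z hx hy hz hv hq
  have ha1 : |a| ≤ 1 / |h| := by
    apply abs_le_of_sq_le_sq _ (by positivity)
    rw [show (1 / |h|) ^ 2 = 1 / h ^ 2 by rw [div_pow, sq_abs, one_pow], ← hab]; nlinarith [sq_nonneg b]
  have hb1 : |b| ≤ 1 / |h| := by
    apply abs_le_of_sq_le_sq _ (by positivity)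
    rw [show (1 / |h|) ^ 2 = 1 / h ^ 2 by rw [div_pow, sq_abs, one_pow], ← hab]; nlinarith [sq_nonneg a]
  have hg1 : 1 / |h| * g ≤ 1 / 2000 := by
    rw [div_mul_eq_mul_div, div_le_iff₀ hha]; linarith
  have hp : |a * x + b * y| ≤ 1 / 1000 := by
    have e1 : |a * x| ≤ 1 / |h| * g := by
      rw [abs_mul]; exact mul_le_mul ha1 hx (abs_nonneg _) (by positivity)
    have e2 : |b * y| ≤ 1 / |h| * g := by
      rw [abs_mul]; exact mul_le_mul hb1 hy (abs_nonneg _) (by positivity)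
    linarith [abs_add_le (a * x) (b * y)]
  have hk : |z / h| ≤ 1 / 1000 := by
    rw [abs_div, div_le_iff₀ hha]; linarith [abs_nonneg z]
  have hq' : 10000 * (E / h ^ 2) < (x ^ 2 + y ^ 2 - z ^ 2) / h ^ 2 := by
    rw [← mul_div_assoc]; exact div_lt_div_of_pos_right hq hh2
  refine ⟨hp, hk, hq', ?_⟩
  apply g_frame U (a * x + b * y) (a * y - b * x) (z / h) (E / h ^ 2) _ hU0 _ hp hk _ _ hq'
  · have : U ^ 2 - 1 = (n₁ ^ 2 + n₂ ^ 2 - h ^ 2) / h ^ 2 := by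
      rw [hU, div_pow, sq_abs, hDD]; field_simp
    rw [this, abs_div, abs_of_pos hh2]
    gcongr
  · have : (U - (a * x + b * y)) ^ 2 + (a * y - b * x) ^ 2 - (1 - z / h) ^ 2 =
        ((n₁ - x) ^ 2 + (n₂ - y) ^ 2 - (h - z) ^ 2) / h ^ 2 := by
      have e1 : (1 - z / h) ^ 2 = (h - z) ^ 2 / h ^ 2 := by field_simp
      have e2 : U - (a * x + b * y) = a * (n₁ - x) + b * (n₂ - y) := by rw [← hUe]; ring
      have e3 : a * y - b * x = -(a * (n₂ - y) - b * (n₁ - x)) := by linear_combination (-1) * hUz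
      rw [e1, e2, e3, sub_div, show ((n₁ - x) ^ 2 + (n₂ - y) ^ 2) / h ^ 2 =
        ((n₁ - x) ^ 2 + (n₂ - y) ^ 2) * (1 / h ^ 2) by ring, ← hab]
      ring
    rw [this, abs_div, abs_of_pos hh2]
    gcongr
  · have : (a * x + b * y) ^ 2 + (a * y - b * x) ^ 2 = (x ^ 2 + y ^ 2) * (1 / h ^ 2) := by
      rw [← hab]; ring
    rw [this, div_pow]; ring

/-- Lorentz form -/
def qf (u v : ℝ × ℝ × ℝ) : ℝ := (u.1 - v.1) ^ 2 + (u.2.1 - v.2.1) ^ 2 - (u.2.2 - v.2.2) ^ 2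

lemma qf_comm (u v : ℝ × ℝ × ℝ) : qf u v = qf v u := by unfold qf; ring

def nearby (g : ℝ) (u v : ℝ × ℝ × ℝ) : Prop :=
  |u.1 - v.1| ≤ g ∧ |u.2.1 - v.2.1| ≤ g ∧ |u.2.2 - v.2.2| ≤ g

lemma cross_form (a b h x y z x' y' z' E : ℝ) (hh : h ≠ 0) (hab : a ^ 2 + b ^ 2 = 1 / h ^ 2)
    (hc : |x * x' + y * y' - z * z'| ≤ 2 * E) :
    |(a * x + b * y) * (a * x' + b * y') + (a * y - b * x) * (a * y' - b * x') - z / h * (z' / h)|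
      ≤ 2 * (E / h ^ 2) := by
  have hh2 : 0 < h ^ 2 := by positivity
  have : (a * x + b * y) * (a * x' + b * y') + (a * y - b * x) * (a * y' - b * x') -
      z / h * (z' / h) = (x * x' + y * y' - z * z') / h ^ 2 := by
    have : (a * x + b * y) * (a * x' + b * y') + (a * y - b * x) * (a * y' - b * x') =
      (x * x' + y * y') * (1 / h ^ 2) := by rw [← hab]; ring
    rw [this]; field_simp
  rw [this, abs_div, abs_of_pos hh2, ← mul_div_assoc]
  gcongr

lemma G1 (w w' b b' : ℝ × ℝ × ℝ) (E g : ℝ) (h1 : |qf w b| ≤ E) (h2 : |qf w b'| ≤ E)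
    (h3 : |qf w' b| ≤ E) (h4 : |qf w' b'| ≤ E) (hE : E < (w.2.2 - b.2.2) ^ 2)
    (hg : 2000 * g ≤ |w.2.2 - b.2.2|) (hw : nearby g w w') (hb : nearby g b' b)
    (hqw : 10000 * E < qf w w') (hqb : 10000 * E < qf b b') :
    4 * qf b b' ≤ qf w w' ∨ 4 * qf w w' ≤ qf b b' := by
  have hE0 : 0 ≤ E := (abs_nonneg _).trans h1
  obtain ⟨a, c, hac, H⟩ := g_setup (w.1 - b.1) (w.2.1 - b.2.1) (w.2.2 - b.2.2) E g h1 hE hg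
  have hh2 : 0 < (w.2.2 - b.2.2) ^ 2 := by linarith
  have hh : w.2.2 - b.2.2 ≠ 0 := by intro h; rw [h] at hh2; norm_num at hh2
  rw [qf_comm b b'] at hqb ⊢
  obtain ⟨p1, p2, p3, p4, p5, p6⟩ := H (b'.1 - b.1) (b'.2.1 - b.2.1) (b'.2.2 - b.2.2)
    hb.1 hb.2.1 hb.2.2 (by
      have : qf w b' = (w.1 - b.1 - (b'.1 - b.1)) ^ 2 + (w.2.1 - b.2.1 - (b'.2.1 - b.2.1)) ^ 2 -
        (w.2.2 - b.2.2 - (b'.2.2 - b.2.2)) ^ 2 := by unfold qf; ring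
      rw [← this]; exact h2) hqb
  obtain ⟨r1, r2, r3, r4, r5, r6⟩ := H (w.1 - w'.1) (w.2.1 - w'.2.1) (w.2.2 - w'.2.2)
    hw.1 hw.2.1 hw.2.2 (by
      have : qf w' b = (w.1 - b.1 - (w.1 - w'.1)) ^ 2 + (w.2.1 - b.2.1 - (w.2.1 - w'.2.1)) ^ 2 -
        (w.2.2 - b.2.2 - (w.2.2 - w'.2.2)) ^ 2 := by unfold qf; ring
      rw [← this]; exact h3) hqw
  have hc : |(b'.1 - b.1) * (w.1 - w'.1) + (b'.2.1 - b.2.1) * (w.2.1 - w'.2.1) -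
      (b'.2.2 - b.2.2) * (w.2.2 - w'.2.2)| ≤ 2 * E := by
    have : (b'.1 - b.1) * (w.1 - w'.1) + (b'.2.1 - b.2.1) * (w.2.1 - w'.2.1) -
      (b'.2.2 - b.2.2) * (w.2.2 - w'.2.2) = (qf w' b' - qf w' b - qf w b' + qf w b) / 2 := by
      unfold qf; ring
    rw [this]
    rw [abs_le] at *
    constructor <;> linarith
  have key := g1_core _ _ _ _ _ _ _ _ _ (by positivity) r2 p1 p3 p5 p6 r5 r6
    (cross_form a c _ _ _ _ _ _ _ E hh hac hc)
  by_contra hcon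
  push Not at hcon
  apply key
  change qf b' b / _ < 4 * (qf w w' / _) ∧ qf w w' / _ < 4 * (qf b' b / _)
  rw [← mul_div_assoc, ← mul_div_assoc]
  exact ⟨div_lt_div_of_pos_right hcon.2 hh2, div_lt_div_of_pos_right hcon.1 hh2⟩

lemma G2_aux (w₀ w₁ w₂ b b' : ℝ × ℝ × ℝ) (E g : ℝ) (h1 : |qf w₀ b| ≤ E) (h2 : |qf w₀ b'| ≤ E)
    (h3 : |qf w₁ b| ≤ E) (h4 : |qf w₁ b'| ≤ E) (h5 : |qf w₂ b| ≤ E) (h6 : |qf w₂ b'| ≤ E)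
    (hE : E < (w₀.2.2 - b.2.2) ^ 2)
    (hg : 2000 * g ≤ |w₀.2.2 - b.2.2|) (hw₁ : nearby g w₀ w₁) (hw₂ : nearby g w₀ w₂)
    (hb : nearby g b' b)
    (hq₁ : 10000 * E < qf w₀ w₁) (hq₂ : 10000 * E < qf w₀ w₂) (hqb : 10000 * E < qf b b')
    (hl₁ : qf b b' < qf w₀ w₁) (hl₂ : qf b b' < qf w₀ w₂)
    (hm₁ : qf w₀ w₁ ≤ qf w₁ w₂) (hm₂ : qf w₀ w₂ ≤ qf w₁ w₂) : False := by
  have hE0 : 0 ≤ E := (abs_nonneg _).trans h1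
  have f1 : 4 * qf b b' ≤ qf w₀ w₁ := by
    rcases G1 w₀ w₁ b b' E g h1 h2 h3 h4 hE hg hw₁ hb hq₁ hqb with h | h <;> linarith
  have f2 : 4 * qf b b' ≤ qf w₀ w₂ := by
    rcases G1 w₀ w₂ b b' E g h1 h2 h5 h6 hE hg hw₂ hb hq₂ hqb with h | h <;> linarith
  obtain ⟨a, c, hac, H⟩ := g_setup (w₀.1 - b.1) (w₀.2.1 - b.2.1) (w₀.2.2 - b.2.2) E g h1 hE hg
  have hh2 : 0 < (w₀.2.2 - b.2.2) ^ 2 := by linarith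
  have hh : w₀.2.2 - b.2.2 ≠ 0 := by intro h; rw [h] at hh2; norm_num at hh2
  rw [qf_comm b b'] at hqb f1 f2
  obtain ⟨p1, p2, p3, p4, p5, p6⟩ := H (b'.1 - b.1) (b'.2.1 - b.2.1) (b'.2.2 - b.2.2)
    hb.1 hb.2.1 hb.2.2 (by
      have : qf w₀ b' = (w₀.1 - b.1 - (b'.1 - b.1)) ^ 2 + (w₀.2.1 - b.2.1 - (b'.2.1 - b.2.1)) ^ 2 -
        (w₀.2.2 - b.2.2 - (b'.2.2 - b.2.2)) ^ 2 := by unfold qf; ring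
      rw [← this]; exact h2) hqb
  have W : ∀ w : ℝ × ℝ × ℝ, |qf w b| ≤ E → |qf w b'| ≤ E → nearby g w₀ w →
      10000 * E < qf w₀ w → _ := fun w k1 k2 k3 k4 =>
    (⟨H (w₀.1 - w.1) (w₀.2.1 - w.2.1) (w₀.2.2 - w.2.2)
    k3.1 k3.2.1 k3.2.2 (by
      have : qf w b = (w₀.1 - b.1 - (w₀.1 - w.1)) ^ 2 + (w₀.2.1 - b.2.1 - (w₀.2.1 - w.2.1)) ^ 2 -
        (w₀.2.2 - b.2.2 - (w₀.2.2 - w.2.2)) ^ 2 := by unfold qf; ring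
      rw [← this]; exact k1) k4, cross_form a c _ (b'.1 - b.1) (b'.2.1 - b.2.1) (b'.2.2 - b.2.2)
        (w₀.1 - w.1) (w₀.2.1 - w.2.1) (w₀.2.2 - w.2.2) E hh hac (by
    have : (b'.1 - b.1) * (w₀.1 - w.1) + (b'.2.1 - b.2.1) * (w₀.2.1 - w.2.1) -
      (b'.2.2 - b.2.2) * (w₀.2.2 - w.2.2) = (qf w b' - qf w b - qf w₀ b' + qf w₀ b) / 2 := by
      unfold qf; ring
    rw [this]
    rw [abs_le] at *
    constructor <;> linarith)⟩ : _ ∧ _)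
  obtain ⟨⟨r1, r2, r3, r4, r5, r6⟩, r7⟩ := W w₁ h3 h4 hw₁ hq₁
  obtain ⟨⟨s1, s2, s3, s4, s5, s6⟩, s7⟩ := W w₂ h5 h6 hw₂ hq₂
  set h := w₀.2.2 - b.2.2 with hhd
  set P₁ := a * (w₀.1 - w₁.1) + c * (w₀.2.1 - w₁.2.1)
  set P₂ := a * (w₀.1 - w₂.1) + c * (w₀.2.1 - w₂.2.1)
  set F₁ := a * (w₀.2.1 - w₁.2.1) - c * (w₀.1 - w₁.1)
  set F₂ := a * (w₀.2.1 - w₂.2.1) - c * (w₀.1 - w₂.1)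
  set K₁ := (w₀.2.2 - w₁.2.2) / h
  set K₂ := (w₀.2.2 - w₂.2.2) / h
  have hq12 : (-P₂ - -P₁) ^ 2 + (-F₂ - -F₁) ^ 2 - (-K₂ - -K₁) ^ 2 = qf w₁ w₂ / h ^ 2 := by
    have e1 : (-P₂ - -P₁) ^ 2 + (-F₂ - -F₁) ^ 2 = ((w₁.1 - w₂.1) ^ 2 + (w₁.2.1 - w₂.2.1) ^ 2) *
      (1 / h ^ 2) := by
      rw [← hac]; simp only [P₁, P₂, F₁, F₂]; ring
    have e2 : (-K₂ - -K₁) ^ 2 = (w₂.2.2 - w₁.2.2) ^ 2 / h ^ 2 := by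
      rw [← div_pow]; simp only [K₁, K₂]; congr 1; field_simp; ring
    rw [e1, e2]; unfold qf; ring
  refine g2_core _ _ _ (-P₁) (-F₁) (-K₁) (-P₂) (-F₂) (-K₂) (E / h ^ 2) _ _ _ (by positivity)
    p2 (by rwa [abs_neg]) (by rwa [abs_neg]) p1 (by rwa [abs_neg]) (by rwa [abs_neg]) p3 ?_ ?_
    p5 p6 ?_ (by rw [neg_sq]; exact r5) (by rw [← abs_neg, show -(-P₁ - -K₁) = P₁ - K₁ by ring]; exact r6)
    ?_ (by rw [neg_sq]; exact s5) (by rw [← abs_neg, show -(-P₂ - -K₂) = P₂ - K₂ by ring]; exact s6) ?_ ?_ ?_ ?_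
  · change 4 * (qf b' b / h ^ 2) ≤ qf w₀ w₁ / h ^ 2
    rw [← mul_div_assoc]; gcongr
  · change 4 * (qf b' b / h ^ 2) ≤ qf w₀ w₂ / h ^ 2
    rw [← mul_div_assoc]; gcongr
  · rw [show -(-P₁ - -K₁) = P₁ - K₁ by ring]; exact r4
  · rw [show -(-P₂ - -K₂) = P₂ - K₂ by ring]; exact s4
  · rw [← abs_neg]
    convert r7 using 2; ring
  · rw [← abs_neg]
    convert s7 using 2; ring
  · rw [hq12]; change qf w₀ w₁ / h ^ 2 ≤ _; gcongr
  · rw [hq12]; change qf w₀ w₂ / h ^ 2 ≤ _; gcongr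

def Edg (E τ : ℝ) (w b : ℝ × ℝ × ℝ) : Prop := |qf w b| ≤ E ∧
  τ ^ 2 ≤ (w.1 - b.1) ^ 2 + (w.2.1 - b.2.1) ^ 2 + (w.2.2 - b.2.2) ^ 2

lemma Edg.symm {E τ : ℝ} {w b : ℝ × ℝ × ℝ} (h : Edg E τ w b) : Edg E τ b w := by
  refine ⟨by rw [qf_comm]; exact h.1, h.2.trans (le_of_eq (by ring))⟩

lemma nearby.symm {g : ℝ} {u v : ℝ × ℝ × ℝ} (h : nearby g u v) : nearby g v u := by
  obtain ⟨h1, h2, h3⟩ := h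
  exact ⟨by rwa [abs_sub_comm], by rwa [abs_sub_comm], by rwa [abs_sub_comm]⟩

lemma Edg.height {E τ : ℝ} {w b : ℝ × ℝ × ℝ} (h : Edg E τ w b) (hτ : 0 < τ)
    {u v : ℝ × ℝ × ℝ} (hu : nearby (τ / 4000) u v) (hq : 10000 * E < qf u v) :
    E < (w.2.2 - b.2.2) ^ 2 ∧ 2000 * (τ / 4000) ≤ |w.2.2 - b.2.2| := by
  have hE0 : 0 ≤ E := (abs_nonneg _).trans h.1
  have h1 : qf u v ≤ 2 * (τ / 4000) ^ 2 := by
    have e1 : (u.1 - v.1) ^ 2 ≤ (τ / 4000) ^ 2 := by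
      rw [← sq_abs]; exact pow_le_pow_left₀ (abs_nonneg _) hu.1 2
    have e2 : (u.2.1 - v.2.1) ^ 2 ≤ (τ / 4000) ^ 2 := by
      rw [← sq_abs]; exact pow_le_pow_left₀ (abs_nonneg _) hu.2.1 2
    unfold qf; nlinarith [sq_nonneg (u.2.2 - v.2.2)]
  have h2 := (abs_le.1 h.1).2
  have h3 := h.2
  unfold qf at h2
  have h4 : (τ / 2) ^ 2 ≤ (w.2.2 - b.2.2) ^ 2 := by nlinarith
  refine ⟨by nlinarith, ?_⟩
  have := sq_le_sq.1 h4
  rw [abs_of_pos (by positivity)] at this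
  linarith

lemma G1' (w w' b b' : ℝ × ℝ × ℝ) (E τ : ℝ) (hτ : 0 < τ) (h1 : Edg E τ w b) (h2 : Edg E τ w b')
    (h3 : Edg E τ w' b) (h4 : Edg E τ w' b')
    (hw : nearby (τ / 4000) w w') (hb : nearby (τ / 4000) b b')
    (hqw : 10000 * E < qf w w') (hqb : 10000 * E < qf b b') :
    4 * qf b b' ≤ qf w w' ∨ 4 * qf w w' ≤ qf b b' := by
  obtain ⟨k1, k2⟩ := h1.height hτ hw hqw
  exact G1 w w' b b' E (τ / 4000) h1.1 h2.1 h3.1 h4.1 k1 k2 hw hb.symm hqw hqb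

lemma G2' (w₀ w₁ w₂ b b' : ℝ × ℝ × ℝ) (E τ : ℝ) (hτ : 0 < τ)
    (h1 : Edg E τ w₀ b) (h2 : Edg E τ w₀ b')
    (h3 : Edg E τ w₁ b) (h4 : Edg E τ w₁ b') (h5 : Edg E τ w₂ b) (h6 : Edg E τ w₂ b')
    (hw₁ : nearby (τ / 4000) w₀ w₁) (hw₂ : nearby (τ / 4000) w₀ w₂)
    (hw₃ : nearby (τ / 4000) w₁ w₂)
    (hb : nearby (τ / 4000) b b') (hqb : 10000 * E < qf b b')
    (hl₁ : qf b b' < qf w₀ w₁) (hl₂ : qf b b' < qf w₀ w₂) (hl₃ : qf b b' < qf w₁ w₂) : False := by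
  obtain ⟨k1, k2⟩ := h1.height hτ hb hqb
  obtain ⟨k3, k4⟩ := h3.height hτ hb hqb
  obtain ⟨k5, k6⟩ := h5.height hτ hb hqb
  by_cases c1 : qf w₀ w₁ ≤ qf w₁ w₂
  · by_cases c2 : qf w₀ w₂ ≤ qf w₁ w₂
    · exact G2_aux w₀ w₁ w₂ b b' E _ h1.1 h2.1 h3.1 h4.1 h5.1 h6.1 k1 k2 hw₁ hw₂ hb.symm
        (by linarith) (by linarith) hqb hl₁ hl₂ c1 c2
    · exact G2_aux w₁ w₀ w₂ b b' E _ h3.1 h4.1 h1.1 h2.1 h5.1 h6.1 k3 k4 hw₁.symm hw₃ hb.symm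
        (by rw [qf_comm]; linarith) (by linarith) hqb (by rw [qf_comm w₁]; exact hl₁) hl₃
        (by rw [qf_comm w₁]; linarith) (by linarith)
  · by_cases c2 : qf w₀ w₁ ≤ qf w₀ w₂
    · exact G2_aux w₁ w₀ w₂ b b' E _ h3.1 h4.1 h1.1 h2.1 h5.1 h6.1 k3 k4 hw₁.symm hw₃ hb.symm
        (by rw [qf_comm]; linarith) (by linarith) hqb (by rw [qf_comm w₁]; exact hl₁) hl₃
        (by rw [qf_comm w₁]; linarith) (by linarith)
    · exact G2_aux w₂ w₀ w₁ b b' E _ h5.1 h6.1 h1.1 h2.1 h3.1 h4.1 k5 k6 hw₂.symm hw₃.symm hb.symm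
        (by rw [qf_comm]; linarith) (by rw [qf_comm]; linarith) hqb
        (by rw [qf_comm w₂]; exact hl₂) (by rw [qf_comm w₂]; exact hl₃)
        (by rw [qf_comm w₂]; linarith) (by rw [qf_comm w₂]; linarith)

section dirs
variable {V : Type*} [NormedAddCommGroup V] [InnerProductSpace ℝ V]

lemma sq_err {x r e : ℝ} (h : |x - r| ≤ e) (hx : 0 ≤ x) (hr0 : 0 ≤ r) (hr : r ≤ 1) (he : e ≤ 1) :
    |x ^ 2 - r ^ 2| ≤ 3 * e := by
  rw [show x ^ 2 - r ^ 2 = (x - r) * (x + r) by ring, abs_mul, abs_of_nonneg (by linarith : 0 ≤ x + r)]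
  have := abs_le.1 h
  have h1 : x + r ≤ 3 := by linarith
  nlinarith [abs_nonneg (x - r)]

lemma dir1 (ζ d : V) (r k e X : ℝ) (h1 : |‖ζ‖ - r| ≤ e) (h2 : |‖ζ - d‖ - (r + k)| ≤ e)
    (h3 : abs (‖d‖ - |k|) ≤ e) (hd : ‖d‖ ≤ X) (hk : |k| ≤ X) (hk1 : |k| ≤ 1) (he : e ≤ 1)
    (hr : r ∈ Set.Icc (1 / 2 : ℝ) 1) (hr' : r + k ∈ Set.Icc (1 / 2 : ℝ) 1) :
    ‖k • ζ + r • d‖ ^ 2 ≤ 13 * (e * X) := by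
  have he0 : 0 ≤ e := (abs_nonneg _).trans h1
  have a1 := sq_err h1 (norm_nonneg _) (by linarith [hr.1]) hr.2 he
  have a2 := sq_err h2 (norm_nonneg _) (by linarith [hr'.1]) hr'.2 he
  have a3 : |‖d‖ ^ 2 - k ^ 2| ≤ e * (2 * X) := by
    rw [← sq_abs k, show ‖d‖ ^ 2 - |k| ^ 2 = (‖d‖ - |k|) * (‖d‖ + |k|) by ring, abs_mul]
    apply mul_le_mul h3 _ (abs_nonneg _) he0
    rw [abs_of_nonneg (by positivity)]; linarith
  have e1 : ‖k • ζ + r • d‖ ^ 2 = k ^ 2 * ‖ζ‖ ^ 2 + 2 * (k * r * inner ℝ ζ d) + r ^ 2 * ‖d‖ ^ 2 := by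
    rw [norm_add_sq_real, norm_smul, norm_smul, inner_smul_left, inner_smul_right, mul_pow, mul_pow,
      Real.norm_eq_abs, Real.norm_eq_abs, sq_abs, sq_abs]
    simp; ring
  have e2 : ‖ζ - d‖ ^ 2 = ‖ζ‖ ^ 2 - 2 * inner ℝ ζ d + ‖d‖ ^ 2 := norm_sub_sq_real _ _
  set A := ‖ζ‖ ^ 2 - r ^ 2 with hA
  set A' := ‖ζ - d‖ ^ 2 - (r + k) ^ 2 with hA'
  set A'' := ‖d‖ ^ 2 - k ^ 2 with hA''
  have e3 : ‖k • ζ + r • d‖ ^ 2 = k ^ 2 * A - r * k * (A' - A - A'') + r ^ 2 * A'' := by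
    rw [e1, hA, hA', hA'', e2]; ring
  have hX : 0 ≤ X := (norm_nonneg _).trans hd
  have f1 : |k ^ 2 * A| ≤ 3 * (e * X) := by
    rw [abs_mul, abs_pow, sq]
    have : |k| * |k| ≤ 1 * X := mul_le_mul hk1 hk (abs_nonneg _) (by norm_num)
    have := mul_le_mul this a1 (abs_nonneg _) (by positivity)
    linarith
  have f2 : |r * k * (A' - A - A'')| ≤ 6 * (e * X) + 2 * (e * X) := by
    have g1 : |r * k * (A' - A)| ≤ X * (6 * e) := by
      rw [abs_mul, abs_mul]
      have : |r| ≤ 1 := by rw [abs_of_nonneg (by linarith [hr.1])]; exact hr.2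
      have h5 : |r| * |k| ≤ 1 * X := mul_le_mul this hk (abs_nonneg _) (by norm_num)
      have h6 : |A' - A| ≤ 6 * e := (abs_sub _ _).trans (by linarith)
      have := mul_le_mul h5 h6 (abs_nonneg _) (by positivity)
      linarith
    have g2 : |r * k * A''| ≤ 1 * (e * (2 * X)) := by
      rw [abs_mul, abs_mul]
      have : |r| ≤ 1 := by rw [abs_of_nonneg (by linarith [hr.1])]; exact hr.2
      have h5 : |r| * |k| ≤ 1 * 1 := mul_le_mul this hk1 (abs_nonneg _) (by norm_num)
      have := mul_le_mul h5 a3 (abs_nonneg _) (by positivity)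
      linarith
    have : r * k * (A' - A - A'') = r * k * (A' - A) - r * k * A'' := by ring
    rw [this]
    refine (abs_sub _ _).trans (by linarith)
  have f3 : |r ^ 2 * A''| ≤ 1 * (e * (2 * X)) := by
    rw [abs_mul]
    apply mul_le_mul _ a3 (abs_nonneg _) (by norm_num)
    rw [abs_of_nonneg (by positivity)]; nlinarith [hr.1, hr.2]
  rw [e3]
  have := abs_le.1 f1; have := abs_le.1 f2; have := abs_le.1 f3
  linarith

lemma dirA (ev ζ d : V) (r k e X B Y h₀ : ℝ) (h1 : |‖ζ‖ - r| ≤ e) (h2 : |‖ζ - d‖ - (r + k)| ≤ e)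
    (h3 : abs (‖d‖ - |k|) ≤ e) (hd : ‖d‖ ≤ X) (hk : |k| ≤ X) (hk1 : |k| ≤ 1) (he : e ≤ 1)
    (hr : r ∈ Set.Icc (1 / 2 : ℝ) 1) (hr' : r + k ∈ Set.Icc (1 / 2 : ℝ) 1)
    (hev : ‖ζ - r • ev‖ ≤ Y) (hh : 0 < h₀) (hkh : h₀ ≤ |k|) (hB0 : 0 ≤ B)
    (hB : 13 * (e * X) ≤ (B * h₀) ^ 2) : ‖ev + k⁻¹ • d‖ ≤ 2 * (B + Y) := by
  have q1 := (dir1 ζ d r k e X h1 h2 h3 hd hk hk1 he hr hr').trans hB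
  have q2 : ‖k • ζ + r • d‖ ≤ B * h₀ := (abs_le_of_sq_le_sq' q1 (by positivity)).2
  have hkpos : 0 < |k| := by linarith
  have hk0 : k ≠ 0 := abs_pos.1 hkpos
  have hY : 0 ≤ Y := (norm_nonneg _).trans hev
  have hr0 : (0 : ℝ) < r := by linarith [hr.1]
  have q3 : (k * r) • (ev + k⁻¹ • d) = (k • ζ + r • d) - k • (ζ - r • ev) := by
    rw [smul_add, smul_smul, smul_sub, smul_smul, show k * r * k⁻¹ = r by field_simp]
    abel
  have q4 : |k| * r * ‖ev + k⁻¹ • d‖ ≤ B * h₀ + |k| * Y := by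
    have : ‖(k * r) • (ev + k⁻¹ • d)‖ = |k| * r * ‖ev + k⁻¹ • d‖ := by
      rw [norm_smul, Real.norm_eq_abs, abs_mul, abs_of_pos hr0]
    rw [← this, q3]
    refine (norm_sub_le _ _).trans ?_
    rw [norm_smul, Real.norm_eq_abs]
    gcongr
  have q5 : |k| * (r * ‖ev + k⁻¹ • d‖) ≤ |k| * (B + Y) := by nlinarith
  have q6 := le_of_mul_le_mul_left q5 hkpos
  nlinarith [norm_nonneg (ev + k⁻¹ • d), hr.1]

lemma dirB (d₁ d₂ : V) (k₁ k₂ E q₀ h₀ B : ℝ) (h1 : |‖d₁‖ ^ 2 - k₁ ^ 2| ≤ E)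
    (h2 : |‖d₂‖ ^ 2 - k₂ ^ 2| ≤ E) (hQ : ‖d₁ - d₂‖ ^ 2 - (k₁ - k₂) ^ 2 ≤ q₀)
    (hh : 0 < h₀) (hk₁ : h₀ ≤ |k₁|) (hk₂ : h₀ ≤ |k₂|) (hkk : 0 < k₁ * k₂) (hq₀ : 0 ≤ q₀)
    (hB0 : 0 ≤ B) (hB : 4 * E + q₀ ≤ (B * h₀) ^ 2) : ‖k₁⁻¹ • d₁ - k₂⁻¹ • d₂‖ ≤ B := by
  have hE : 0 ≤ E := (abs_nonneg _).trans h1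
  have hk10 : k₁ ≠ 0 := by rintro rfl; simp at hkk
  have hk20 : k₂ ≠ 0 := by rintro rfl; simp at hkk
  have e0 : ‖k₂ • d₁ - k₁ • d₂‖ ^ 2 = k₂ ^ 2 * ‖d₁‖ ^ 2 - 2 * (k₁ * k₂ * inner ℝ d₁ d₂) +
      k₁ ^ 2 * ‖d₂‖ ^ 2 := by
    rw [norm_sub_sq_real, norm_smul, norm_smul, inner_smul_left, inner_smul_right, mul_pow, mul_pow,
      Real.norm_eq_abs, Real.norm_eq_abs, sq_abs, sq_abs]
    simp; ring
  have e2 : ‖d₁ - d₂‖ ^ 2 = ‖d₁‖ ^ 2 - 2 * inner ℝ d₁ d₂ + ‖d₂‖ ^ 2 := norm_sub_sq_real _ _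
  set a₁ := ‖d₁‖ ^ 2 - k₁ ^ 2 with ha1
  set a₂ := ‖d₂‖ ^ 2 - k₂ ^ 2 with ha2
  have e3 : ‖k₂ • d₁ - k₁ • d₂‖ ^ 2 = a₁ * (k₂ * (k₂ - k₁)) + a₂ * (k₁ * (k₁ - k₂)) +
      k₁ * k₂ * (‖d₁ - d₂‖ ^ 2 - (k₁ - k₂) ^ 2) := by
    rw [e0, e2, ha1, ha2]; ring
  set x := |k₁| with hx
  set y := |k₂| with hy
  have hxy : k₁ * k₂ = x * y := by rw [hx, hy, ← abs_mul, abs_of_pos hkk]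
  have hx0 : 0 < x := by linarith
  have hy0 : 0 < y := by linarith
  have t1 : a₁ * (k₂ * (k₂ - k₁)) ≤ E * (y * (y + x)) := by
    refine (le_abs_self _).trans ?_
    rw [abs_mul, abs_mul]
    gcongr
    exact (abs_sub _ _)
  have t2 : a₂ * (k₁ * (k₁ - k₂)) ≤ E * (x * (x + y)) := by
    refine (le_abs_self _).trans ?_
    rw [abs_mul, abs_mul]
    gcongr
    exact (abs_sub _ _)
  have t3 : k₁ * k₂ * (‖d₁ - d₂‖ ^ 2 - (k₁ - k₂) ^ 2) ≤ x * y * q₀ := by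
    rw [hxy]; gcongr
  have t4 : ‖k₂ • d₁ - k₁ • d₂‖ ^ 2 ≤ (B * (x * y)) ^ 2 := by
    rw [e3]
    have u1 : h₀ ^ 2 * (x + y) ^ 2 ≤ 4 * (x * y) ^ 2 := by
      have : h₀ * (x + y) ≤ 2 * (x * y) := by nlinarith
      have := pow_le_pow_left₀ (by positivity) this 2
      nlinarith
    have u2 : h₀ ^ 2 * (x * y) ≤ (x * y) ^ 2 := by
      have : h₀ * h₀ ≤ x * y := mul_le_mul hk₁ hk₂ hh.le hx0.le
      nlinarith [mul_pos hx0 hy0]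
    have u3 : h₀ ^ 2 * (E * (x + y) ^ 2 + x * y * q₀) ≤ h₀ ^ 2 * (B * (x * y)) ^ 2 := by
      calc h₀ ^ 2 * (E * (x + y) ^ 2 + x * y * q₀) = E * (h₀ ^ 2 * (x + y) ^ 2) +
            q₀ * (h₀ ^ 2 * (x * y)) := by ring
        _ ≤ E * (4 * (x * y) ^ 2) + q₀ * (x * y) ^ 2 := by gcongr
        _ = (4 * E + q₀) * (x * y) ^ 2 := by ring
        _ ≤ (B * h₀) ^ 2 * (x * y) ^ 2 := by gcongr
        _ = _ := by ring
    have := le_of_mul_le_mul_left u3 (by positivity)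
    nlinarith
  have t5 : ‖k₂ • d₁ - k₁ • d₂‖ ≤ B * (x * y) := (abs_le_of_sq_le_sq' t4 (by positivity)).2
  have t6 : (k₁ * k₂) • (k₁⁻¹ • d₁ - k₂⁻¹ • d₂) = k₂ • d₁ - k₁ • d₂ := by
    rw [smul_sub, smul_smul, smul_smul, show k₁ * k₂ * k₁⁻¹ = k₂ by field_simp,
      show k₁ * k₂ * k₂⁻¹ = k₁ by field_simp]
  rw [← t6, norm_smul, Real.norm_eq_abs, abs_of_pos hkk, hxy] at t5
  have : (x * y) * ‖k₁⁻¹ • d₁ - k₂⁻¹ • d₂‖ ≤ (x * y) * B := by linarith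
  exact le_of_mul_le_mul_left this (by positivity)

set_option maxHeartbeats 1000000 in
/-- combination -/
lemma dirC (v₁ v₂ ζ₁ ζ₂ d₁ d₂ : V) (r k₁ k₂ lam t K S : ℝ) (hv₁ : ‖v₁‖ = 1) (hv₂ : ‖v₂‖ = 1)
    (hlam : 0 < lam) (ht : 0 < t) (hK : 1 ≤ K) (hS : 0 < S) (hS2 : lam / t ≤ S ^ 2)
    (he : K * lam ≤ 1)
    (hr : r ∈ Set.Icc (1 / 2 : ℝ) 1) (hr₁ : r + k₁ ∈ Set.Icc (1 / 2 : ℝ) 1)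
    (hr₂ : r + k₂ ∈ Set.Icc (1 / 2 : ℝ) 1)
    (a1 : |‖ζ₁‖ - r| ≤ K * lam) (a2 : |‖ζ₁ - d₁‖ - (r + k₁)| ≤ K * lam)
    (a3 : abs (‖d₁‖ - |k₁|) ≤ K * lam) (a4 : ‖ζ₁ - r • v₁‖ ≤ K * S)
    (a5 : t / K ≤ Real.sqrt (‖d₁‖ ^ 2 + k₁ ^ 2)) (a6 : Real.sqrt (‖d₁‖ ^ 2 + k₁ ^ 2) ≤ K * t)
    (b1 : |‖ζ₂‖ - r| ≤ K * lam) (b2 : |‖ζ₂ - d₂‖ - (r + k₂)| ≤ K * lam)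
    (b3 : abs (‖d₂‖ - |k₂|) ≤ K * lam) (b4 : ‖ζ₂ - r • v₂‖ ≤ K * S)
    (b5 : t / K ≤ Real.sqrt (‖d₂‖ ^ 2 + k₂ ^ 2)) (b6 : Real.sqrt (‖d₂‖ ^ 2 + k₂ ^ 2) ≤ K * t)
    (hkk : |k₁ - k₂| ≤ t / K / 4000)
    (hQ : ‖d₁ - d₂‖ ^ 2 - (k₁ - k₂) ^ 2 ≤ 10000 * (2 * K ^ 2 * lam * t)) :
    ‖v₁ - v₂‖ ≤ 400 * K ^ 2 * S := by
  have hK0 : 0 < K := by linarith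
  set τ := t / K with hτ
  have hτ0 : 0 < τ := by positivity
  have aux : ∀ (d : V) (k : ℝ), abs (‖d‖ - |k|) ≤ K * lam → Real.sqrt (‖d‖ ^ 2 + k ^ 2) ≤ K * t →
      ‖d‖ ≤ K * t ∧ |k| ≤ K * t ∧ |‖d‖ ^ 2 - k ^ 2| ≤ 2 * K ^ 2 * lam * t := by
    intro d k h1 h2
    have c1 : ‖d‖ ≤ K * t := by
      refine le_trans (Real.le_sqrt_of_sq_le ?_) h2; nlinarith [sq_nonneg k]
    have c2 : |k| ≤ K * t := by
      refine le_trans (Real.le_sqrt_of_sq_le ?_) h2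
      rw [sq_abs]; nlinarith [sq_nonneg ‖d‖]
    refine ⟨c1, c2, ?_⟩
    rw [← sq_abs k, show ‖d‖ ^ 2 - |k| ^ 2 = (‖d‖ - |k|) * (‖d‖ + |k|) by ring, abs_mul]
    have : abs (‖d‖ + |k|) ≤ 2 * (K * t) := by rw [abs_of_nonneg (by positivity)]; linarith
    have := mul_le_mul h1 this (abs_nonneg _) (by positivity)
    refine this.trans (le_of_eq (by ring))
  obtain ⟨a7, a8, a9⟩ := aux d₁ k₁ a3 a6
  obtain ⟨b7, b8, b9⟩ := aux d₂ k₂ b3 b6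
  have hlt : lam ≤ S ^ 2 * t := by rwa [div_le_iff₀ ht] at hS2
  have triv : ∀ (d : V) (k : ℝ), t / K ≤ Real.sqrt (‖d‖ ^ 2 + k ^ 2) →
      |‖d‖ ^ 2 - k ^ 2| ≤ 2 * K ^ 2 * lam * t → |k| < τ / 2 → ‖v₁ - v₂‖ ≤ 400 * K ^ 2 * S := by
    intro d k h1 h2 h3
    have c1 : τ ^ 2 ≤ ‖d‖ ^ 2 + k ^ 2 := by
      have := pow_le_pow_left₀ hτ0.le h1 2
      rwa [Real.sq_sqrt (by positivity)] at this
    have c2 : k ^ 2 ≤ τ ^ 2 / 4 := by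
      have := pow_le_pow_left₀ (abs_nonneg _) h3.le 2
      rw [sq_abs] at this; linarith
    have c3 := (abs_le.1 h2).2
    have c4 : τ ^ 2 ≤ 4 * K ^ 2 * lam * t := by linarith
    have htK : t = τ * K := by rw [hτ]; field_simp
    have c5 : τ ^ 2 ≤ τ ^ 2 * (2 * K ^ 2 * S) ^ 2 := by
      calc τ ^ 2 ≤ 4 * K ^ 2 * lam * t := c4
        _ ≤ 4 * K ^ 2 * (S ^ 2 * t) * t := by gcongr
        _ = τ ^ 2 * (2 * K ^ 2 * S) ^ 2 := by rw [htK]; ring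
    have c6 : 1 ≤ (2 * K ^ 2 * S) ^ 2 := by
      have : τ ^ 2 * 1 ≤ τ ^ 2 * (2 * K ^ 2 * S) ^ 2 := by linarith
      exact le_of_mul_le_mul_left this (by positivity)
    have c7 : 1 ≤ 2 * K ^ 2 * S := by
      by_contra hcon
      have : (2 * K ^ 2 * S) ^ 2 < 1 := by
        have := pow_lt_pow_left₀ (not_le.1 hcon) (by positivity) (two_ne_zero)
        simpa using this
      linarith
    have := norm_sub_le v₁ v₂
    rw [hv₁, hv₂] at this
    linarith
  by_cases hc1 : |k₁| < τ / 2
  · exact triv d₁ k₁ a5 a9 hc1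
  by_cases hc2 : |k₂| < τ / 2
  · exact triv d₂ k₂ b5 b9 hc2
  push Not at hc1 hc2
  have hkpos : 0 < k₁ * k₂ := by
    by_contra hcon
    have h1 : |k₁| + |k₂| = |k₁ - k₂| := by
      rcases le_or_gt 0 k₁ with h | h
      · rcases le_or_gt k₂ 0 with h' | h'
        · rw [abs_of_nonneg h, abs_of_nonpos h', abs_of_nonneg (by linarith)]; ring
        · have : k₁ = 0 := by nlinarith
          simp [this]
      · rcases le_or_gt 0 k₂ with h' | h'
        · rw [abs_of_neg h, abs_of_nonneg h', abs_of_nonpos (by linarith)]; ring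
        · nlinarith
    linarith
  have k1le : ∀ k, r + k ∈ Set.Icc (1 / 2 : ℝ) 1 → |k| ≤ 1 := by
    intro k hk; rw [abs_le]; constructor <;> linarith [hr.1, hr.2, hk.1, hk.2]
  have hB1 : 13 * (K * lam * (K * t)) ≤ (8 * K ^ 2 * S * (τ / 2)) ^ 2 := by
    have htK : τ * K = t := by rw [hτ]; field_simp
    calc 13 * (K * lam * (K * t)) ≤ 16 * (K * (S ^ 2 * t) * (K * t)) := by
          have : K * lam * (K * t) ≤ K * (S ^ 2 * t) * (K * t) := by gcongr
          have h0 : 0 ≤ K * lam * (K * t) := by positivity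
          linarith
      _ = 16 * (K * S) ^ 2 * t ^ 2 := by ring
      _ = 16 * (K * S) ^ 2 * (τ * K) ^ 2 := by rw [htK]
      _ = _ := by ring
  have r1 := dirA v₁ ζ₁ d₁ r k₁ (K * lam) (K * t) (8 * K ^ 2 * S) (K * S) (τ / 2) a1 a2 a3 a7 a8
    (k1le _ hr₁) he hr hr₁ a4 (by positivity) hc1 (by positivity) hB1
  have r2 := dirA v₂ ζ₂ d₂ r k₂ (K * lam) (K * t) (8 * K ^ 2 * S) (K * S) (τ / 2) b1 b2 b3 b7 b8
    (k1le _ hr₂) he hr hr₂ b4 (by positivity) hc2 (by positivity) hB1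
  have r3 := dirB d₁ d₂ k₁ k₂ _ _ (τ / 2) (300 * K ^ 2 * S) a9 b9 hQ (by positivity) hc1 hc2 hkpos
    (by positivity) (by positivity) (by
      have htK : τ * K = t := by rw [hτ]; field_simp
      calc 4 * (2 * K ^ 2 * lam * t) + 10000 * (2 * K ^ 2 * lam * t) = 20008 * (K ^ 2 * lam * t) := by ring
        _ ≤ 22500 * (K ^ 2 * (S ^ 2 * t) * t) := by
          have : K ^ 2 * lam * t ≤ K ^ 2 * (S ^ 2 * t) * t := by gcongr
          have h0 : 0 ≤ K ^ 2 * lam * t := by positivity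
          linarith
        _ = 22500 * (K * S) ^ 2 * t ^ 2 := by ring
        _ = 22500 * (K * S) ^ 2 * (τ * K) ^ 2 := by rw [htK]
        _ = _ := by ring)
  have r4 : v₁ - v₂ = (v₁ + k₁⁻¹ • d₁) - (v₂ + k₂⁻¹ • d₂) - (k₁⁻¹ • d₁ - k₂⁻¹ • d₂) := by abel
  have hKS : K * S ≤ K ^ 2 * S := by
    have : K ≤ K ^ 2 := by nlinarith
    gcongr
  calc ‖v₁ - v₂‖ ≤ ‖v₁ + k₁⁻¹ • d₁‖ + ‖v₂ + k₂⁻¹ • d₂‖ + ‖k₁⁻¹ • d₁ - k₂⁻¹ • d₂‖ := by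
        rw [r4]
        refine (norm_sub_le _ _).trans ?_
        gcongr
        exact norm_sub_le _ _
    _ ≤ 400 * K ^ 2 * S := by
        have : 0 ≤ K ^ 2 * S := by positivity
        linarith
end dirs



lemma dir_zero (θ : ℝ) : dir θ 0 = Real.cos θ := by simp [dir, mk2]
lemma dir_one (θ : ℝ) : dir θ 1 = Real.sin θ := by simp [dir, mk2]

lemma plane_norm_sq (v : Plane) : ‖v‖ ^ 2 = v 0 ^ 2 + v 1 ^ 2 := by
  rw [EuclideanSpace.norm_sq_eq, Fin.sum_univ_two]; simp

lemma dir_norm (θ : ℝ) : ‖dir θ‖ = 1 := by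
  have h := plane_norm_sq (dir θ)
  rw [dir_zero, dir_one, Real.cos_sq_add_sin_sq] at h
  exact (sq_eq_sq₀ (norm_nonneg _) zero_le_one).1 (by rw [h]; norm_num)

lemma dir_sub_norm (a b : ℝ) : ‖dir a - dir b‖ = 2 * |Real.sin ((a - b) / 2)| := by
  have h := plane_norm_sq (dir a - dir b)
  have e0 : (dir a - dir b) 0 = Real.cos a - Real.cos b := by simp [dir_zero]
  have e1 : (dir a - dir b) 1 = Real.sin a - Real.sin b := by simp [dir_one]
  rw [e0, e1] at h
  have h2 : ‖dir a - dir b‖ ^ 2 = (2 * |Real.sin ((a - b) / 2)|) ^ 2 := by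
    rw [h, Real.cos_sub_cos, Real.sin_sub_sin, mul_pow 2 |Real.sin ((a-b)/2)|, sq_abs]
    nlinarith [Real.sin_sq_add_cos_sq ((a + b) / 2)]
  exact (sq_eq_sq₀ (norm_nonneg _) (by positivity)).1 h2

lemma dir_lip (a b : ℝ) : ‖dir a - dir b‖ ≤ |a - b| := by
  rw [dir_sub_norm]
  have := Real.abs_sin_le_abs (x := (a - b) / 2)
  rw [abs_div, abs_two] at this; linarith

lemma sin_low (y : ℝ) (h0 : 0 ≤ y) (h1 : y ≤ 1) (u : ℝ) (h : Real.sin (Real.pi * y) ≤ u) :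
    2 * y ≤ u ∨ 2 * (1 - y) ≤ u := by
  have hp := Real.pi_pos
  rcases le_total y (1 / 2) with hy | hy
  · left
    have := Real.mul_le_sin (x := Real.pi * y) (by positivity) (by nlinarith)
    have e : 2 / Real.pi * (Real.pi * y) = 2 * y := by field_simp
    linarith
  · right
    have := Real.mul_le_sin (x := Real.pi * (1 - y)) (mul_nonneg hp.le (by linarith)) (by nlinarith)
    have e : 2 / Real.pi * (Real.pi * (1 - y)) = 2 * (1 - y) := by field_simp
    have e2 : Real.sin (Real.pi * (1 - y)) = Real.sin (Real.pi * y) := by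
      rw [show Real.pi * (1 - y) = Real.pi - Real.pi * y by ring, Real.sin_pi_sub]
    linarith

/-- number of integers in an interval -/
lemma int_count (a b : ℝ) (hab : a ≤ b + 1) : ((Finset.Icc ⌈a⌉ ⌊b⌋).card : ℝ) ≤ b - a + 1 := by
  rw [Int.card_Icc]
  have h1 := Int.floor_le b
  have h2 := Int.le_ceil a
  rcases le_total 0 (⌊b⌋ + 1 - ⌈a⌉) with h | h
  · have : (((⌊b⌋ + 1 - ⌈a⌉).toNat : ℤ) : ℝ) = ((⌊b⌋ + 1 - ⌈a⌉ : ℤ) : ℝ) := by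
      rw [Int.toNat_of_nonneg h]
    have h3 : (((⌊b⌋ + 1 - ⌈a⌉).toNat : ℤ) : ℝ) = ((⌊b⌋ + 1 - ⌈a⌉).toNat : ℝ) := Int.cast_natCast _
    rw [← h3, this]; push_cast; linarith
  · rw [Int.toNat_of_nonpos h]; simp; linarith

def ang (σ : ℝ) (j : ℤ) : ℝ := ((j : ℝ) + 1 / 2) * (2 * Real.pi * σ)

lemma arc_count (σ : ℝ) (hσ : 0 < σ) (R : ℝ) (hR : 1 ≤ R) (j₀ : ℤ) (hj₀ : validArc σ j₀)
    (S : Finset ℤ) (hS : ∀ j ∈ S, validArc σ j ∧ ‖dir (ang σ j) - dir (ang σ j₀)‖ ≤ R * σ) :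
    (S.card : ℝ) ≤ 4 * R := by
  classical
  have hsub : S ⊆ (Finset.Icc ⌈(j₀ : ℝ) - R / 4⌉ ⌊(j₀ : ℝ) + R / 4⌋ ∪
      Finset.Icc ⌈σ⁻¹ - R / 4⌉ ⌊σ⁻¹⌋) ∪ Finset.Icc ⌈(0 : ℝ)⌉ ⌊R / 4⌋ := by
    intro j hj
    obtain ⟨⟨hv0, hv1⟩, hd⟩ := hS j hj
    obtain ⟨hw0, hw1⟩ := hj₀
    have hv0' : (0 : ℝ) ≤ j := by exact_mod_cast hv0
    have hw0' : (0 : ℝ) ≤ j₀ := by exact_mod_cast hw0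
    rw [dir_sub_norm] at hd
    have e1 : (ang σ j - ang σ j₀) / 2 = Real.pi * (((j : ℝ) - j₀) * σ) := by
      unfold ang; ring
    rw [e1] at hd
    set y := |(j : ℝ) - j₀| * σ with hy
    have hσσ : σ⁻¹ * σ = 1 := inv_mul_cancel₀ hσ.ne'
    have hab : |(j : ℝ) - j₀| ≤ σ⁻¹ := by
      rw [abs_le]; constructor <;> linarith
    have hy1 : y ≤ 1 := by rw [← hσσ]; exact mul_le_mul_of_nonneg_right hab hσ.le
    have e2 : Real.sin (Real.pi * y) ≤ R * σ / 2 := by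
      have : Real.sin (Real.pi * y) ≤ |Real.sin (Real.pi * (((j : ℝ) - j₀) * σ))| := by
        rcases le_total 0 ((j : ℝ) - j₀) with h | h
        · rw [hy, abs_of_nonneg h]; exact le_abs_self _
        · rw [hy, abs_of_nonpos h, show Real.pi * (-((j : ℝ) - j₀) * σ) =
            -(Real.pi * (((j : ℝ) - j₀) * σ)) by ring, Real.sin_neg]
          exact neg_le_abs _
      linarith
    have key : |(j : ℝ) - j₀| ≤ R / 4 ∨ σ⁻¹ - R / 4 ≤ |(j : ℝ) - j₀| := by
      rcases sin_low y (by positivity) hy1 _ e2 with h | h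
      · left
        have : |(j : ℝ) - j₀| * σ ≤ (R / 4) * σ := by rw [← hy]; linarith
        exact le_of_mul_le_mul_right this hσ
      · right
        have : (σ⁻¹ - R / 4) * σ ≤ |(j : ℝ) - j₀| * σ := by rw [← hy, sub_mul, hσσ]; linarith
        exact le_of_mul_le_mul_right this hσ
    simp only [Finset.mem_union, Finset.mem_Icc, Int.ceil_le, Int.le_floor]
    rcases key with h | h
    · left; left
      have := abs_le.1 h
      constructor <;> linarith
    · rcases le_total 0 ((j : ℝ) - j₀) with h' | h'
      · rw [abs_of_nonneg h'] at h
        left; right; constructor <;> linarith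
      · rw [abs_of_nonpos h'] at h
        right; constructor <;> linarith
  have h1 := int_count ((j₀ : ℝ) - R / 4) ((j₀ : ℝ) + R / 4) (by linarith)
  have h2 := int_count (σ⁻¹ - R / 4) σ⁻¹ (by linarith)
  have h3 := int_count 0 (R / 4) (by linarith)
  have h4 : (S.card : ℝ) ≤ ((Finset.Icc ⌈(j₀ : ℝ) - R / 4⌉ ⌊(j₀ : ℝ) + R / 4⌋).card : ℝ) +
      (Finset.Icc ⌈σ⁻¹ - R / 4⌉ ⌊σ⁻¹⌋).card + (Finset.Icc ⌈(0 : ℝ)⌉ ⌊R / 4⌋).card := by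
    have := (Finset.card_le_card hsub).trans ((Finset.card_union_le _ _).trans
      (Nat.add_le_add_right (Finset.card_union_le _ _) _))
    exact_mod_cast this
  linarith


lemma annulus_abs {δ : ℝ} {p : Param} {w : Plane} (hp : 0 ≤ p.2) (h : w ∈ annulus δ p) :
    abs (‖w - p.1‖ - p.2) ≤ δ := by
  have hne : (circ p).Nonempty := NormedSpace.sphere_nonempty.2 hp
  refine le_trans ((Metric.le_infDist hne).2 ?_) h
  intro y hy
  have hy' : dist y p.1 = p.2 := hy
  rw [← dist_eq_norm, ← hy', abs_le]
  constructor
  · have := dist_triangle y w p.1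
    rw [dist_comm y w] at this; linarith
  · have := dist_triangle w y p.1
    linarith

/-- coordinates of a cube centre -/
def cc (lam : ℝ) (k : CubeIdx) : ℝ × ℝ × ℝ :=
  (((k.1.1 : ℝ) + 1 / 2) * lam, ((k.1.2 : ℝ) + 1 / 2) * lam, ((k.2 : ℝ) + 1 / 2) * lam)

lemma ctr_norm_sq (lam : ℝ) (w b : CubeIdx) :
    ‖(cubeCtr lam w).1 - (cubeCtr lam b).1‖ ^ 2 = ((cc lam w).1 - (cc lam b).1) ^ 2 +
      ((cc lam w).2.1 - (cc lam b).2.1) ^ 2 := by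
  rw [plane_norm_sq]; simp [cubeCtr, cc, mk2]

lemma ctr_snd (lam : ℝ) (w : CubeIdx) : (cubeCtr lam w).2 = (cc lam w).2.2 := rfl

/-- the tangency relation -/
def TT (lam K t S : ℝ) (x y : DPair) : Prop :=
  tang (cubeCtr lam x.1) (cubeCtr lam y.1) ≤ K * lam ∧
  t / K ≤ pdist (cubeCtr lam x.1) (cubeCtr lam y.1) ∧
  pdist (cubeCtr lam x.1) (cubeCtr lam y.1) ≤ K * t ∧
  (rect (K * lam) (K * S) (cubeCtr lam x.1) (arcCenterAt (cubeCtr lam x.1) S x.2) ∩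
    rect (K * lam) (K * S) (cubeCtr lam y.1) (arcCenterAt (cubeCtr lam y.1) S y.2)).Nonempty

lemma TT_symm {lam K t S : ℝ} {x y : DPair} (h : TT lam K t S x y) : TT lam K t S y x := by
  obtain ⟨h1, h2, h3, h4⟩ := h
  have e : pdist (cubeCtr lam y.1) (cubeCtr lam x.1) = pdist (cubeCtr lam x.1) (cubeCtr lam y.1) := by
    unfold pdist; rw [dist_comm]; congr 1; ring
  have e' : tang (cubeCtr lam y.1) (cubeCtr lam x.1) = tang (cubeCtr lam x.1) (cubeCtr lam y.1) := by
    unfold tang; rw [dist_comm, abs_sub_comm (cubeCtr lam y.1).2]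
  refine ⟨by rwa [e'], by rwa [e], by rwa [e], by rwa [Set.inter_comm]⟩

lemma TT_data {lam K t S : ℝ} {x y : DPair} (h : TT lam K t S x y)
    (hx : cubeCtr lam x.1 ∈ domD) (hy : cubeCtr lam y.1 ∈ domD) :
    ∃ ζ : Plane, |‖ζ‖ - (cc lam x.1).2.2| ≤ K * lam ∧
      |‖ζ - ((cubeCtr lam y.1).1 - (cubeCtr lam x.1).1)‖ - ((cc lam x.1).2.2 +
        ((cc lam y.1).2.2 - (cc lam x.1).2.2))| ≤ K * lam ∧
      abs (‖(cubeCtr lam y.1).1 - (cubeCtr lam x.1).1‖ - |(cc lam y.1).2.2 - (cc lam x.1).2.2|) ≤ K * lam ∧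
      ‖ζ - (cc lam x.1).2.2 • dir (ang S x.2)‖ ≤ K * S ∧
      t / K ≤ Real.sqrt (‖(cubeCtr lam y.1).1 - (cubeCtr lam x.1).1‖ ^ 2 +
        ((cc lam y.1).2.2 - (cc lam x.1).2.2) ^ 2) ∧
      Real.sqrt (‖(cubeCtr lam y.1).1 - (cubeCtr lam x.1).1‖ ^ 2 +
        ((cc lam y.1).2.2 - (cc lam x.1).2.2) ^ 2) ≤ K * t := by
  obtain ⟨h1, h2, h3, z, ⟨z1, z2⟩, z3, -⟩ := TT_symm (TT_symm h)
  have hx2 := hx.2.1; have hy2 := hy.2.1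
  have e : ‖(cubeCtr lam y.1).1 - (cubeCtr lam x.1).1‖ = dist (cubeCtr lam x.1).1 (cubeCtr lam y.1).1 := by
    rw [dist_comm, dist_eq_norm]
  have e2 : pdist (cubeCtr lam x.1) (cubeCtr lam y.1) = Real.sqrt (‖(cubeCtr lam y.1).1 - (cubeCtr lam x.1).1‖ ^ 2 +
        ((cc lam y.1).2.2 - (cc lam x.1).2.2) ^ 2) := by
    rw [e]; unfold pdist; rw [ctr_snd, ctr_snd]; congr 1; ring
  rw [e2] at h2 h3
  refine ⟨z - (cubeCtr lam x.1).1, annulus_abs (by linarith) z1, ?_, ?_, ?_, h2, h3⟩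
  · have := annulus_abs (by linarith) z3
    rw [ctr_snd] at this
    rw [sub_sub_sub_cancel_right, add_sub_cancel]
    rwa [show z - (cubeCtr lam y.1).1 = z - (cubeCtr lam y.1).1 from rfl] 
  · rw [e, abs_sub_comm (cc lam y.1).2.2]; exact h1
  · have : dist z (arcCenterAt (cubeCtr lam x.1) S x.2) ≤ K * S := z2
    rw [dist_eq_norm] at this
    rwa [sub_sub]

lemma TT_edg {lam K t S : ℝ} (hK : 0 < K) (ht : 0 < t) {x y : DPair} (h : TT lam K t S x y)  :
    Edg (2 * K ^ 2 * lam * t) (t / K) (cc lam x.1) (cc lam y.1) ∧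
    nearby (K * t) (cc lam x.1) (cc lam y.1) := by
  obtain ⟨h1, h2, h3, -⟩ := h
  unfold tang at h1
  unfold pdist at h2 h3
  rw [dist_eq_norm, ctr_snd, ctr_snd] at h1 h2 h3
  have e := ctr_norm_sq lam x.1 y.1
  set D := ‖(cubeCtr lam x.1).1 - (cubeCtr lam y.1).1‖
  have hD : 0 ≤ D := norm_nonneg _
  set a := (cc lam x.1).1 - (cc lam y.1).1
  set b := (cc lam x.1).2.1 - (cc lam y.1).2.1
  set c := (cc lam x.1).2.2 - (cc lam y.1).2.2
  have hKt : 0 < K * t := by positivity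
  have g2 := pow_le_pow_left₀ (by positivity) h2 2
  have g3 := pow_le_pow_left₀ (Real.sqrt_nonneg _) h3 2
  rw [Real.sq_sqrt (by positivity)] at g2 g3
  have c1 : D ≤ K * t := abs_le_of_sq_le_sq' (by nlinarith [sq_nonneg c]) hKt.le |>.2
  have c2 : |c| ≤ K * t := abs_le_of_sq_le_sq (by nlinarith [sq_nonneg D]) hKt.le
  refine ⟨⟨?_, ?_⟩, ?_, ?_, c2⟩
  · have : qf (cc lam x.1) (cc lam y.1) = (D - |c|) * (D + |c|) := by
      have : (D - |c|) * (D + |c|) = D ^ 2 - |c| ^ 2 := by ring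
      rw [this, e, sq_abs]; rfl
    rw [this, abs_mul]
    have h5 : abs (D + |c|) ≤ 2 * (K * t) := by rw [abs_of_nonneg (by positivity)]; linarith
    have := mul_le_mul h1 h5 (abs_nonneg _) ((abs_nonneg _).trans h1)
    linarith
  · linarith
  · exact abs_le_of_sq_le_sq (by nlinarith [sq_nonneg c, sq_nonneg b]) hKt.le
  · exact abs_le_of_sq_le_sq (by nlinarith [sq_nonneg c, sq_nonneg a]) hKt.le

/-- direction lemma, in terms of arcs -/
lemma TT_dir {lam K t S : ℝ} (hlam : 0 < lam) (ht : 0 < t) (hK : 1 ≤ K) (hS : 0 < S)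
    (hS2 : lam / t ≤ S ^ 2) (he : K * lam ≤ 1) {w b b₁ : CubeIdx} {v v' u u' : ℤ}
    (hw : cubeCtr lam w ∈ domD) (hb : cubeCtr lam b ∈ domD) (hb₁ : cubeCtr lam b₁ ∈ domD)
    (h : TT lam K t S (w, v) (b, u)) (h' : TT lam K t S (w, v') (b₁, u'))
    (hn : nearby (t / K / 4000) (cc lam b) (cc lam b₁))
    (hQ : qf (cc lam b) (cc lam b₁) ≤ 10000 * (2 * K ^ 2 * lam * t)) :
    ‖dir (ang S v') - dir (ang S v)‖ ≤ (400 * K ^ 2) * S := by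
  obtain ⟨ζ, a1, a2, a3, a4, a5, a6⟩ := TT_data h hw hb
  obtain ⟨ζ', b1, b2, b3, b4, b5, b6⟩ := TT_data h' hw hb₁
  rw [norm_sub_rev]
  refine dirC _ _ ζ ζ' _ _ _ _ _ lam t K S (dir_norm _) (dir_norm _) hlam ht hK hS hS2 he hw.2 ?_ ?_
    a1 a2 a3 a4 a5 a6 b1 b2 b3 b4 b5 b6 ?_ ?_
  · change (cc lam w).2.2 + ((cc lam b).2.2 - (cc lam w).2.2) ∈ _
    rw [add_sub_cancel]; exact hb.2
  · change (cc lam w).2.2 + ((cc lam b₁).2.2 - (cc lam w).2.2) ∈ _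
    rw [add_sub_cancel]; exact hb₁.2
  · rw [sub_sub_sub_cancel_right]; exact hn.2.2
  · rw [sub_sub_sub_cancel_right, sub_sub_sub_cancel_right, ctr_norm_sq]; exact hQ



/-- class of a pair of cubes -/
def clz (lam g : ℝ) (w b : CubeIdx) : ℤ × ℤ × ℤ :=
  (⌊((cc lam w).1 - (cc lam b).1) / g⌋, ⌊((cc lam w).2.1 - (cc lam b).2.1) / g⌋,
    ⌊((cc lam w).2.2 - (cc lam b).2.2) / g⌋)

lemma floor_near {g a b c : ℝ} (hg : 0 < g) (h : ⌊(a - b) / g⌋ = ⌊(a - c) / g⌋) : |b - c| ≤ g := by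
  have := Int.abs_sub_lt_one_of_floor_eq_floor h
  rw [← sub_div, abs_div, abs_of_pos hg, div_lt_one hg] at this
  rw [abs_sub_comm]
  rw [show a - b - (a - c) = c - b by ring] at this
  exact this.le

lemma floor_near' {g a b c : ℝ} (hg : 0 < g) (h : ⌊(b - a) / g⌋ = ⌊(c - a) / g⌋) : |b - c| ≤ g := by
  have := Int.abs_sub_lt_one_of_floor_eq_floor h
  rw [← sub_div, abs_div, abs_of_pos hg, div_lt_one hg] at this
  rw [show b - a - (c - a) = b - c by ring] at this
  exact this.le

lemma clz_near {lam g : ℝ} (hg : 0 < g) {w b b' : CubeIdx} (h : clz lam g w b = clz lam g w b') :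
    nearby g (cc lam b) (cc lam b') := by
  simp only [clz, Prod.mk.injEq] at h
  exact ⟨floor_near hg h.1, floor_near hg h.2.1, floor_near hg h.2.2⟩

lemma clz_near' {lam g : ℝ} (hg : 0 < g) {w b b' : CubeIdx} (h : clz lam g b w = clz lam g b' w) :
    nearby g (cc lam b) (cc lam b') := by
  simp only [clz, Prod.mk.injEq] at h
  exact ⟨floor_near' hg h.1, floor_near' hg h.2.1, floor_near' hg h.2.2⟩

lemma dom_qf {lam : ℝ} {w b : CubeIdx} (hw : cubeCtr lam w ∈ domD) (hb : cubeCtr lam b ∈ domD) :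
    qf (cc lam w) (cc lam b) ≤ 4 := by
  have e := ctr_norm_sq lam w b
  have h1 : ‖(cubeCtr lam w).1 - (cubeCtr lam b).1‖ ≤ 1 / 2 := by
    refine (norm_sub_le _ _).trans ?_
    have := hw.1; have := hb.1; linarith
  have h2 := pow_le_pow_left₀ (norm_nonneg _) h1 2
  rw [e] at h2
  unfold qf
  nlinarith [sq_nonneg ((cc lam w).2.2 - (cc lam b).2.2)]

lemma near_pdist {lam t : ℝ} (ht : 0 ≤ t) {w b : CubeIdx} (h : nearby (t / 2) (cc lam w) (cc lam b)) :
    pdist (cubeCtr lam w) (cubeCtr lam b) ≤ t := by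
  unfold pdist
  rw [dist_eq_norm, ctr_norm_sq, ctr_snd, ctr_snd]
  apply Real.sqrt_le_iff.2 ⟨ht, ?_⟩
  obtain ⟨h1, h2, h3⟩ := h
  have k1 := sq_le_sq' (abs_le.1 h1).1 (abs_le.1 h1).2
  have k2 := sq_le_sq' (abs_le.1 h2).1 (abs_le.1 h2).2
  have k3 := sq_le_sq' (abs_le.1 h3).1 (abs_le.1 h3).2
  nlinarith

open Classical in
lemma step_apply (lam K t S : ℝ) (hlam : 0 < lam) (ht : 0 < t) (hK : 1 ≤ K) (hS : 0 < S)
    (hS2 : lam / t ≤ S ^ 2) (he : K * lam ≤ 1) (G : Finset DPair) (P : Finset CubeIdx)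
    (hP : ∀ ω ∈ G, ω.1 ∈ P) (hdom : ∀ k ∈ P, cubeCtr lam k ∈ domD)
    (hval : ∀ ω ∈ G, validArc S ω.2) (N : ℕ) (hN : 4 ≤ 4 ^ N * (10000 * (2 * K ^ 2 * lam * t)))
    (M' : ℝ) (hM : ∀ w ∈ P, ∀ V : Finset ℤ, (∀ v ∈ V, (w, v) ∈ G) → (V.card : ℝ) ≤ M')
    (hM0 : 0 ≤ M') (m : ℝ) (hm0 : 0 ≤ m)
    (hm : ∀ ω ∈ G, ((G.filter (fun ω' => TT lam K t S ω ω')).card : ℝ) ≤ m)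
    (nt : ℝ) (hnt0 : 0 ≤ nt)
    (hnt : ∀ b ∈ P, ∀ B : Finset CubeIdx, (∀ b' ∈ B, b' ∈ P ∧
      pdist (cubeCtr lam b') (cubeCtr lam b) ≤ t) → (B.card : ℝ) ≤ nt) :
    (((G ×ˢ G).filter (fun z => TT lam K t S z.1 z.2)).card : ℝ) ^ 4 ≤
      (10 ^ 12 * K ^ 6) ^ 4 * (1600 * K ^ 2) ^ 8 * (P.card ^ 4 * nt *
        (2 * (N + 1) * (1600 * K ^ 2) * M' ^ 2 * m ^ 3)) := by
  have hK0 : 0 < K := by linarith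
  set g := t / K / 4000 with hg
  have hg0 : 0 < g := by positivity
  set E := 2 * K ^ 2 * lam * t with hE
  have hE0 : 0 < E := by positivity
  have hK2 : 1 ≤ K ^ 2 := one_le_pow₀ hK
  set I : Finset ℤ := Finset.Icc ⌈-(4000 * K ^ 2) - 1⌉ ⌊4000 * K ^ 2⌋ with hI
  have hIc : (I.card : ℝ) ≤ 10 ^ 4 * K ^ 2 := by
    have := int_count (-(4000 * K ^ 2) - 1) (4000 * K ^ 2) (by nlinarith)
    rw [← hI] at this; linarith
  have hIm : ∀ x : ℝ, |x| ≤ K * t → ⌊x / g⌋ ∈ I := by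
    intro x hx
    have h1 : |x / g| ≤ 4000 * K ^ 2 := by
      rw [abs_div, abs_of_pos hg0, div_le_iff₀ hg0]
      refine hx.trans (le_of_eq ?_)
      rw [hg]; field_simp
    have h2 := abs_le.1 h1
    rw [hI, Finset.mem_Icc]
    constructor
    · rw [Int.ceil_le]
      have := Int.lt_floor_add_one (x / g); linarith
    · exact Int.floor_le_floor h2.2
  set Cls : Finset (ℤ × ℤ × ℤ) := I ×ˢ I ×ˢ I with hCls
  have hCc : (Cls.card : ℝ) ≤ 10 ^ 12 * K ^ 6 := by
    rw [hCls, Finset.card_product, Finset.card_product]; push_cast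
    calc (I.card : ℝ) * (I.card * I.card) ≤ (10 ^ 4 * K ^ 2) * ((10 ^ 4 * K ^ 2) * (10 ^ 4 * K ^ 2)) := by
          gcongr
      _ = _ := by ring
  have key := step_core G P hP (TT lam K t S) (fun x y h => TT_symm h) (clz lam g) Cls
    (by
      intro x _ y _ h
      obtain ⟨-, h1, h2, h3⟩ := TT_edg hK0 ht h
      rw [hCls, Finset.mem_product, Finset.mem_product]
      exact ⟨hIm _ h1, hIm _ h2, hIm _ h3⟩)
    (fun w b => qf (cc lam w) (cc lam b)) (10000 * E) 4 (by positivity) (fun x y => qf_comm _ _)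
    (by intro x; unfold qf; simp; positivity) (fun x hx y hy => dom_qf (hdom x hx) (hdom y hy))
    N hN M' hM m hm0 hm (1600 * K ^ 2)
    (by
      rintro w b V hV ⟨v, v₁, h1, h2, h3⟩
      have := arc_count S hS (400 * K ^ 2) (by linarith) v (hval _ h1) V (by
        intro v' hv'
        obtain ⟨h4, b₁, u₁, h5, h6, h7, h8⟩ := hV v' hv'
        exact ⟨hval _ h4, TT_dir hlam ht hK hS hS2 he (hdom _ (hP _ h1)) (hdom _ (hP _ h2))
          (hdom _ (hP _ h5)) h3 h6 (clz_near hg0 h7.symm) h8⟩)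
      linarith)
    (by
      rintro w b V hV ⟨v, v₁, h1, h2, h3⟩
      have := arc_count S hS (400 * K ^ 2) (by linarith) v (hval _ h1) V (by
        intro v' hv'
        obtain ⟨h4, b₁, u₁, h5, h6, h7, h8⟩ := hV v' hv'
        exact ⟨hval _ h4, TT_dir hlam ht hK hS hS2 he (hdom _ (hP _ h1)) (hdom _ (hP _ h2))
          (hdom _ (hP _ h5)) h3 h6 (clz_near' hg0 h7.symm) h8⟩)
      linarith)
    (fun χ w b => clz lam g w b = χ ∧ Edg E (t / K) (cc lam w) (cc lam b))
    (fun x _ y _ h => ⟨rfl, (TT_edg hK0 ht h).1⟩)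
    (by
      rintro χ w w' b b' ⟨a1, e1⟩ ⟨a2, e2⟩ ⟨a3, e3⟩ ⟨a4, e4⟩ q1 q2
      exact G1' _ _ _ _ E (t / K) (by positivity) e1 e2 e3 e4 (clz_near' hg0 (a1.trans a3.symm))
        (clz_near hg0 (a1.trans a2.symm)) q1 q2)
    (by
      rintro χ b b' w₀ w₁ w₂ ⟨a1, e1⟩ ⟨a2, e2⟩ ⟨a3, e3⟩ ⟨a4, e4⟩ ⟨a5, e5⟩ ⟨a6, e6⟩ q1 q2 q3 q4 l1 l2 l3
      exact G2' _ _ _ _ _ E (t / K) (by positivity) e1 e4 e2 e5 e3 e6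
        (clz_near' hg0 (a1.trans a2.symm)) (clz_near' hg0 (a1.trans a3.symm))
        (clz_near' hg0 (a2.trans a3.symm)) (clz_near hg0 (a1.trans a4.symm)) q1 l1 l3 l2)
    (by
      rintro χ w w' b₀ b₁ b₂ ⟨a1, e1⟩ ⟨a2, e2⟩ ⟨a3, e3⟩ ⟨a4, e4⟩ ⟨a5, e5⟩ ⟨a6, e6⟩ q1 q2 q3 q4 l1 l2 l3
      exact G2' _ _ _ _ _ E (t / K) (by positivity) e1.symm e4.symm e2.symm e5.symm e3.symm e6.symm
        (clz_near hg0 (a1.trans a2.symm)) (clz_near hg0 (a1.trans a3.symm))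
        (clz_near hg0 (a2.trans a3.symm)) (clz_near' hg0 (a1.trans a4.symm)) q1 l1 l3 l2)
    (by positivity) hM0 nt hnt0
    (by
      intro b hb B hB
      apply hnt b hb B
      intro b' hb'
      obtain ⟨h1, w, χ, ⟨h2, -⟩, ⟨h3, -⟩⟩ := hB b' hb'
      refine ⟨h1, near_pdist ht.le ?_⟩
      obtain ⟨n1, n2, n3⟩ := clz_near hg0 (h3.trans h2.symm)
      have : g ≤ t / 2 := by
        rw [hg, div_div]
        apply div_le_div_of_nonneg_left ht.le (by norm_num); linarith
      exact ⟨n1.trans this, n2.trans this, n3.trans this⟩)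
  refine key.trans ?_
  gcongr


lemma idx3_eq_iff {δ : ℝ} (hδ : 0 < δ) (p : Param) (k : CubeIdx) :
    idx3 δ p = k ↔ p ∈ cubeSet δ k := by
  obtain ⟨⟨a, b⟩, c⟩ := k
  simp only [idx3, idx2, Prod.mk.injEq, Int.floor_eq_iff, cubeSet, Set.mem_ofPred_eq,
    le_div_iff₀ hδ, div_lt_iff₀ hδ]
  tauto

lemma ctr_mem {δ : ℝ} (hδ : 0 < δ) (k : CubeIdx) : cubeCtr δ k ∈ cubeSet δ k := by
  simp only [cubeSet, cubeCtr, mk2, Set.mem_ofPred_eq]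
  simp
  refine ⟨?_, ?_, ?_, ?_, ?_, ?_⟩ <;> nlinarith

lemma idx3_image {δ : ℝ} (hδ : 0 < δ) (P : Set CubeIdx) :
    idx3 δ '' (⋃ k ∈ P, cubeSet δ k) = P := by
  ext k
  simp only [Set.mem_image, Set.mem_iUnion, exists_prop]
  constructor
  · rintro ⟨p, ⟨k', hk', hp⟩, rfl⟩
    rwa [(idx3_eq_iff hδ p k').2 hp]
  · intro hk
    exact ⟨cubeCtr δ k, ⟨k, hk, ctr_mem hδ k⟩, (idx3_eq_iff hδ _ _).2 (ctr_mem hδ k)⟩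

lemma count3_cubes {δ : ℝ} (hδ : 0 < δ) (P : Set CubeIdx) :
    count3 δ (⋃ k ∈ P, cubeSet δ k) = Nat.card P := by
  unfold count3; rw [idx3_image hδ]

lemma plane_coord (v : Plane) : |v 0| ≤ ‖v‖ ∧ |v 1| ≤ ‖v‖ := by
  have := plane_norm_sq v
  constructor <;> apply abs_le_of_sq_le_sq _ (norm_nonneg _) <;> nlinarith [sq_nonneg (v 0), sq_nonneg (v 1)]

lemma dom_finite {δ : ℝ} (hδ : 0 < δ) (P : Set CubeIdx) (h : ∀ k ∈ P, cubeCtr δ k ∈ domD) :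
    P.Finite := by
  set B : ℤ := ⌈1 / δ⌉ + 1 with hB
  have hB' : 1 / δ + 1 ≤ (B : ℝ) := by
    rw [hB]; push_cast; linarith [Int.le_ceil (1 / δ)]
  have aux : ∀ a : ℤ, |((a : ℝ) + 1 / 2) * δ| ≤ 1 → a ∈ Finset.Icc (-B) B := by
    intro a ha
    rw [abs_mul, abs_of_pos hδ, ← le_div_iff₀ hδ, abs_le] at ha
    rw [Finset.mem_Icc]
    constructor
    · have : ((-B : ℤ) : ℝ) ≤ a := by push_cast; linarith [ha.1]
      exact_mod_cast this
    · have : (a : ℝ) ≤ B := by linarith [ha.2]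
      exact_mod_cast this
  apply Set.Finite.subset ((Finset.Icc (-B) B ×ˢ Finset.Icc (-B) B) ×ˢ Finset.Icc (-B) B).finite_toSet
  intro k hk
  obtain ⟨h1, h2⟩ := h k hk
  obtain ⟨h3, h4⟩ := plane_coord (cubeCtr δ k).1
  simp only [Finset.coe_product, Set.mem_prod, Finset.mem_coe]
  refine ⟨⟨aux _ ?_, aux _ ?_⟩, aux _ ?_⟩
  · have : (cubeCtr δ k).1 0 = ((k.1.1 : ℝ) + 1 / 2) * δ := by simp [cubeCtr, mk2]
    rw [← this]; linarith
  · have : (cubeCtr δ k).1 1 = ((k.1.2 : ℝ) + 1 / 2) * δ := by simp [cubeCtr, mk2]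
    rw [← this]; linarith
  · change |(cubeCtr δ k).2| ≤ 1
    rw [abs_le]; constructor <;> linarith [h2.1, h2.2]

lemma valid_finite (σ : ℝ) (E : Set ℤ) (h : ∀ j ∈ E, validArc σ j) : E.Finite := by
  apply Set.Finite.subset (Finset.Icc (0 : ℤ) ⌊σ⁻¹⌋).finite_toSet
  intro j hj
  simp only [Finset.coe_Icc, Set.mem_Icc]
  exact ⟨(h j hj).1, Int.le_floor.2 (h j hj).2.le⟩

lemma arc_center_mem (p : Param) {σ : ℝ} (hσ : 0 < σ) (j : ℤ) : arcCenterAt p σ j ∈ arcSet p σ j := by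
  have := mul_pos (mul_pos two_pos Real.pi_pos) hσ
  refine ⟨((j : ℝ) + 1 / 2) * (2 * Real.pi * σ), ?_, ?_, rfl⟩ <;> nlinarith

lemma arc_center_dist (p : Param) {σ : ℝ} (hσ : 0 < σ) (j : ℤ) (hp0 : 0 ≤ p.2) (hp : p.2 ≤ 1) {w : Plane}
    (hw : w ∈ arcSet p σ j) : ‖w - arcCenterAt p σ j‖ ≤ 4 * σ := by
  obtain ⟨θ, h1, h2, rfl⟩ := hw
  unfold arcCenterAt
  rw [add_sub_add_left_eq_sub, ← smul_sub, norm_smul, Real.norm_eq_abs, abs_of_nonneg hp0]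
  have h3 := dir_lip θ (((j : ℝ) + 1 / 2) * (2 * Real.pi * σ))
  have hpi := Real.pi_lt_four
  have h4 : |θ - ((j : ℝ) + 1 / 2) * (2 * Real.pi * σ)| ≤ Real.pi * σ := by
    rw [abs_le]; constructor <;> nlinarith
  have h5 : Real.pi * σ ≤ 4 * σ := by nlinarith
  have := h3.trans (h4.trans h5)
  calc p.2 * _ ≤ 1 * (4 * σ) := mul_le_mul hp this (norm_nonneg _) (by norm_num)
    _ = _ := by ring

lemma floor_win {δ a b : ℝ} (hδ : 0 < δ) (h : |a - b| ≤ 4 * δ) :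
    ⌊a / δ⌋ ∈ Finset.Icc (⌊b / δ⌋ - 4) (⌊b / δ⌋ + 4) := by
  have h1 : |a / δ - b / δ| ≤ 4 := by
    rw [← sub_div, abs_div, abs_of_pos hδ, div_le_iff₀ hδ]; exact h
  have h2 := abs_le.1 h1
  rw [Finset.mem_Icc]
  have e1 : ⌊b / δ⌋ - 4 = ⌊b / δ - 4⌋ := by exact_mod_cast (Int.floor_sub_natCast (b / δ) 4).symm
  have e2 : ⌊b / δ⌋ + 4 = ⌊b / δ + 4⌋ := by exact_mod_cast (Int.floor_add_natCast (b / δ) 4).symm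
  rw [e1, e2]
  exact ⟨Int.floor_le_floor (by linarith), Int.floor_le_floor (by linarith)⟩

lemma arcs_count_le (p : Param) {σ : ℝ} (hσ : 0 < σ) (hp0 : 0 ≤ p.2) (hp : p.2 ≤ 1) (E : Set ℤ)
    (hE : E.Finite) : (idx2 σ '' (⋃ j ∈ E, arcSet p σ j)).Finite ∧
      (count2 σ (⋃ j ∈ E, arcSet p σ j) : ℝ) ≤ 81 * (Nat.card E : ℝ) := by
  classical
  set F : ℤ → Finset (ℤ × ℤ) := fun j =>
    Finset.Icc ((idx2 σ (arcCenterAt p σ j)).1 - 4) ((idx2 σ (arcCenterAt p σ j)).1 + 4) ×ˢ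
    Finset.Icc ((idx2 σ (arcCenterAt p σ j)).2 - 4) ((idx2 σ (arcCenterAt p σ j)).2 + 4) with hF
  have hFc : ∀ j, (F j).card = 81 := by
    intro j
    rw [hF]; simp only [Finset.card_product, Int.card_Icc]
    have : ∀ x : ℤ, (x + 4 + 1 - (x - 4)).toNat = 9 := by intro x; omega
    rw [this, this]
  have hsub : idx2 σ '' (⋃ j ∈ E, arcSet p σ j) ⊆ (hE.toFinset.biUnion F : Finset (ℤ × ℤ)) := by
    rintro _ ⟨w, hw, rfl⟩
    simp only [Set.mem_iUnion, exists_prop] at hw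
    obtain ⟨j, hj, hw⟩ := hw
    have hd := arc_center_dist p hσ j hp0 hp hw
    obtain ⟨c1, c2⟩ := plane_coord (w - arcCenterAt p σ j)
    rw [Finset.mem_coe, Finset.mem_biUnion]
    refine ⟨j, hE.mem_toFinset.2 hj, ?_⟩
    rw [hF]; simp only [Finset.mem_product]
    exact ⟨floor_win hσ (c1.trans hd), floor_win hσ (c2.trans hd)⟩
  refine ⟨Set.Finite.subset (Finset.finite_toSet _) hsub, ?_⟩
  have h1 : count2 σ (⋃ j ∈ E, arcSet p σ j) ≤ (hE.toFinset.biUnion F).card := by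
    unfold count2
    have := Set.ncard_le_ncard hsub (Finset.finite_toSet _)
    rwa [Set.ncard_coe_finset] at this
  have h2 : (hE.toFinset.biUnion F).card ≤ hE.toFinset.card * 81 :=
    Finset.card_biUnion_le_card_mul _ _ _ (fun j _ => (hFc j).le)
  have h3 : Nat.card E = hE.toFinset.card := Nat.card_eq_card_finite_toFinset hE
  have := h1.trans h2
  rw [h3]
  have h4 : ((count2 σ (⋃ j ∈ E, arcSet p σ j) : ℕ) : ℝ) ≤ ((hE.toFinset.card * 81 : ℕ) : ℝ) := by
    exact_mod_cast this
  push_cast at h4; linarith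

lemma arcs_count_ge (p : Param) {σ : ℝ} (hσ : 0 < σ) (hp0 : 1 / 2 ≤ p.2) (hp : p.2 ≤ 1) (E : Set ℤ)
    (hE : ∀ j ∈ E, validArc σ j) :
      (Nat.card E : ℝ) ≤ 16 * (count2 σ (⋃ j ∈ E, arcSet p σ j) : ℝ) := by
  classical
  have hf := valid_finite σ E hE
  have hfin := (arcs_count_le p hσ (by linarith) hp E hf).1
  have h3 : Nat.card E = hf.toFinset.card := Nat.card_eq_card_finite_toFinset hf
  set f : ℤ → ℤ × ℤ := fun j => idx2 σ (arcCenterAt p σ j) with hfdef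
  have h1 : hf.toFinset.card ≤ 16 * (hf.toFinset.image f).card := by
    apply Finset.card_le_mul_card_image
    intro b hb
    obtain ⟨j₀, hj₀, rfl⟩ := Finset.mem_image.1 hb
    have := arc_count σ hσ 4 (by norm_num) j₀ (hE _ (hf.mem_toFinset.1 hj₀))
      (hf.toFinset.filter (fun j => f j = f j₀)) (by
        intro j hj
        obtain ⟨hj1, hj2⟩ := Finset.mem_filter.1 hj
        refine ⟨hE _ (hf.mem_toFinset.1 hj1), ?_⟩
        simp only [hfdef, idx2, Prod.mk.injEq] at hj2
        have n0 := Int.abs_sub_lt_one_of_floor_eq_floor hj2.1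
        have n1 := Int.abs_sub_lt_one_of_floor_eq_floor hj2.2
        rw [← sub_div, abs_div, abs_of_pos hσ, div_lt_one hσ] at n0 n1
        set u := arcCenterAt p σ j - arcCenterAt p σ j₀ with hu
        have hu' : u = p.2 • (dir (ang σ j) - dir (ang σ j₀)) := by
          rw [hu]; unfold arcCenterAt ang; rw [add_sub_add_left_eq_sub, ← smul_sub]
        have c0 : |u 0| < σ := n0
        have c1 : |u 1| < σ := n1
        have hn : ‖u‖ ≤ 2 * σ := by
          apply abs_le_of_sq_le_sq' _ (by positivity) |>.2
          rw [plane_norm_sq]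
          have k0 := sq_lt_sq' (abs_lt.1 c0).1 (abs_lt.1 c0).2
          have k1 := sq_lt_sq' (abs_lt.1 c1).1 (abs_lt.1 c1).2
          nlinarith
        rw [hu', norm_smul, Real.norm_eq_abs, abs_of_nonneg (by linarith)] at hn
        nlinarith [norm_nonneg (dir (ang σ j) - dir (ang σ j₀))])
    have h5 : ((hf.toFinset.filter (fun j => f j = f j₀)).card : ℝ) ≤ ((16 : ℕ) : ℝ) := by
      exact this.trans (by norm_num)
    exact_mod_cast h5
  have h2 : (hf.toFinset.image f).card ≤ count2 σ (⋃ j ∈ E, arcSet p σ j) := by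
    unfold count2
    have : ((hf.toFinset.image f : Finset (ℤ × ℤ)) : Set (ℤ × ℤ)) ⊆ idx2 σ '' (⋃ j ∈ E, arcSet p σ j) := by
      intro x hx
      obtain ⟨j, hj, rfl⟩ := Finset.mem_image.1 (Finset.mem_coe.1 hx)
      refine ⟨_, ?_, rfl⟩
      simp only [Set.mem_iUnion, exists_prop]
      exact ⟨j, hf.mem_toFinset.1 hj, arc_center_mem p hσ j⟩
    have := Set.ncard_le_ncard this hfin
    rwa [Set.ncard_coe_finset] at this
  rw [h3]
  have h4 : ((hf.toFinset.card : ℕ) : ℝ) ≤ ((16 * count2 σ (⋃ j ∈ E, arcSet p σ j) : ℕ) : ℝ) := by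
    exact_mod_cast h1.trans (Nat.mul_le_mul_left _ h2)
  push_cast at h4; exact h4

lemma iUnion_mono' {α β : Type*} {E F : Set α} (h : E ⊆ F) (f : α → Set β) :
    (⋃ j ∈ E, f j) ⊆ ⋃ j ∈ F, f j := Set.biUnion_subset_biUnion_left h

lemma dset2_sub (p : Param) {σ s C : ℝ} (hσ : 0 < σ) (hC : 0 ≤ C) (hp0 : 1 / 2 ≤ p.2) (hp : p.2 ≤ 1) (E E' : Set ℤ)
    (hE : ∀ j ∈ E, validArc σ j) (hEE : E' ⊆ E) (c : ℝ) (hc : 0 < c)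
    (hcard : c * (Nat.card E : ℝ) ≤ Nat.card E')
    (h : IsDSet2 σ s C (⋃ j ∈ E, arcSet p σ j)) :
    IsDSet2 σ s (1296 / c * C) (⋃ j ∈ E', arcSet p σ j) := by
  obtain ⟨hb, h⟩ := h
  refine ⟨hb.subset (iUnion_mono' hEE _), fun x r hr => ?_⟩
  have hf := valid_finite σ E hE
  obtain ⟨f1, f2⟩ := arcs_count_le p hσ (by linarith) hp E hf
  have f3 := arcs_count_ge p hσ hp0 hp E' (fun j hj => hE j (hEE hj))
  have h1 : count2 σ ((⋃ j ∈ E', arcSet p σ j) ∩ closedBall x r) ≤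
      count2 σ ((⋃ j ∈ E, arcSet p σ j) ∩ closedBall x r) := by
    unfold count2
    exact Nat.card_mono (f1.subset (Set.image_mono Set.inter_subset_left))
      (Set.image_mono (Set.inter_subset_inter_left _ (iUnion_mono' hEE _)))
  have h1' : (count2 σ ((⋃ j ∈ E', arcSet p σ j) ∩ closedBall x r) : ℝ) ≤
      count2 σ ((⋃ j ∈ E, arcSet p σ j) ∩ closedBall x r) := by exact_mod_cast h1
  have hr0 : 0 < r := by linarith
  have hrs : 0 ≤ r ^ s := (Real.rpow_pos_of_pos hr0 s).le
  have h2 : (count2 σ (⋃ j ∈ E, arcSet p σ j) : ℝ) ≤ 1296 / c * count2 σ (⋃ j ∈ E', arcSet p σ j) := by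
    have : (Nat.card E : ℝ) ≤ (Nat.card E' : ℝ) / c := by rw [le_div_iff₀ hc]; linarith
    calc (count2 σ (⋃ j ∈ E, arcSet p σ j) : ℝ) ≤ 81 * (Nat.card E : ℝ) := f2
      _ ≤ 81 * ((Nat.card E' : ℝ) / c) := by gcongr
      _ ≤ 81 * ((16 * (count2 σ (⋃ j ∈ E', arcSet p σ j) : ℝ)) / c) := by gcongr
      _ = _ := by ring
  calc _ ≤ _ := h1'
    _ ≤ C * r ^ s * (count2 σ (⋃ j ∈ E, arcSet p σ j) : ℝ) := h x r hr
    _ ≤ C * r ^ s * (1296 / c * count2 σ (⋃ j ∈ E', arcSet p σ j)) := by gcongr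
    _ = _ := by ring

lemma dset3_sub {δ s C : ℝ} (hδ : 0 < δ) (hC : 0 ≤ C) (P P' : Set CubeIdx) (hP : P.Finite)
    (hPP : P' ⊆ P) (c : ℝ) (hc : 0 < c)
    (hcard : c * (Nat.card P : ℝ) ≤ Nat.card P')
    (h : IsDSet3 δ s C (⋃ k ∈ P, cubeSet δ k)) :
    IsDSet3 δ s (1296 / c * C) (⋃ k ∈ P', cubeSet δ k) := by
  obtain ⟨hb, h⟩ := h
  refine ⟨hb.subset (iUnion_mono' hPP _), fun x r hr => ?_⟩
  have h1 : count3 δ ((⋃ j ∈ P', cubeSet δ j) ∩ {q | pdist q x ≤ r}) ≤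
      count3 δ ((⋃ j ∈ P, cubeSet δ j) ∩ {q | pdist q x ≤ r}) := by
    unfold count3
    refine Nat.card_mono ?_ (Set.image_mono (Set.inter_subset_inter_left _ (iUnion_mono' hPP _)))
    refine Set.Finite.subset ?_ (Set.image_mono Set.inter_subset_left)
    rw [idx3_image hδ]; exact hP
  have h1' : (count3 δ ((⋃ j ∈ P', cubeSet δ j) ∩ {q | pdist q x ≤ r}) : ℝ) ≤
      count3 δ ((⋃ j ∈ P, cubeSet δ j) ∩ {q | pdist q x ≤ r}) := by exact_mod_cast h1
  have hr0 : 0 < r := by linarith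
  have hrs : 0 ≤ r ^ s := (Real.rpow_pos_of_pos hr0 s).le
  have h2 := h x r hr
  rw [count3_cubes hδ] at h2 ⊢
  have : (Nat.card P : ℝ) ≤ 1296 / c * (Nat.card P' : ℝ) := by
    have : (Nat.card P : ℝ) ≤ (Nat.card P' : ℝ) / c := by rw [le_div_iff₀ hc]; linarith
    have h0 : 0 ≤ (Nat.card P' : ℝ) / c := by positivity
    calc _ ≤ _ := this
      _ ≤ 1296 * ((Nat.card P' : ℝ) / c) := by linarith
      _ = _ := by ring
  calc _ ≤ _ := h1'
    _ ≤ _ := h2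
    _ ≤ C * r ^ s * (1296 / c * (Nat.card P' : ℝ)) := by gcongr
    _ = _ := by ring


open Classical in
/-- all nonempty fibres of `G` have cardinality `M` -/
def CF {α γ : Type*} (G : Finset (α × γ)) (M : ℕ) : Prop :=
  ∀ p ∈ G.image Prod.fst, (G.filter (fun ω => ω.1 = p)).card = M

open Classical in
lemma CF_card {α γ : Type*} {G : Finset (α × γ)} {M : ℕ} (h : CF G M) :
    G.card = (G.image Prod.fst).card * M := by
  rw [Finset.card_eq_sum_card_image Prod.fst G, Finset.sum_congr rfl h, Finset.sum_const, smul_eq_mul]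

open Classical in
lemma prune {α γ : Type*} (G H : Finset (α × γ)) (M : ℕ) (hG : CF G M) (hM : 1 ≤ M) (hne : G.Nonempty)
    (hHG : H ⊆ G) (hH : G.card ≤ 2 * H.card) :
    ∃ G' ⊆ H, ∃ M', CF G' M' ∧ 1 ≤ M' ∧ G'.Nonempty ∧ M ≤ 4 * M' ∧
      (G.image Prod.fst).card ≤ 4 * (G'.image Prod.fst).card := by
  set M' := (M + 3) / 4 with hM'
  set P := G.image Prod.fst with hP
  set P' := P.filter (fun p => M' ≤ (H.filter (fun ω => ω.1 = p)).card) with hP'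
  have hsel : ∀ p, ∃ S : Finset (α × γ), p ∈ P' → S ⊆ H.filter (fun ω => ω.1 = p) ∧ S.card = M' := by
    intro p
    by_cases hp : p ∈ P'
    · obtain ⟨S, h1, h2⟩ := Finset.exists_subset_card_eq (Finset.mem_filter.1 hp).2
      exact ⟨S, fun _ => ⟨h1, h2⟩⟩
    · exact ⟨∅, fun h => absurd h hp⟩
  choose sel hsel using hsel
  set G' := P'.biUnion sel with hG'
  have hM'1 : 1 ≤ M' := by omega
  have hfib : ∀ p ∈ P', G'.filter (fun ω => ω.1 = p) = sel p := by
    intro p hp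
    ext ω
    rw [Finset.mem_filter, hG', Finset.mem_biUnion]
    constructor
    · rintro ⟨⟨p', hp', hω⟩, rfl⟩
      have := (Finset.mem_filter.1 ((hsel p' hp').1 hω)).2
      rwa [this]
    · intro hω
      exact ⟨⟨p, hp, hω⟩, (Finset.mem_filter.1 ((hsel p hp).1 hω)).2⟩
  have himg : G'.image Prod.fst = P' := by
    ext p
    rw [Finset.mem_image]
    constructor
    · rintro ⟨ω, hω, rfl⟩
      obtain ⟨p', hp', hω'⟩ := Finset.mem_biUnion.1 hω
      have := (Finset.mem_filter.1 ((hsel p' hp').1 hω')).2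
      rwa [this]
    · intro hp
      have : (sel p).Nonempty := by rw [← Finset.card_pos, (hsel p hp).2]; omega
      obtain ⟨ω, hω⟩ := this
      exact ⟨ω, Finset.mem_biUnion.2 ⟨p, hp, hω⟩, (Finset.mem_filter.1 ((hsel p hp).1 hω)).2⟩
  have hcount : P.card ≤ 4 * P'.card := by
    have c1 : G.card = P.card * M := CF_card hG
    have c2 : H.card = ∑ p ∈ P, (H.filter (fun ω => ω.1 = p)).card :=
      Finset.card_eq_sum_card_fiberwise (fun ω hω => Finset.mem_image_of_mem _ (hHG hω))
    have c3 : ∑ p ∈ P, (H.filter (fun ω => ω.1 = p)).card ≤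
        ∑ p ∈ P, ((if p ∈ P' then M else 0) + (M' - 1)) := by
      apply Finset.sum_le_sum
      intro p hp
      by_cases hp' : p ∈ P'
      · rw [if_pos hp']
        have : (H.filter (fun ω => ω.1 = p)).card ≤ M := by
          rw [← hG p hp]; exact Finset.card_le_card (Finset.filter_subset_filter _ hHG)
        omega
      · rw [if_neg hp']
        have : ¬ (M' ≤ (H.filter (fun ω => ω.1 = p)).card) := by
          intro h; exact hp' (Finset.mem_filter.2 ⟨hp, h⟩)
        omega
    rw [Finset.sum_add_distrib, Finset.sum_const, smul_eq_mul, ← Finset.sum_filter, Finset.sum_const,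
      smul_eq_mul] at c3
    have c4 : P.filter (fun p => p ∈ P') = P' := by
      ext p; rw [Finset.mem_filter]; exact ⟨fun h => h.2, fun h => ⟨(Finset.mem_filter.1 h).1, h⟩⟩
    rw [c4] at c3
    have c5 : 4 * (M' - 1) ≤ M := by omega
    have c6 : P.card * M ≤ 2 * (P'.card * M + P.card * (M' - 1)) := by
      rw [← c1]; refine hH.trans ?_; rw [c2]; omega
    have c7 : P.card * (4 * (M' - 1)) ≤ P.card * M := Nat.mul_le_mul_left _ c5
    have c8 : P.card * M ≤ (4 * P'.card) * M := by
      have : P.card * (4 * (M' - 1)) = 4 * (P.card * (M' - 1)) := by ring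
      nlinarith
    exact Nat.le_of_mul_le_mul_right c8 (by omega)
  refine ⟨G', ?_, M', ?_, hM'1, ?_, by omega, by rw [himg]; exact hcount⟩
  · intro ω hω
    obtain ⟨p', hp', hω'⟩ := Finset.mem_biUnion.1 hω
    exact (Finset.mem_filter.1 ((hsel p' hp').1 hω')).1
  · intro p hp
    rw [himg] at hp
    have := hfib p hp
    rw [this]; exact (hsel p hp).2
  · have hPn : P.Nonempty := hne.image _
    have : 0 < P'.card := by have := Finset.card_pos.2 hPn; omega
    rw [← himg] at this
    exact Finset.image_nonempty.1 (Finset.card_pos.1 this)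

open Classical in
lemma iterate_core {α γ : Type*} (W : Finset (α × γ)) (T : α × γ → α × γ → Prop) (M : ℕ) (hM : 1 ≤ M)
    (hW : CF W M) (hWn : W.Nonempty) (m : ℕ → ℝ) (tgt : ℝ) (J : ℕ)
    (h0 : ∀ ω ∈ W, ((W.filter (fun ω' => T ω ω')).card : ℝ) ≤ m 0)
    (hstep : ∀ j < J, ∀ G ⊆ W, ∀ M', CF G M' → 1 ≤ M' → G.Nonempty → M ≤ 4 ^ j * M' →
      (∀ ω ∈ G, ((G.filter (fun ω' => T ω ω')).card : ℝ) ≤ m j) → tgt < m j →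
      G.card ≤ 2 * (G.filter (fun ω => ((G.filter (fun ω' => T ω ω')).card : ℝ) ≤ m (j + 1))).card) :
    ∃ G ⊆ W, ∃ M', CF G M' ∧ 1 ≤ M' ∧ G.Nonempty ∧ M ≤ 4 ^ J * M' ∧
      (W.image Prod.fst).card ≤ 4 ^ J * (G.image Prod.fst).card ∧
      ∀ ω ∈ G, ((G.filter (fun ω' => T ω ω')).card : ℝ) ≤ max (m J) tgt := by
  suffices H : ∀ j ≤ J, ∃ G ⊆ W, ∃ M', CF G M' ∧ 1 ≤ M' ∧ G.Nonempty ∧ M ≤ 4 ^ j * M' ∧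
      (W.image Prod.fst).card ≤ 4 ^ j * (G.image Prod.fst).card ∧
      ∀ ω ∈ G, ((G.filter (fun ω' => T ω ω')).card : ℝ) ≤ max (m j) tgt from H J le_rfl
  intro j
  induction j with
  | zero =>
    intro _
    exact ⟨W, Finset.Subset.refl _, M, hW, hM, hWn, by simp, by simp, fun ω hω => (h0 ω hω).trans (le_max_left _ _)⟩
  | succ j ih =>
    intro hj
    obtain ⟨G, hG, M', h1, h2, h3, h4, h5, h6⟩ := ih (by omega)
    by_cases hc : m j ≤ tgt
    · refine ⟨G, hG, M', h1, h2, h3, h4.trans ?_, h5.trans ?_, fun ω hω => (h6 ω hω).trans ?_⟩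
      · exact Nat.mul_le_mul_right _ (Nat.pow_le_pow_right (by norm_num) (by omega))
      · exact Nat.mul_le_mul_right _ (Nat.pow_le_pow_right (by norm_num) (by omega))
      · rw [max_eq_right hc]; exact le_max_right _ _
    · push Not at hc
      rw [max_eq_left hc.le] at h6
      have := hstep j (by omega) G hG M' h1 h2 h3 h4 h6 hc
      obtain ⟨G', g1, M'', g2, g3, g4, g5, g6⟩ := prune G _ M' h1 h2 h3 (Finset.filter_subset _ _) this
      have g1' : G' ⊆ G := g1.trans (Finset.filter_subset _ _)
      refine ⟨G', g1'.trans hG, M'', g2, g3, g4, ?_, ?_, fun ω hω => ?_⟩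
      · calc M ≤ 4 ^ j * M' := h4
          _ ≤ 4 ^ j * (4 * M'') := Nat.mul_le_mul_left _ g5
          _ = _ := by ring
      · calc _ ≤ 4 ^ j * (G.image Prod.fst).card := h5
          _ ≤ 4 ^ j * (4 * (G'.image Prod.fst).card) := Nat.mul_le_mul_left _ g6
          _ = _ := by ring
      · refine le_trans ?_ ((Finset.mem_filter.1 (g1 hω)).2.trans (le_max_left _ _))
        exact_mod_cast Finset.card_le_card (Finset.filter_subset_filter _ g1')

open Classical in
/-- many bad points give many edges -/
lemma bad_edges {α : Type*} (G : Finset α) (T : α → α → Prop) (y : ℝ) (hy : 0 ≤ y)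
    (h : ¬ (G.card ≤ 2 * (G.filter (fun ω => ((G.filter (fun ω' => T ω ω')).card : ℝ) ≤ y)).card)) :
    (G.card : ℝ) / 2 * y ≤ (((G ×ˢ G).filter (fun z => T z.1 z.2)).card : ℝ) := by
  push Not at h
  set A := G.filter (fun ω => ((G.filter (fun ω' => T ω ω')).card : ℝ) ≤ y)
  set B := G.filter (fun ω => ¬ ((G.filter (fun ω' => T ω ω')).card : ℝ) ≤ y) with hB
  have h1 : A.card + B.card = G.card := Finset.card_filter_add_card_filter_not _
  have h2 : (G.card : ℝ) / 2 ≤ B.card := by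
    have : G.card ≤ 2 * B.card := by omega
    have : (G.card : ℝ) ≤ 2 * B.card := by exact_mod_cast this
    linarith
  have h3 : ((G ×ˢ G).filter (fun z => T z.1 z.2)).card = ∑ ω ∈ G, (G.filter (fun ω' => T ω ω')).card := by
    rw [Finset.card_filter, Finset.sum_product]
    simp only [Finset.card_filter]
  rw [h3]; push_cast
  calc (G.card : ℝ) / 2 * y ≤ B.card * y := by gcongr
    _ = ∑ ω ∈ B, y := by rw [Finset.sum_const, nsmul_eq_mul]
    _ ≤ ∑ ω ∈ B, ((G.filter (fun ω' => T ω ω')).card : ℝ) :=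
        Finset.sum_le_sum (fun ω hω => (not_le.1 (Finset.mem_filter.1 hω).2).le)
    _ ≤ _ := Finset.sum_le_sum_of_subset_of_nonneg (Finset.filter_subset _ _) (fun _ _ _ => by positivity)


lemma dyadic_facts {x : ℝ} (hx : 0 < x) : 0 < dyadicCeil x ∧ x ≤ dyadicCeil x ∧ dyadicCeil x ≤ 2 * x := by
  unfold dyadicCeil
  set n := ⌊Real.logb 2 x⁻¹⌋ with hn
  have h1 : (n : ℝ) ≤ Real.logb 2 x⁻¹ := Int.floor_le _
  have h2 : Real.logb 2 x⁻¹ < n + 1 := Int.lt_floor_add_one _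
  rw [Real.le_logb_iff_rpow_le (by norm_num) (by positivity)] at h1
  rw [Real.logb_lt_iff_lt_rpow (by norm_num) (by positivity)] at h2
  rw [Real.rpow_add (by norm_num), Real.rpow_one] at h2
  rw [Real.rpow_intCast] at h1 h2
  rw [zpow_neg]
  have hp : (0 : ℝ) < 2 ^ n := by positivity
  refine ⟨by positivity, ?_, ?_⟩
  · exact (le_inv_comm₀ hp hx).1 h1
  · rw [inv_le_iff_one_le_mul₀ hp]
    have : 1 < 2 ^ n * 2 * x := by rwa [inv_lt_iff_one_lt_mul₀ hx] at h2
    nlinarith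

open Classical in
/-- first projection of a finite set of pairs -/
def PF {α γ : Type*} (G : Finset (α × γ)) : Finset α := G.image Prod.fst

open Classical in
lemma fib_card {α γ : Type*} (G : Finset (α × γ)) (p : α) :
    (G.filter (fun ω => ω.1 = p)).card = Nat.card ({j | (p, j) ∈ (G : Set (α × γ))} : Set γ) := by
  have h : ({j | (p, j) ∈ (G : Set (α × γ))} : Set γ) =
      ((G.filter (fun ω => ω.1 = p)).image Prod.snd : Finset γ) := by
    ext j
    simp only [Finset.mem_coe, Finset.coe_image, Set.mem_image, Finset.mem_filter]
    constructor
    · intro h; exact ⟨(p, j), ⟨h, rfl⟩, rfl⟩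
    · rintro ⟨⟨a, b⟩, ⟨h1, rfl⟩, rfl⟩; exact h1
  have h2 : Nat.card ({j | (p, j) ∈ (G : Set (α × γ))} : Set γ) =
      Set.ncard ({j | (p, j) ∈ (G : Set (α × γ))} : Set γ) := rfl
  rw [h2, h, Set.ncard_coe_finset, Finset.card_image_of_injOn]
  rintro ⟨a, b⟩ h1 ⟨c, d⟩ h2 h3
  simp only [Finset.coe_filter] at h1 h2
  have e1 := h1.2; have e2 := h2.2
  simp only at e1 e2 h3
  rw [e1, e2, h3]

lemma CF_fib {G : Finset DPair} {M : ℕ} : CF G M ↔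
    ∀ p ∈ PF G, Nat.card (configE (G : Set DPair) p) = M := by
  unfold CF PF
  constructor
  · intro h p hp; rw [← h p hp]; exact (fib_card G p).symm
  · intro h p hp; rw [← h p hp]; exact (fib_card G p)

lemma configP_coe (G : Finset DPair) : configP (G : Set DPair) = (PF G : Set CubeIdx) := by
  unfold configP PF; simp

lemma configP_card (G : Finset DPair) : Nat.card (configP (G : Set DPair)) = (PF G).card := by
  rw [configP_coe]; exact Set.ncard_coe_finset _

lemma cfg_facts {lam σ s C : ℝ} {M : ℕ} {Ω : Set DPair} (hlam : 0 < lam) (hσ : 0 < σ) (hC : 0 ≤ C)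
    (h : IsConfigD lam σ s C M Ω) :
    Ω.Finite ∧ (∀ k ∈ configP Ω, cubeCtr lam k ∈ domD) ∧ (configP Ω).Finite ∧ 1 ≤ M ∧
    1 ≤ 81 * C * σ ^ s * M ∧ (M : ℝ) ≤ σ⁻¹ + 1 ∧
    ∀ t, lam ≤ t → ∀ b, ∀ B : Finset CubeIdx, (∀ b' ∈ B, b' ∈ configP Ω ∧
      pdist (cubeCtr lam b') b ≤ t) → (B.card : ℝ) ≤ C * t ^ s * Nat.card (configP Ω) := by
  obtain ⟨⟨k₀, hk₀⟩, h2, ⟨-, h3⟩, h4⟩ := h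
  have hdom : ∀ k ∈ configP Ω, cubeCtr lam k ∈ domD := fun k hk => h2 k hk (ctr_mem hlam k)
  have hPf := dom_finite hlam _ hdom
  obtain ⟨⟨k₁, j₀⟩, hω, hk⟩ := hk₀
  simp only at hk
  subst hk
  have hk₁ : k₁ ∈ configP Ω := ⟨_, hω, rfl⟩
  obtain ⟨e1, ⟨-, e2⟩, e3⟩ := h4 _ hk₁
  have hEf := valid_finite σ _ e1
  have hj₀ : j₀ ∈ configE Ω k₁ := hω
  have hM1 : 1 ≤ M := by
    rw [← e3]
    have : Nonempty (configE Ω k₁) := ⟨⟨j₀, hj₀⟩⟩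
    have : Finite (configE Ω k₁) := hEf
    exact Nat.card_pos
  have hd := hdom _ hk₁
  obtain ⟨f1, f2⟩ := arcs_count_le (cubeCtr lam k₁) hσ (by linarith [hd.2.1]) hd.2.2 _ hEf
  refine ⟨?_, hdom, hPf, hM1, ?_, ?_, ?_⟩
  · apply Set.Finite.subset (hPf.prod (Finset.Icc (0 : ℤ) ⌊σ⁻¹⌋).finite_toSet)
    rintro ⟨k, j⟩ hkj
    have hkP : k ∈ configP Ω := ⟨_, hkj, rfl⟩
    have := (h4 k hkP).1 j hkj
    refine ⟨hkP, ?_⟩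
    simp only [Finset.coe_Icc, Set.mem_Icc]
    exact ⟨this.1, Int.le_floor.2 this.2.le⟩
  · have := e2 (arcCenterAt (cubeCtr lam k₁) σ j₀) σ le_rfl
    have hpos : 1 ≤ count2 σ ((⋃ j ∈ configE Ω k₁, arcSet (cubeCtr lam k₁) σ j) ∩
        closedBall (arcCenterAt (cubeCtr lam k₁) σ j₀) σ) := by
      unfold count2
      have hf := f1.subset (Set.image_mono (Set.inter_subset_left
        (t := closedBall (arcCenterAt (cubeCtr lam k₁) σ j₀) σ)))
      have := hf.to_subtype
      have hn : Nonempty ↑(idx2 σ '' ((⋃ j ∈ configE Ω k₁, arcSet (cubeCtr lam k₁) σ j) ∩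
        closedBall (arcCenterAt (cubeCtr lam k₁) σ j₀) σ)) := by
        refine ⟨⟨_, Set.mem_image_of_mem _ ⟨?_, mem_closedBall_self hσ.le⟩⟩⟩
        simp only [Set.mem_iUnion, exists_prop]
        exact ⟨j₀, hj₀, arc_center_mem _ hσ _⟩
      exact Nat.card_pos
    have hpos' := (Nat.one_le_cast (α := ℝ)).2 hpos
    have hσs : 0 ≤ σ ^ s := (Real.rpow_pos_of_pos hσ s).le
    rw [e3] at f2
    calc (1 : ℝ) ≤ _ := hpos'
      _ ≤ _ := this
      _ ≤ C * σ ^ s * (81 * M) := by gcongr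
      _ = _ := by ring
  · have hsub : configE Ω k₁ ⊆ (Finset.Icc ⌈(0 : ℝ)⌉ ⌊σ⁻¹⌋ : Finset ℤ) := by
      intro j hj
      simp only [Finset.coe_Icc, Set.mem_Icc, Int.ceil_zero]
      exact ⟨(e1 j hj).1, Int.le_floor.2 (e1 j hj).2.le⟩
    have h5 := Set.ncard_le_ncard hsub (Finset.finite_toSet _)
    rw [Set.ncard_coe_finset] at h5
    have h6 : M ≤ (Finset.Icc ⌈(0 : ℝ)⌉ ⌊σ⁻¹⌋).card := by rw [← e3]; exact h5
    have h7 : (M : ℝ) ≤ (Finset.Icc ⌈(0 : ℝ)⌉ ⌊σ⁻¹⌋).card := by exact_mod_cast h6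
    have := int_count 0 σ⁻¹ (by positivity)
    linarith
  · intro t ht b B hB
    have := h3 b t ht
    rw [count3_cubes hlam] at this
    refine le_trans ?_ this
    have hsub : (B : Set CubeIdx) ⊆ idx3 lam '' ((⋃ k ∈ configP Ω, cubeSet lam k) ∩ {q | pdist q b ≤ t}) := by
      intro k hk
      obtain ⟨h5, h6⟩ := hB k hk
      refine ⟨cubeCtr lam k, ⟨?_, h6⟩, (idx3_eq_iff hlam _ _).2 (ctr_mem hlam k)⟩
      simp only [Set.mem_iUnion, exists_prop]
      exact ⟨k, h5, ctr_mem hlam k⟩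
    have hf : (idx3 lam '' ((⋃ k ∈ configP Ω, cubeSet lam k) ∩ {q | pdist q b ≤ t})).Finite := by
      refine Set.Finite.subset ?_ (Set.image_mono Set.inter_subset_left)
      rw [idx3_image hlam]; exact hPf
    have := Set.ncard_le_ncard hsub hf
    rw [Set.ncard_coe_finset] at this
    exact_mod_cast this

open Classical in
lemma sub_config {lam σ s C : ℝ} {M : ℕ} {Ω : Set DPair} (hlam : 0 < lam) (hσ : 0 < σ) (hC : 0 ≤ C)
    (h : IsConfigD lam σ s C M Ω) (G : Finset DPair) (hG : (G : Set DPair) ⊆ Ω) (hn : G.Nonempty)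
    (M' : ℕ) (hcf : CF G M') (c : ℝ) (hc : 0 < c)
    (hP : c * (Nat.card (configP Ω) : ℝ) ≤ Nat.card (configP (G : Set DPair)))
    (hM : c * (M : ℝ) ≤ M') : IsConfigD lam σ s (1296 / c * C) M' (G : Set DPair) := by
  obtain ⟨-, hdom, hPf, -, -, -, -⟩ := cfg_facts hlam hσ hC h
  obtain ⟨-, h2, h3, h4⟩ := h
  have hsub : configP (G : Set DPair) ⊆ configP Ω := Set.image_mono hG
  refine ⟨?_, fun k hk => h2 k (hsub hk), dset3_sub hlam hC _ _ hPf hsub c hc hP h3, ?_⟩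
  · obtain ⟨ω, hω⟩ := hn
    exact ⟨ω.1, ω, hω, rfl⟩
  · intro k hk
    obtain ⟨e1, e2, e3⟩ := h4 k (hsub hk)
    have hE : configE (G : Set DPair) k ⊆ configE Ω k := fun j hj => hG hj
    have hcard : Nat.card (configE (G : Set DPair) k) = M' := by
      apply CF_fib.1 hcf; rw [configP_coe] at hk; exact hk
    have hd := hdom k (hsub hk)
    exact ⟨fun j hj => e1 j (hE hj), dset2_sub _ hσ hC hd.2.1 hd.2.2 _ _ e1 hE c hc
      (by rw [e3, hcard]; exact hM) e2, hcard⟩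

lemma numeric (n n' M M' m μ K N F τs ls Ss lk : ℝ) (hn : 0 < n) (hn' : 0 < n') (hM' : 0 < M')
    (hK : 1 ≤ K) (hN : N + 1 ≤ 3 * K) (hF : 0 < F) (hτ : 0 < τs) (hls : 0 < ls) (hSs : 0 < Ss)
    (hlk : 0 < lk) (hM0 : 0 ≤ M)
    (hμ : 0 < μ) (hMF : M ≤ F * M') (h1 : 1 ≤ 81 * K * Ss * M) (hS2 : Ss ^ 2 * τs ≤ 4 * ls)
    (hm : ls * lk * n < m)
    (H : (n' * M' / 2 * (μ * m)) ^ 4 ≤ (10 ^ 12 * K ^ 6) ^ 4 * (1600 * K ^ 2) ^ 8 * (n' ^ 4 * (K * τs * n) *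
        (2 * (N + 1) * (1600 * K ^ 2) * M' ^ 2 * m ^ 3))) :
    μ ^ 4 * lk ≤ (26244 * 16 * (10 ^ 12) ^ 4 * 1600 ^ 8 * 9600) * F ^ 2 * K ^ 46 := by
  have hK0 : 0 < K := by linarith
  have hm0 : 0 < m := lt_trans (by positivity) hm
  have s1 : μ ^ 4 * M' ^ 2 * m ≤ 16 * (10 ^ 12) ^ 4 * 1600 ^ 8 * 9600 * K ^ 44 * τs * n := by
    have : (n' ^ 4 * M' ^ 2 * m ^ 3) * (μ ^ 4 * M' ^ 2 * m) ≤
        (n' ^ 4 * M' ^ 2 * m ^ 3) * (16 * (10 ^ 12) ^ 4 * 1600 ^ 8 * 9600 * K ^ 44 * τs * n) := by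
      calc _ = 16 * (n' * M' / 2 * (μ * m)) ^ 4 := by ring
        _ ≤ 16 * ((10 ^ 12 * K ^ 6) ^ 4 * (1600 * K ^ 2) ^ 8 * (n' ^ 4 * (K * τs * n) *
        (2 * (N + 1) * (1600 * K ^ 2) * M' ^ 2 * m ^ 3))) := by gcongr
        _ ≤ 16 * ((10 ^ 12 * K ^ 6) ^ 4 * (1600 * K ^ 2) ^ 8 * (n' ^ 4 * (K * τs * n) *
        (2 * (3 * K) * (1600 * K ^ 2) * M' ^ 2 * m ^ 3))) := by gcongr
        _ = _ := by ring
    exact le_of_mul_le_mul_left this (by positivity)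
  have s2 : τs ≤ 26244 * K ^ 2 * ls * F ^ 2 * M' ^ 2 := by
    have a : 1 ≤ 81 * K * Ss * (F * M') := h1.trans (by gcongr)
    have b : 1 ≤ (81 * K * Ss * (F * M')) ^ 2 := one_le_pow₀ a
    calc τs = 1 * τs := by ring
      _ ≤ (81 * K * Ss * (F * M')) ^ 2 * τs := by gcongr
      _ = 6561 * K ^ 2 * F ^ 2 * M' ^ 2 * (Ss ^ 2 * τs) := by ring
      _ ≤ 6561 * K ^ 2 * F ^ 2 * M' ^ 2 * (4 * ls) := by gcongr
      _ = _ := by ring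
  have s3 : (n * ls * M' ^ 2) * (μ ^ 4 * lk) ≤ (n * ls * M' ^ 2) *
      ((26244 * 16 * (10 ^ 12) ^ 4 * 1600 ^ 8 * 9600) * F ^ 2 * K ^ 46) := by
    calc _ = μ ^ 4 * M' ^ 2 * (ls * lk * n) := by ring
      _ ≤ μ ^ 4 * M' ^ 2 * m := by gcongr
      _ ≤ _ := s1
      _ ≤ 16 * (10 ^ 12) ^ 4 * 1600 ^ 8 * 9600 * K ^ 44 * (26244 * K ^ 2 * ls * F ^ 2 * M' ^ 2) * n := by gcongr
      _ = _ := by ring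
  exact le_of_mul_le_mul_left s3 (by positivity)


open Classical in
lemma mem_PF {α γ : Type*} {G : Finset (α × γ)} {ω : α × γ} (h : ω ∈ G) : ω.1 ∈ PF G := by
  unfold PF; rw [Finset.mem_image]; exact ⟨ω, h, rfl⟩

lemma param_exists (κ ε A : ℝ) (hκ : 0 < κ) (hε : 0 < ε) (hε2 : ε ≤ κ / 1000) :
    ∃ lam₀ > (0 : ℝ), ∀ lam : ℝ, 0 < lam → lam ≤ lam₀ → lam ≤ 1 / 2 ∧
      (lam ^ 2)⁻¹ ≤ Real.exp (lam ^ (-ε)) ∧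
      A * (lam ^ (-ε)) ^ 46 < (lam ^ (κ / 16)) ^ 4 * lam ^ (-κ) := by
  have t1 : ∀ b : ℝ, 0 < b → Filter.Tendsto (fun x : ℝ => x ^ (-b)) (nhdsWithin 0 (Ioi 0)) Filter.atTop := by
    intro b hb
    have := (tendsto_rpow_atTop hb).comp (tendsto_inv_nhdsGT_zero (𝕜 := ℝ))
    refine this.congr' ?_
    filter_upwards [self_mem_nhdsWithin] with x hx
    have hx : 0 < x := hx
    simp only [Function.comp]
    rw [Real.inv_rpow hx.le, Real.rpow_neg hx.le]
  have e1 := (tendsto_exp_div_rpow_atTop (2 / ε)).comp (t1 ε hε)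
  have e2 := t1 (3 * κ / 4 - 46 * ε) (by linarith)
  have h := ((Filter.tendsto_atTop.1 e1 1).and (e2.eventually_gt_atTop A)).and
    (Ioo_mem_nhdsGT (show (0 : ℝ) < 1 / 2 by norm_num))
  obtain ⟨u, hu, hsub⟩ := (mem_nhdsGT_iff_exists_Ioc_subset).1 h
  refine ⟨u, hu, fun lam h0 h1 => ?_⟩
  obtain ⟨⟨f1, f2⟩, f3⟩ := hsub ⟨h0, h1⟩
  refine ⟨f3.2.le, ?_, ?_⟩
  · simp only [Function.comp] at f1
    rw [one_le_div (by positivity), ← Real.rpow_mul h0.le] at f1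
    have : (lam ^ 2)⁻¹ = lam ^ (-ε * (2 / ε)) := by
      rw [show -ε * (2 / ε) = -(2 : ℕ) by field_simp; norm_num, Real.rpow_neg h0.le, Real.rpow_natCast]
    rw [this]; exact f1
  · have a1 : (lam ^ (κ / 16)) ^ 4 * lam ^ (-κ) = lam ^ (-(3 * κ / 4 - 46 * ε)) * (lam ^ (-ε)) ^ 46 := by
      rw [← Real.rpow_mul_natCast h0.le, ← Real.rpow_mul_natCast h0.le, ← Real.rpow_add h0, ← Real.rpow_add h0]
      congr 1; push_cast; ring
    rw [a1]
    exact mul_lt_mul_of_pos_right f2 (by positivity)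

open Classical in
lemma core (κ s ε lam t : ℝ) (J : ℕ) (hκ : 0 < κ) (hs : 0 < s) (hs1 : s ≤ 1) (hε : 0 < ε) (hε1 : ε ≤ 1 / 2)
    (hJ : 3 ≤ κ / 16 * J) (hlam : 0 < lam) (hl2 : lam ≤ 1 / 2)
    (hexp : (lam ^ 2)⁻¹ ≤ Real.exp (lam ^ (-ε)))
    (hbig : (26244 * 16 * (10 ^ 12) ^ 4 * 1600 ^ 8 * 9600) * ((4 : ℝ) ^ J) ^ 2 * (lam ^ (-ε)) ^ 46 <
      (lam ^ (κ / 16)) ^ 4 * lam ^ (-κ)) (ht : lam ≤ t) (ht1 : t ≤ 1) (Ω : Set DPair) (M : ℕ)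
    (hΩ : IsConfigD lam (dyadicCeil (Real.sqrt (lam / t))) s (lam ^ (-ε)) M Ω) :
    ∃ G : Finset DPair, (G : Set DPair) ⊆ Ω ∧
      (∃ M' : ℕ, IsConfigD lam (dyadicCeil (Real.sqrt (lam / t))) s (1296 * 4 ^ J * lam ^ (-ε)) M' (G : Set DPair)) ∧
      ((4 : ℝ) ^ J)⁻¹ * ((4 : ℝ) ^ J)⁻¹ * (Nat.card Ω : ℝ) ≤ G.card ∧
      ∀ ω ∈ G, ((G.filter (fun ω' => TT lam (lam ^ (-ε)) t (dyadicCeil (Real.sqrt (lam / t))) ω ω')).card : ℝ) ≤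
        lam ^ (s - κ) * (Nat.card (configP Ω) : ℝ) := by
  set S := dyadicCeil (Real.sqrt (lam / t)) with hSd
  set K := lam ^ (-ε) with hKd
  have ht0 : 0 < t := hlam.trans_le ht
  have hlt : 0 < lam / t := by positivity
  obtain ⟨hS, hS1, hS2⟩ := dyadic_facts (Real.sqrt_pos.2 hlt)
  rw [← hSd] at hS hS1 hS2
  have hlamS : lam ≤ S := by
    refine le_trans ?_ hS1
    apply Real.le_sqrt_of_sq_le
    rw [le_div_iff₀ ht0]
    nlinarith [mul_pos hlam hlam, sq_nonneg lam]
  have hSsq : lam / t ≤ S ^ 2 := by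
    rw [← Real.sq_sqrt hlt.le]; gcongr
  have hSsq2 : S ^ 2 * t ≤ 4 * lam := by
    have : S ^ 2 ≤ (2 * Real.sqrt (lam / t)) ^ 2 := by gcongr
    rw [mul_pow, Real.sq_sqrt hlt.le] at this
    calc S ^ 2 * t ≤ (2 ^ 2 * (lam / t)) * t := by gcongr
      _ = 4 * lam := by field_simp; norm_num
  have hK : 1 ≤ K := Real.one_le_rpow_of_pos_of_le_one_of_nonpos hlam (by linarith) (by linarith)
  have hK0 : 0 < K := by linarith
  have hKlam : K * lam ≤ 1 := by
    have : K * lam = lam ^ (1 - ε) := by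
      rw [hKd, show 1 - ε = -ε + 1 by ring, Real.rpow_add hlam, Real.rpow_one]
    rw [this]; exact Real.rpow_le_one hlam.le (by linarith) (by linarith)
  obtain ⟨hfin, hdom, hPf, hM1, hMS, hMle, hball⟩ := cfg_facts hlam hS hK0.le hΩ
  set n : ℝ := (Nat.card (configP Ω) : ℝ) with hn
  set W : Finset DPair := hfin.toFinset with hW
  have hWΩ : (W : Set DPair) = Ω := hfin.coe_toFinset
  have hn0 : 0 < n := by
    have h1 : Nonempty (configP Ω) := hΩ.1.to_subtype
    have h2 : Finite (configP Ω) := hPf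
    rw [hn]; exact_mod_cast Nat.card_pos
  have hWn : W.Nonempty := by
    obtain ⟨k, ω, hω, -⟩ := hΩ.1
    exact ⟨ω, by rw [hW, hfin.mem_toFinset]; exact hω⟩
  have hPW : (PF W).card = Nat.card (configP Ω) := by rw [← configP_card, hWΩ]
  have hCFW : CF W M := by
    rw [CF_fib, hWΩ]
    intro p hp
    refine (hΩ.2.2.2 p ?_).2.2
    rw [← hWΩ, configP_coe]; exact hp
  have hcardW : W.card = (PF W).card * M := CF_card hCFW
  have hls : 0 < lam ^ s := by positivity
  set μ := lam ^ (κ / 16) with hμ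
  have hμ0 : 0 < μ := by positivity
  obtain ⟨G, hGW, M', g1, g2, g3, g4, g5, g6⟩ := iterate_core W (TT lam K t S) M hM1 hCFW hWn
    (fun j => μ ^ j * (2 * lam⁻¹ * n)) (lam ^ (s - κ) * n) J
    (by
      intro ω _
      have : ((W.filter (fun ω' => TT lam K t S ω ω')).card : ℝ) ≤ W.card := by
        exact_mod_cast Finset.card_filter_le _ _
      refine this.trans ?_
      rw [hcardW, hPW]; push_cast
      rw [← hn, pow_zero, one_mul]
      have h2 : S⁻¹ ≤ lam⁻¹ := inv_anti₀ hlam hlamS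
      have h3 : 1 ≤ lam⁻¹ := (one_le_inv₀ hlam).2 (by linarith)
      have h4 : (M : ℝ) ≤ 2 * lam⁻¹ := by linarith
      calc n * M ≤ n * (2 * lam⁻¹) := by gcongr
        _ = _ := by ring)
    (by
      intro j hj G hG M' hcf hM' hGn hMM hmult htgt
      by_contra hcon
      have hGΩ : (G : Set DPair) ⊆ Ω := by rw [← hWΩ]; exact_mod_cast hG
      have hPG : ∀ k ∈ PF G, k ∈ configP Ω := by
        intro k hk
        have : k ∈ configP (G : Set DPair) := by rw [configP_coe]; exact hk
        exact Set.image_mono hGΩ this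
      have hmem : ∀ ω ∈ G, ω.1 ∈ PF G := fun ω hω => by
        exact mem_PF hω
      set m : ℝ := μ ^ j * (2 * lam⁻¹ * n) with hm
      have hm0 : 0 < m := by positivity
      have hedge := bad_edges G (TT lam K t S) (μ ^ (j + 1) * (2 * lam⁻¹ * n)) (by positivity) hcon
      have hmm : μ ^ (j + 1) * (2 * lam⁻¹ * n) = μ * m := by rw [hm, pow_succ]; ring
      rw [hmm] at hedge
      have hNle : K ≤ ⌈K⌉₊ := Nat.le_ceil K
      have hNlt : (⌈K⌉₊ : ℝ) < K + 1 := Nat.ceil_lt_add_one hK0.le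
      have h4N : (lam ^ 2)⁻¹ ≤ (4 : ℝ) ^ ⌈K⌉₊ := by
        calc (lam ^ 2)⁻¹ ≤ Real.exp K := hexp
          _ ≤ Real.exp (⌈K⌉₊ : ℝ) := Real.exp_le_exp.2 hNle
          _ = Real.exp 1 ^ ⌈K⌉₊ := by rw [← Real.exp_nat_mul, mul_one]
          _ ≤ _ := by
            gcongr
            linarith [Real.exp_one_lt_d9]
      have hstep := step_apply lam K t S hlam ht0 hK hS hSsq hKlam G (PF G) hmem
        (fun k hk => hdom k (hPG k hk))
        (fun ω hω => (hΩ.2.2.2 ω.1 (hPG _ (hmem ω hω))).1 ω.2 (hGΩ hω))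
        ⌈K⌉₊
        (by
          have h1 : 1 ≤ (4 : ℝ) ^ ⌈K⌉₊ * lam ^ 2 := by
            rwa [inv_le_iff_one_le_mul₀ (by positivity)] at h4N
          have h2 : lam ^ 2 ≤ K ^ 2 * lam * t := by
            have : 1 ≤ K ^ 2 := one_le_pow₀ hK
            calc lam ^ 2 = 1 * lam * lam := by ring
              _ ≤ _ := by gcongr
          have h3 : (4 : ℝ) ^ ⌈K⌉₊ * lam ^ 2 ≤ (4 : ℝ) ^ ⌈K⌉₊ * (K ^ 2 * lam * t) := by gcongr
          nlinarith)
        (M' : ℝ)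
        (by
          intro w hw V hV
          have h1 := CF_fib.1 hcf w hw
          have h2 : (V : Set ℤ) ⊆ configE (G : Set DPair) w := fun v hv => hV v hv
          have h3 : (configE (G : Set DPair) w).Finite := by
            refine (G.image Prod.snd).finite_toSet.subset ?_
            intro v hv
            rw [Finset.mem_coe, Finset.mem_image]
            exact ⟨(w, v), hv, rfl⟩
          have h4 := Set.ncard_le_ncard h2 h3
          rw [Set.ncard_coe_finset] at h4
          have h5 : V.card ≤ M' := by rw [← h1]; exact h4
          exact_mod_cast h5)
        (by positivity) m hm0.le (fun ω hω => by convert hmult ω hω)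
        (K * t ^ s * n) (by positivity)
        (fun b hb B hB => hball t ht _ B (fun b' hb' => ⟨hPG _ (hB b' hb').1, (hB b' hb').2⟩))
      have hGc : (G.card : ℝ) = (PF G).card * M' := by
        have := CF_card hcf
        exact_mod_cast this
      have hP0 : (0 : ℝ) < (PF G).card := by
        obtain ⟨ω, hω⟩ := hGn
        exact_mod_cast Finset.card_pos.2 ⟨_, hmem ω hω⟩
      have hM'0 : (0 : ℝ) < M' := by exact_mod_cast hM'
      rw [hGc] at hedge
      have H : ((PF G).card * (M' : ℝ) / 2 * (μ * m)) ^ 4 ≤ _ :=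
        (pow_le_pow_left₀ (by positivity) hedge 4).trans (by convert hstep)
      have hfinal := numeric n (PF G).card M M' m μ K ⌈K⌉₊ (4 ^ J) (t ^ s) (lam ^ s) (S ^ s) (lam ^ (-κ))
        hn0 hP0 hM'0 hK (by linarith) (by positivity) (by positivity) hls (by positivity) (by positivity)
        (by positivity) hμ0
        (by
          have h1 : (M : ℝ) ≤ 4 ^ j * M' := by exact_mod_cast hMM
          refine h1.trans ?_
          gcongr
          · norm_num)
        hMS
        (by
          have h1 : (S ^ s) ^ 2 * t ^ s = (S ^ 2 * t) ^ s := by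
            rw [Real.mul_rpow (by positivity) ht0.le, ← Real.rpow_natCast, ← Real.rpow_natCast,
              ← Real.rpow_mul hS.le, ← Real.rpow_mul hS.le, mul_comm s]
          rw [h1]
          calc (S ^ 2 * t) ^ s ≤ (4 * lam) ^ s := by gcongr
            _ = 4 ^ s * lam ^ s := Real.mul_rpow (by norm_num) hlam.le
            _ ≤ 4 ^ (1 : ℝ) * lam ^ s := by
              gcongr
              norm_num
            _ = _ := by rw [Real.rpow_one])
        (by
          rw [← Real.rpow_add hlam, ← sub_eq_add_neg]; exact htgt)
        H
      linarith)
  have hGΩ : (G : Set DPair) ⊆ Ω := by rw [← hWΩ]; exact_mod_cast hGW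
  have g4' : (M : ℝ) ≤ 4 ^ J * M' := by exact_mod_cast g4
  have g5' : n ≤ 4 ^ J * (PF G).card := by
    have h1 : (PF W).card ≤ 4 ^ J * (PF G).card := g5
    rw [hPW] at h1
    rw [hn]; exact_mod_cast h1
  have h4J : (0 : ℝ) < 4 ^ J := by positivity
  refine ⟨G, hGΩ, ⟨M', ?_⟩, ?_, fun ω hω => ?_⟩
  · have := sub_config hlam hS hK0.le hΩ G hGΩ g3 M' g1 ((4 : ℝ) ^ J)⁻¹ (by positivity)
      (by
        rw [configP_card, ← hn, inv_mul_le_iff₀ h4J]; exact g5')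
      (by rw [inv_mul_le_iff₀ h4J]; exact g4')
    rwa [div_inv_eq_mul] at this
  · have h1 : (G.card : ℝ) = (PF G).card * M' := by
      have := CF_card g1
      exact_mod_cast this
    have h2 : (Nat.card Ω : ℝ) = n * M := by
      have : Nat.card Ω = W.card := by
        rw [← hWΩ]; exact Set.ncard_coe_finset _
      rw [this, hcardW, hPW]; push_cast; rfl
    rw [h1, h2]
    rw [show ((4 : ℝ) ^ J)⁻¹ * ((4 : ℝ) ^ J)⁻¹ * (n * M) = (((4 : ℝ) ^ J)⁻¹ * n) * (((4 : ℝ) ^ J)⁻¹ * M) by ring]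
    have a1 : ((4 : ℝ) ^ J)⁻¹ * n ≤ (PF G).card := by rw [inv_mul_le_iff₀ h4J]; exact g5'
    have a2 : ((4 : ℝ) ^ J)⁻¹ * M ≤ M' := by rw [inv_mul_le_iff₀ h4J]; exact g4'
    gcongr
  · refine (g6 ω hω).trans (max_le ?_ le_rfl)
    have h1 : μ ^ J ≤ lam ^ 3 := by
      rw [hμ, ← Real.rpow_mul_natCast hlam.le, ← Real.rpow_natCast]
      exact Real.rpow_le_rpow_of_exponent_ge hlam (by linarith) (by push_cast; exact hJ)
    have h2 : lam ≤ lam ^ (s - κ) := by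
      conv_lhs => rw [← Real.rpow_one lam]
      exact Real.rpow_le_rpow_of_exponent_ge hlam (by linarith) (by linarith)
    calc μ ^ J * (2 * lam⁻¹ * n) ≤ lam ^ 3 * (2 * lam⁻¹ * n) := by gcongr
      _ = (2 * lam) * lam * n := by field_simp
      _ ≤ 1 * lam * n := by gcongr; linarith
      _ ≤ _ := by rw [one_mul]; gcongr

lemma final_thm :
    ∀ κ : ℝ, 0 < κ →
    ∃ Cκ : ℝ, 1 ≤ Cκ ∧ ∃ cκ > (0 : ℝ),
    ∀ s : ℝ, 0 < s → s ≤ 1 →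
    ∃ ε ∈ Set.Ioc (0 : ℝ) (1 / 2), ∃ lam₀ > (0 : ℝ),
    ∀ lam : ℝ, 0 < lam → lam ≤ lam₀ → ∀ t : ℝ, lam ≤ t → t ≤ 1 →
    ∀ (Ω : Set DPair) (M : ℕ),
      IsConfigD lam (dyadicCeil (Real.sqrt (lam / t))) s (lam ^ (-ε)) M Ω →
      ∃ G ⊆ Ω,
        (∃ M' : ℕ,
          IsConfigD lam (dyadicCeil (Real.sqrt (lam / t))) s (Cκ * lam ^ (-ε)) M' G) ∧
        cκ * (Nat.card Ω : ℝ) ≤ (Nat.card G : ℝ) ∧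
        ∀ ω ∈ G,
          (Nat.card {ω' : DPair | ω' ∈ G ∧
              tang (cubeCtr lam ω.1) (cubeCtr lam ω'.1) ≤ lam ^ (1 - ε) ∧
              lam ^ ε * t ≤ pdist (cubeCtr lam ω.1) (cubeCtr lam ω'.1) ∧
              pdist (cubeCtr lam ω.1) (cubeCtr lam ω'.1) ≤ lam ^ (-ε) * t ∧
              (rect (lam ^ (-ε) * lam) (lam ^ (-ε) * dyadicCeil (Real.sqrt (lam / t)))
                  (cubeCtr lam ω.1)
                  (arcCenterAt (cubeCtr lam ω.1) (dyadicCeil (Real.sqrt (lam / t))) ω.2) ∩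
                rect (lam ^ (-ε) * lam) (lam ^ (-ε) * dyadicCeil (Real.sqrt (lam / t)))
                  (cubeCtr lam ω'.1)
                  (arcCenterAt (cubeCtr lam ω'.1) (dyadicCeil (Real.sqrt (lam / t)))
                    ω'.2)).Nonempty} : ℝ) ≤
            lam ^ (s - κ) * (Nat.card (configP Ω) : ℝ) := by
  classical
  intro κ hκ
  set J := ⌈48 / κ⌉₊ with hJ
  have hJ3 : 3 ≤ κ / 16 * J := by
    have : 48 / κ ≤ J := Nat.le_ceil _
    rw [div_le_iff₀ hκ] at this
    linarith
  have h4J : (1 : ℝ) ≤ 4 ^ J := one_le_pow₀ (by norm_num)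
  refine ⟨1296 * 4 ^ J, by linarith, ((4 : ℝ) ^ J)⁻¹ * ((4 : ℝ) ^ J)⁻¹, by positivity, ?_⟩
  intro s hs hs1
  have hε : 0 < min (κ / 1000) (1 / 2) := by positivity
  have hε1 : min (κ / 1000) (1 / 2) ≤ 1 / 2 := min_le_right _ _
  obtain ⟨lam₀, hl0, hl⟩ := param_exists κ (min (κ / 1000) (1 / 2))
    ((26244 * 16 * (10 ^ 12) ^ 4 * 1600 ^ 8 * 9600) * ((4 : ℝ) ^ J) ^ 2) hκ hε (min_le_left _ _)
  refine ⟨min (κ / 1000) (1 / 2), ⟨hε, min_le_right _ _⟩, lam₀, hl0, ?_⟩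
  generalize min (κ / 1000) (1 / 2) = ε at *
  intro lam hlam hlam0 t ht ht1 Ω M hΩ
  obtain ⟨p1, p2, p3⟩ := hl lam hlam hlam0
  obtain ⟨G, q1, q2, q3, q4⟩ := core κ s ε lam t J hκ hs hs1 hε hε1 hJ3 hlam p1 p2 p3 ht ht1 Ω M hΩ
  have hcG : Nat.card (G : Set DPair) = G.card := Set.ncard_coe_finset G
  refine ⟨G, q1, q2, by rw [hcG]; exact q3, fun ω hω => ?_⟩
  refine le_trans (le_of_eq ?_) (q4 ω hω)
  congr 1
  rw [← Set.ncard_coe_finset]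
  show Set.ncard _ = _
  congr 1
  ext ω'
  have r1 : lam ^ (1 - ε) = lam ^ (-ε) * lam := by
    rw [show 1 - ε = -ε + 1 by ring, Real.rpow_add hlam, Real.rpow_one]
  have r2 : lam ^ ε * t = t / lam ^ (-ε) := by
    rw [Real.rpow_neg hlam.le, div_inv_eq_mul, mul_comm]
  rw [Finset.mem_coe, Finset.mem_filter, r1, r2]
  rfl


/-- for every `κ > 0` and `s ∈ (0,1]`, after passing to a positive
proportion sub-configuration `G` of a `(λ,Σ,s,λ^{-ε})`-configuration `Ω`, every `(p,v) ∈ G`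
makes at most `λ^{s-κ}|P|` tangent intersections of distance `≈ t` inside `G`. -/
theorem prop_high_tangency :
    ∀ κ : ℝ, 0 < κ →
    ∃ Cκ : ℝ, 1 ≤ Cκ ∧ ∃ cκ > (0 : ℝ),
    ∀ s : ℝ, 0 < s → s ≤ 1 →
    ∃ ε ∈ Set.Ioc (0 : ℝ) (1 / 2), ∃ lam₀ > (0 : ℝ),
    ∀ lam : ℝ, 0 < lam → lam ≤ lam₀ → ∀ t : ℝ, lam ≤ t → t ≤ 1 →
    ∀ (Ω : Set DPair) (M : ℕ),
      IsConfigD lam (dyadicCeil (Real.sqrt (lam / t))) s (lam ^ (-ε)) M Ω →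
      ∃ G ⊆ Ω,
        (∃ M' : ℕ,
          IsConfigD lam (dyadicCeil (Real.sqrt (lam / t))) s (Cκ * lam ^ (-ε)) M' G) ∧
        cκ * (Nat.card Ω : ℝ) ≤ (Nat.card G : ℝ) ∧
        ∀ ω ∈ G,
          (Nat.card {ω' : DPair | ω' ∈ G ∧
              tang (cubeCtr lam ω.1) (cubeCtr lam ω'.1) ≤ lam ^ (1 - ε) ∧
              lam ^ ε * t ≤ pdist (cubeCtr lam ω.1) (cubeCtr lam ω'.1) ∧
              pdist (cubeCtr lam ω.1) (cubeCtr lam ω'.1) ≤ lam ^ (-ε) * t ∧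
              (rect (lam ^ (-ε) * lam) (lam ^ (-ε) * dyadicCeil (Real.sqrt (lam / t)))
                  (cubeCtr lam ω.1)
                  (arcCenterAt (cubeCtr lam ω.1) (dyadicCeil (Real.sqrt (lam / t))) ω.2) ∩
                rect (lam ^ (-ε) * lam) (lam ^ (-ε) * dyadicCeil (Real.sqrt (lam / t)))
                  (cubeCtr lam ω'.1)
                  (arcCenterAt (cubeCtr lam ω'.1) (dyadicCeil (Real.sqrt (lam / t)))
                    ω'.2)).Nonempty} : ℝ) ≤
            lam ^ (s - κ) * (Nat.card (configP Ω) : ℝ) := by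
  exact final_thm

end
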